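/- Let Ω be a bounded pseudoconvex domain in ℂ^n and z₀ ∈ ∂Ω. Suppose W ⊂⊂ U are small open neighborhoods of z₀. Then there exists a positive constant C₂ such that I²_{U∩Ω}(p;X,Y) ≤ I²_Ω(p;X,Y) ≤ C₂ · I²_{U∩Ω}(p;X,Y) for all p ∈ W ∩ Ω and all X, Y ∈ ℂ^n. -/

import Mathlib

open MeasureTheory Complex Topology Filter Set

noncomputable section

/-! ### Wirtinger derivatives and complex Hessians on ℂⁿ -/

/-- The Wirtinger derivative `∂u/∂z_j` of a function `u : ℂⁿ → ℂ` at `z`. -/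
def wder (n : ℕ) (j : Fin n) (u : (Fin n → ℂ) → ℂ) (z : Fin n → ℂ) : ℂ :=
  (1 / 2) * (fderiv ℝ u z (Pi.single j 1) - Complex.I * fderiv ℝ u z (Pi.single j Complex.I))

/-- The conjugate Wirtinger derivative `∂u/∂z̄_j` of a function `u : ℂⁿ → ℂ` at `z`. -/
def wderBar (n : ℕ) (j : Fin n) (u : (Fin n → ℂ) → ℂ) (z : Fin n → ℂ) : ℂ :=
  (1 / 2) * (fderiv ℝ u z (Pi.single j 1) + Complex.I * fderiv ℝ u z (Pi.single j Complex.I))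

/-- The complex Hessian `∂²φ/∂z_j∂z̄_k` of a real-valued function `φ` at `z`. -/
def cHess (n : ℕ) (φ : (Fin n → ℂ) → ℝ) (z : Fin n → ℂ) (j k : Fin n) : ℂ :=
  wderBar n k (fun w => wder n j (fun v => (φ v : ℂ)) w) z

/-- The (real part of the) Hermitian form `Σ_{j,k} H_{jk} X_j conj (Y_k)`. -/
def hermForm (n : ℕ) (H : Fin n → Fin n → ℂ) (X Y : Fin n → ℂ) : ℝ :=
  (∑ j, ∑ k, H j k * X j * starRingEnd ℂ (Y k)).re

/-! ### The Bergman space, Bergman kernel, minimum integrals -/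

/-- Membership in the Bergman space `A²(Ω)`: holomorphic and square-integrable on `Ω`. -/
def InBergman (n : ℕ) (Ω : Set (Fin n → ℂ)) (f : (Fin n → ℂ) → ℂ) : Prop :=
  DifferentiableOn ℂ f Ω ∧ IntegrableOn (fun z => ‖f z‖ ^ 2) Ω

/-- The squared `L²(Ω)`-norm `∫_Ω |f|²`. -/
def l2sq (n : ℕ) (Ω : Set (Fin n → ℂ)) (f : (Fin n → ℂ) → ℂ) : ℝ :=
  ∫ z in Ω, ‖f z‖ ^ 2

/-- The holomorphic directional derivative `Σ_i X_i ∂f/∂z_i(p)`. -/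
def holDeriv (n : ℕ) (f : (Fin n → ℂ) → ℂ) (p X : Fin n → ℂ) : ℂ :=
  ∑ i, X i * fderiv ℂ f p (Pi.single i 1)

/-- The second-order holomorphic derivative `Σ_{j,k} X_j Y_k ∂²f/∂z_j∂z_k(p)`. -/
def holDeriv2 (n : ℕ) (f : (Fin n → ℂ) → ℂ) (p X Y : Fin n → ℂ) : ℂ :=
  ∑ j, ∑ k, X j * Y k * fderiv ℂ (fun z => fderiv ℂ f z (Pi.single k 1)) p (Pi.single j 1)

/-- Bergman's minimum integral `I⁰_Ω(p)`. -/
def I0 (n : ℕ) (Ω : Set (Fin n → ℂ)) (p : Fin n → ℂ) : ℝ :=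
  sInf {r | ∃ f, InBergman n Ω f ∧ f p = 1 ∧ r = l2sq n Ω f}

/-- Bergman's minimum integral `I¹_Ω(p; X)`. -/
def I1 (n : ℕ) (Ω : Set (Fin n → ℂ)) (p X : Fin n → ℂ) : ℝ :=
  sInf {r | ∃ f, InBergman n Ω f ∧ f p = 0 ∧ holDeriv n f p X = 1 ∧ r = l2sq n Ω f}

/-- Bergman's minimum integral `I²_Ω(p; X, Y)`. -/
def I2 (n : ℕ) (Ω : Set (Fin n → ℂ)) (p X Y : Fin n → ℂ) : ℝ :=
  sInf {r | ∃ f, InBergman n Ω f ∧ f p = 0 ∧ fderiv ℂ f p = 0 ∧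
    holDeriv2 n f p X Y = 1 ∧ r = l2sq n Ω f}

/-- The Bergman kernel on the diagonal,
`K_Ω(p, p̄) = sup {|f(p)|² : f ∈ A²(Ω), ‖f‖_{L²(Ω)} ≤ 1}`. -/
def bergmanKernel (n : ℕ) (Ω : Set (Fin n → ℂ)) (p : Fin n → ℂ) : ℝ :=
  sSup {r | ∃ f, InBergman n Ω f ∧ l2sq n Ω f ≤ 1 ∧ r = ‖f p‖ ^ 2}

/-- The components `g_{jk̄}(z) = ∂² log K_Ω(z,z̄)/∂z_j∂z̄_k` of the Bergman metric. -/
def bergMetricMat (n : ℕ) (Ω : Set (Fin n → ℂ)) (z : Fin n → ℂ) (j k : Fin n) : ℂ :=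
  cHess n (fun w => Real.log (bergmanKernel n Ω w)) z j k

/-- The Bergman metric `g_Ω(z; X) = Σ_{j,k} g_{jk̄}(z) X_j X̄_k`. -/
def bergMetric (n : ℕ) (Ω : Set (Fin n → ℂ)) (z X : Fin n → ℂ) : ℝ :=
  hermForm n (bergMetricMat n Ω z) X X

/-- The inverse matrix `(g^{νμ̄})` of the Bergman metric. -/
def bergMetricInv (n : ℕ) (Ω : Set (Fin n → ℂ)) (z : Fin n → ℂ) : Matrix (Fin n) (Fin n) ℂ :=
  (Matrix.of (bergMetricMat n Ω z))⁻¹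

/-- The curvature tensor of the Bergman metric,
`R_{h̄jkl̄} = −∂²g_{jh̄}/∂z_k∂z̄_l + g^{νμ̄} (∂g_{jμ̄}/∂z_k)(∂g_{νh̄}/∂z̄_l)`. -/
def bergCurvTensor (n : ℕ) (Ω : Set (Fin n → ℂ)) (z : Fin n → ℂ) (h j k l : Fin n) : ℂ :=
  - wderBar n l (fun w => wder n k (fun v => bergMetricMat n Ω v j h) w) z
  + ∑ ν, ∑ μ, bergMetricInv n Ω z ν μ *
      wder n k (fun v => bergMetricMat n Ω v j μ) z *
      wderBar n l (fun v => bergMetricMat n Ω v ν h) z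

/-- The bisectional curvature of the Bergman metric,
`B_Ω(z;X,Y) = R_{h̄jkl̄} X̄_h X_j Y_k Ȳ_l / (g(z;X) g(z;Y))`. -/
def bisecCurv (n : ℕ) (Ω : Set (Fin n → ℂ)) (z X Y : Fin n → ℂ) : ℝ :=
  (∑ h, ∑ j, ∑ k, ∑ l, bergCurvTensor n Ω z h j k l *
      starRingEnd ℂ (X h) * X j * Y k * starRingEnd ℂ (Y l)).re /
    (bergMetric n Ω z X * bergMetric n Ω z Y)

/-- The holomorphic sectional curvature `H_Ω(z;X) = B_Ω(z;X,X)`. -/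
def holSecCurv (n : ℕ) (Ω : Set (Fin n → ℂ)) (z X : Fin n → ℂ) : ℝ := bisecCurv n Ω z X X

/-- The Ricci curvature `Ric_Ω(z;X) = Σ_j B_Ω(z;E^j,X)` (standard basis). -/
def ricciCurv (n : ℕ) (Ω : Set (Fin n → ℂ)) (z X : Fin n → ℂ) : ℝ :=
  ∑ j, bisecCurv n Ω z (Pi.single j 1) X

/-! ### Plurisubharmonicity and pseudoconvexity -/

/-- `u` is plurisubharmonic on `Ω`: upper semicontinuous and satisfying the sub-mean value
inequality on circles in complex lines contained in `Ω`. -/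
def PSHOn (n : ℕ) (u : (Fin n → ℂ) → ℝ) (Ω : Set (Fin n → ℂ)) : Prop :=
  UpperSemicontinuousOn u Ω ∧
  ∀ z ∈ Ω, ∀ w : Fin n → ℂ, ∀ r : ℝ, 0 < r →
    (∀ t : ℂ, ‖t‖ ≤ r → z + t • w ∈ Ω) →
    u z ≤ (1 / (2 * Real.pi)) *
      ∫ θ in (0:ℝ)..(2 * Real.pi), u (z + ((r : ℂ) * Complex.exp ((θ : ℂ) * Complex.I)) • w)

/-- A `C²` function `φ` is plurisubharmonic on `Ω` iff its complex Hessian is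
positive semidefinite at every point of `Ω`. -/
def PSHOnC2 (n : ℕ) (φ : (Fin n → ℂ) → ℝ) (Ω : Set (Fin n → ℂ)) : Prop :=
  ∀ z ∈ Ω, ∀ X : Fin n → ℂ, 0 ≤ hermForm n (cHess n φ z) X X

/-- `Ω` is pseudoconvex: it admits a continuous plurisubharmonic exhaustion function. -/
def PseudoconvexExh (n : ℕ) (Ω : Set (Fin n → ℂ)) : Prop :=
  ∃ u : (Fin n → ℂ) → ℝ, ContinuousOn u Ω ∧ PSHOn n u Ω ∧
    ∀ c : ℝ, ∃ K : Set (Fin n → ℂ), IsCompact K ∧ K ⊆ Ω ∧ {z ∈ Ω | u z ≤ c} ⊆ K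

/-! ### Smooth boundary, Levi form, Levi rank -/

/-- `ρ` is a (global) smooth defining function for the domain `Ω`. -/
def IsDefining (n : ℕ) (Ω : Set (Fin n → ℂ)) (ρ : (Fin n → ℂ) → ℝ) : Prop :=
  ContDiff ℝ (⊤ : ℕ∞) ρ ∧ (∀ z ∈ Ω, ρ z < 0) ∧ (∀ z ∈ frontier Ω, ρ z = 0) ∧
    ∀ z ∈ frontier Ω, fderiv ℝ ρ z ≠ 0

/-- The coefficient `∂ρ/∂z_j(q)` of `∂ρ` (for a real-valued `ρ`). -/
def dzCoef (n : ℕ) (ρ : (Fin n → ℂ) → ℝ) (q : Fin n → ℂ) (j : Fin n) : ℂ :=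
  wder n j (fun v => (ρ v : ℂ)) q

/-- The ℂ-linear map `X ↦ Σ_j ∂ρ/∂z_j(q) X_j`. -/
def cTangentMap (n : ℕ) (ρ : (Fin n → ℂ) → ℝ) (q : Fin n → ℂ) : (Fin n → ℂ) →ₗ[ℂ] ℂ :=
  ∑ j, dzCoef n ρ q j • (LinearMap.proj j : (Fin n → ℂ) →ₗ[ℂ] ℂ)

/-- The complex tangent space `T^{1,0}_q(∂Ω) = {X : Σ_j ∂ρ/∂z_j(q) X_j = 0}`. -/
def cTangent (n : ℕ) (ρ : (Fin n → ℂ) → ℝ) (q : Fin n → ℂ) : Submodule ℂ (Fin n → ℂ) :=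
  LinearMap.ker (cTangentMap n ρ q)

/-- The Levi form of `ρ` at `q` is positive semidefinite on the complex tangent space. -/
def LeviPSDAt (n : ℕ) (ρ : (Fin n → ℂ) → ℝ) (q : Fin n → ℂ) : Prop :=
  ∀ X ∈ cTangent n ρ q, 0 ≤ hermForm n (cHess n ρ q) X X

/-- The ℂ-linear map `X ↦ Σ_{j,k} ρ_{jk̄}(q) X_j conj (Y_k)` (Levi pairing against `Y`). -/
def leviPairMap (n : ℕ) (ρ : (Fin n → ℂ) → ℝ) (q Y : Fin n → ℂ) : (Fin n → ℂ) →ₗ[ℂ] ℂ :=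
  ∑ j, (∑ k, cHess n ρ q j k * starRingEnd ℂ (Y k)) • (LinearMap.proj j : (Fin n → ℂ) →ₗ[ℂ] ℂ)

/-- The kernel of the Levi form of `ρ` at `q`, as a Hermitian form on `T^{1,0}_q(∂Ω)`. -/
def leviKernel (n : ℕ) (ρ : (Fin n → ℂ) → ℝ) (q : Fin n → ℂ) : Submodule ℂ (Fin n → ℂ) :=
  cTangent n ρ q ⊓ ⨅ Y ∈ cTangent n ρ q, LinearMap.ker (leviPairMap n ρ q Y)

/-- The Levi form of `ρ` at `q`, as a Hermitian form on `T^{1,0}_q(∂Ω)`, has rank `l`. -/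
def LeviRankAt (n : ℕ) (ρ : (Fin n → ℂ) → ℝ) (q : Fin n → ℂ) (l : ℕ) : Prop :=
  Module.finrank ℂ ↥(cTangent n ρ q) - Module.finrank ℂ ↥(leviKernel n ρ q) = l

/-! ### Test functions, polydiscs, Euclidean norms, biholomorphisms -/

/-- A smooth test function compactly supported in `Ω`. -/
def IsTestFun (n : ℕ) (ψ : (Fin n → ℂ) → ℂ) (Ω : Set (Fin n → ℂ)) : Prop :=
  ContDiff ℝ (⊤ : ℕ∞) ψ ∧ HasCompactSupport ψ ∧ tsupport ψ ⊆ Ω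

/-- The polydisc `P(c, β) = {z : |z_j − c_j| < β_j for all j}`. -/
def polydisc (n : ℕ) (c : Fin n → ℂ) (β : Fin n → ℝ) : Set (Fin n → ℂ) :=
  {z | ∀ j, ‖z j - c j‖ < β j}

/-- The Euclidean norm of the components of `ζ` indexed by `s`. -/
def eucNormOn (n : ℕ) (s : Finset (Fin n)) (ζ : Fin n → ℂ) : ℝ :=
  Real.sqrt (∑ j ∈ s, ‖ζ j‖ ^ 2)

/-- The Euclidean ball of radius `r` centered at the origin in ℂⁿ. -/
def eball (n : ℕ) (r : ℝ) : Set (Fin n → ℂ) :=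
  {ζ | eucNormOn n Finset.univ ζ < r}

/-- `f` is a biholomorphism from `A` onto `B`. -/
def Biholo (n : ℕ) (f : (Fin n → ℂ) → (Fin n → ℂ)) (A B : Set (Fin n → ℂ)) : Prop :=
  DifferentiableOn ℂ f A ∧ Set.BijOn f A B ∧
    ∃ g, DifferentiableOn ℂ g B ∧ ∀ z ∈ A, g (f z) = z

/-- The determinant of the complex Jacobian of `f` at `p`. -/
def cJacDet (n : ℕ) (f : (Fin n → ℂ) → (Fin n → ℂ)) (p : Fin n → ℂ) : ℂ :=
  LinearMap.det ((fderiv ℂ f p).toLinearMap)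

/-! ### Mixed derivatives `D^α` in the variables `z_j`, `z̄_j` -/

/-- The multi-index `α : Fin n → ℕ` recording how many of the directions `ι i` hit slot `j`. -/
def multiIdxOf (n : ℕ) {m : ℕ} (ι : Fin m → Fin n) : Fin n → ℕ :=
  fun j => (Finset.univ.filter fun i => ι i = j).card

/-- All mixed derivatives `D^α φ` of total order `≤ mmax`, where in each slot `j` one may
differentiate in the real directions underlying `z_j` and `z̄_j` (i.e. `e_j` and `i·e_j`),
are bounded on `P` by `bound α`. -/
def MixedDerivBound (n : ℕ) (φ : (Fin n → ℂ) → ℝ) (P : Set (Fin n → ℂ))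
    (mmax : ℕ) (bound : (Fin n → ℕ) → ℝ) : Prop :=
  ∀ m : ℕ, m ≤ mmax → ∀ ι : Fin m → Fin n, ∀ ε : Fin m → ℂ,
    (∀ i, ε i = 1 ∨ ε i = Complex.I) → ∀ z ∈ P,
      ‖iteratedFDeriv ℝ m φ z (fun i => Pi.single (ι i) (ε i))‖ ≤ bound (multiIdxOf n ι)

/-- All mixed derivatives `D^α φ` (of any order) are bounded on `P` by `bound α`. -/
def MixedDerivBoundAll (n : ℕ) (φ : (Fin n → ℂ) → ℝ) (P : Set (Fin n → ℂ))
    (bound : (Fin n → ℕ) → ℝ) : Prop :=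
  ∀ m : ℕ, ∀ ι : Fin m → Fin n, ∀ ε : Fin m → ℂ,
    (∀ i, ε i = 1 ∨ ε i = Complex.I) → ∀ z ∈ P,
      ‖iteratedFDeriv ℝ m φ z (fun i => Pi.single (ι i) (ε i))‖ ≤ bound (multiIdxOf n ι)

/-! ### Fu's centering maps and normal forms (constant Levi rank `l`) -/

/-- Lean indices `1,…,l`, i.e. the coordinates `ζ_2,…,ζ_{l+1}` (the block `ζ'`). -/
def primIdx (n l : ℕ) : Finset (Fin n) := Finset.univ.filter fun j => 1 ≤ j.val ∧ j.val ≤ l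

/-- Lean indices `l+1,…,n−1`, i.e. the coordinates `ζ_{l+2},…,ζ_n` (the block `ζ''`). -/
def dprimIdx (n l : ℕ) : Finset (Fin n) := Finset.univ.filter fun j => l + 1 ≤ j.val

/-- Lean indices `1,…,n−l−1`, i.e. the coordinates `ζ_2,…,ζ_{n−l}`. -/
def midIdx (n l : ℕ) : Finset (Fin n) :=
  Finset.univ.filter fun j => 1 ≤ j.val ∧ j.val ≤ n - l - 1

/-- Lean indices `n−l,…,n−1`, i.e. the coordinates `ζ_{n−l+1},…,ζ_n`. -/
def tailIdx (n l : ℕ) : Finset (Fin n) := Finset.univ.filter fun j => n - l ≤ j.val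

/-- `ρ` is a smooth local defining function for the real hypersurface `S` near `0`
(on the Euclidean ball of radius `ε`). -/
def IsLocalDefining (n : ℕ) (S : Set (Fin n → ℂ)) (ρ : (Fin n → ℂ) → ℝ) (ε : ℝ) : Prop :=
  ContDiffOn ℝ (⊤ : ℕ∞) ρ (eball n ε) ∧
    S ∩ eball n ε = {ζ ∈ eball n ε | ρ ζ = 0} ∧
    ∀ ζ ∈ S ∩ eball n ε, fderiv ℝ ρ ζ ≠ 0

/-- `ρ(ζ) = Re ζ₁ + Σ_{j=2}^{l+1} λ_j |ζ_j|² + O(|ζ'|²·|ζ''| + |ζ'|³ + |Im ζ₁|·|ζ|)` near `0`. -/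
def NormalForm (n l : ℕ) [NeZero n] (lam : Fin n → ℝ) (ρ : (Fin n → ℂ) → ℝ) (ε : ℝ) : Prop :=
  ∃ C > (0:ℝ), ∀ ζ ∈ eball n ε,
    |ρ ζ - ((ζ 0).re + ∑ j ∈ primIdx n l, lam j * ‖ζ j‖ ^ 2)| ≤
      C * ((eucNormOn n (primIdx n l) ζ) ^ 2 * eucNormOn n (dprimIdx n l) ζ +
        (eucNormOn n (primIdx n l) ζ) ^ 3 + |(ζ 0).im| * eucNormOn n Finset.univ ζ)

/-- Fu's centering data near a boundary point: for each `q ∈ U ∩ ∂Ω`, `Φ q` is a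
biholomorphism of `U` onto the unit ball with `Φ q q = 0`, depending smoothly on `q`,
such that `Φ q (U ∩ ∂Ω)` has, near `0`, a defining function `ρloc q` in normal form with
positive coefficients `lam q j` (for `j` in the block `ζ'`) depending smoothly on `q`. -/
def CenteringData (n l : ℕ) [NeZero n] (Ω U : Set (Fin n → ℂ))
    (Φ : (Fin n → ℂ) → (Fin n → ℂ) → (Fin n → ℂ))
    (lam : (Fin n → ℂ) → Fin n → ℝ)
    (ρloc : (Fin n → ℂ) → (Fin n → ℂ) → ℝ) (ε : ℝ) : Prop :=
  ContDiffOn ℝ (⊤ : ℕ∞) (fun pq : (Fin n → ℂ) × (Fin n → ℂ) => Φ pq.1 pq.2)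
      ((U ∩ frontier Ω) ×ˢ U) ∧
  (∀ j : Fin n, ContDiffOn ℝ (⊤ : ℕ∞) (fun q => lam q j) (U ∩ frontier Ω)) ∧
  ∀ q ∈ U ∩ frontier Ω,
    Φ q q = 0 ∧ Biholo n (Φ q) U (eball n 1) ∧
    (∀ j ∈ primIdx n l, 0 < lam q j) ∧
    IsLocalDefining n (Φ q '' (U ∩ frontier Ω)) (ρloc q) ε ∧
    NormalForm n l (lam q) (ρloc q) ε

/-- Fu's polydisc-type region
`P_{δ,a} = {ζ : |ζ₁| < aδ, |ζ_j| < aδ^{1/2} (2 ≤ j ≤ n−l), |ζ_k| < a (n−l+1 ≤ k ≤ n)}`. -/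
def PdaSet (n l : ℕ) [NeZero n] (δ a : ℝ) : Set (Fin n → ℂ) :=
  {ζ | ‖ζ 0‖ < a * δ ∧ (∀ j ∈ midIdx n l, ‖ζ j‖ < a * Real.sqrt δ) ∧
    ∀ j ∈ tailIdx n l, ‖ζ j‖ < a}

/-! ### Finite type in the sense of D'Angelo -/

/-- `h` vanishes to order at least `k` at `0`. -/
def vanishGe (E : Type*) [Norm E] (h : ℂ → E) (k : ℕ) : Prop :=
  ∃ C > (0:ℝ), ∃ ε > (0:ℝ), ∀ t : ℂ, ‖t‖ < ε → ‖h t‖ ≤ C * ‖t‖ ^ k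

/-- The vanishing order of `h` at `0`, as an extended natural number. -/
def vOrder (E : Type*) [Norm E] (h : ℂ → E) : ℕ∞ :=
  sSup ((fun k : ℕ => (k : ℕ∞)) '' {k | vanishGe E h k})

/-- `z₀ ∈ ∂Ω` is a point of finite type in the sense of D'Angelo (w.r.t. the defining
function `ρ`): the order of contact of `∂Ω` with nonconstant holomorphic curves through
`z₀` is uniformly bounded. -/
def FiniteTypeAt (n : ℕ) (ρ : (Fin n → ℂ) → ℝ) (z₀ : Fin n → ℂ) : Prop :=
  ∃ T : ℕ, ∀ γ : ℂ → (Fin n → ℂ), AnalyticAt ℂ γ 0 → γ 0 = z₀ →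
    ¬ (∀ᶠ t in 𝓝 (0:ℂ), γ t = z₀) →
    vOrder ℝ (fun t => ρ (γ t)) ≤ (T : ℕ∞) * vOrder (Fin n → ℂ) (fun t => γ t - z₀)

end

namespace DBar

variable {n : ℕ}

/-- The first order operator `(∂_{x_j} + c ∂_{y_j}) / 2` on functions on `ℂⁿ`: it is `∂/∂z_j`
for `c = -i` and `∂/∂z̄_j` for `c = i`. -/
noncomputable def wd (c : ℂ) (j : Fin n) (u : (Fin n → ℂ) → ℂ) (z : Fin n → ℂ) : ℂ :=
  (1 / 2) * (fderiv ℝ u z (Pi.single j 1) + c * fderiv ℝ u z (Pi.single j I))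

/-- The operator `∂/∂z_j`. -/
noncomputable abbrev dz (j : Fin n) (u : (Fin n → ℂ) → ℂ) : (Fin n → ℂ) → ℂ := wd (-I) j u

/-- The operator `∂/∂z̄_j`. -/
noncomputable abbrev dzb (j : Fin n) (u : (Fin n → ℂ) → ℂ) : (Fin n → ℂ) → ℂ := wd I j u

lemma wd_congr {c : ℂ} {j : Fin n} {u v : (Fin n → ℂ) → ℂ} {z : Fin n → ℂ} (h : u =ᶠ[𝓝 z] v) :
    wd c j u z = wd c j v z := by
  simp only [wd, h.fderiv_eq]

lemma wd_add {c : ℂ} {j : Fin n} {u v : (Fin n → ℂ) → ℂ} {z : Fin n → ℂ}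
    (hu : DifferentiableAt ℝ u z) (hv : DifferentiableAt ℝ v z) :
    wd c j (fun w => u w + v w) z = wd c j u z + wd c j v z := by
  simp only [wd, fderiv_fun_add hu hv, add_apply]
  ring

lemma wd_sub {c : ℂ} {j : Fin n} {u v : (Fin n → ℂ) → ℂ} {z : Fin n → ℂ}
    (hu : DifferentiableAt ℝ u z) (hv : DifferentiableAt ℝ v z) :
    wd c j (fun w => u w - v w) z = wd c j u z - wd c j v z := by
  simp only [wd, fderiv_fun_sub hu hv, sub_apply]
  ring

lemma wd_mul {c : ℂ} {j : Fin n} {u v : (Fin n → ℂ) → ℂ} {z : Fin n → ℂ}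
    (hu : DifferentiableAt ℝ u z) (hv : DifferentiableAt ℝ v z) :
    wd c j (fun w => u w * v w) z = wd c j u z * v z + u z * wd c j v z := by
  simp only [wd, fderiv_fun_mul hu hv, add_apply,
    smul_apply, smul_eq_mul]
  ring

lemma wd_const_mul {c : ℂ} {j : Fin n} {v : (Fin n → ℂ) → ℂ} {z : Fin n → ℂ} (a : ℂ)
    (hv : DifferentiableAt ℝ v z) :
    wd c j (fun w => a * v w) z = a * wd c j v z := by
  simp only [wd, fderiv_const_mul hv, smul_apply, smul_eq_mul]
  ring

lemma wd_sum {ι : Type*} {s : Finset ι} {c : ℂ} {j : Fin n} {u : ι → (Fin n → ℂ) → ℂ}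
    {z : Fin n → ℂ} (hu : ∀ i ∈ s, DifferentiableAt ℝ (u i) z) :
    wd c j (fun w => ∑ i ∈ s, u i w) z = ∑ i ∈ s, wd c j (u i) z := by
  simp only [wd, fderiv_fun_sum hu, sum_apply, Finset.mul_sum,
    ← Finset.sum_add_distrib, mul_add]

lemma wd_conj {c : ℂ} {j : Fin n} {u : (Fin n → ℂ) → ℂ} {z : Fin n → ℂ} :
    wd c j (fun w => starRingEnd ℂ (u w)) z
      = starRingEnd ℂ (wd (starRingEnd ℂ c) j u z) := by
  have h : fderiv ℝ (fun w => starRingEnd ℂ (u w)) z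
      = (conjCLE : ℂ →L[ℝ] ℂ).comp (fderiv ℝ u z) := by
    exact conjCLE.comp_fderiv (f := u) (x := z)
  simp only [wd, h]
  simp [map_ofNat]

lemma contDiff_wd {c : ℂ} {j : Fin n} {u : (Fin n → ℂ) → ℂ} (hu : ContDiff ℝ (⊤ : ℕ∞) u) :
    ContDiff ℝ (⊤ : ℕ∞) (wd c j u) := by
  have h : ContDiff ℝ (⊤ : ℕ∞) (fderiv ℝ u) := hu.fderiv_right (by simp)
  unfold wd
  fun_prop

lemma contDiffOn_wd {c : ℂ} {j : Fin n} {u : (Fin n → ℂ) → ℂ} {D : Set (Fin n → ℂ)}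
    (hD : IsOpen D) (hu : ContDiffOn ℝ (⊤ : ℕ∞) u D) :
    ContDiffOn ℝ (⊤ : ℕ∞) (wd c j u) D := by
  have h : ContDiffOn ℝ (⊤ : ℕ∞) (fderiv ℝ u) D := hu.fderiv_of_isOpen hD (by simp)
  unfold wd
  fun_prop

lemma tsupport_wd_subset {c : ℂ} {j : Fin n} {u : (Fin n → ℂ) → ℂ} :
    tsupport (wd c j u) ⊆ tsupport u := by
  refine closure_minimal (fun z hz => ?_) (isClosed_tsupport u)
  refine support_fderiv_subset ℝ (f := u) (fun h0 => hz ?_)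
  simp [wd, h0]

lemma hasCompactSupport_wd {c : ℂ} {j : Fin n} {u : (Fin n → ℂ) → ℂ} (hu : HasCompactSupport u) :
    HasCompactSupport (wd c j u) :=
  hu.of_isClosed_subset (isClosed_tsupport _) tsupport_wd_subset

lemma wd_comm {c d : ℂ} {j k : Fin n} {u : (Fin n → ℂ) → ℂ} {z : Fin n → ℂ}
    (hu : ContDiffAt ℝ (⊤ : ℕ∞) u z) :
    wd c j (wd d k u) z = wd d k (wd c j u) z := by
  have h2 : ContDiffAt ℝ (⊤ : ℕ∞) (fderiv ℝ u) z := hu.fderiv_right (by simp)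
  have h1 : DifferentiableAt ℝ (fderiv ℝ u) z := h2.differentiableAt (by simp)
  have hsym : IsSymmSndFDerivAt ℝ u z := hu.isSymmSndFDerivAt (by
    simpa using WithTop.coe_le_coe.2 (le_top : (2 : ℕ∞) ≤ ⊤))
  have key : ∀ (e : ℂ) (k : Fin n) (v : Fin n → ℂ), fderiv ℝ (wd e k u) z v
      = (1 / 2) * (fderiv ℝ (fderiv ℝ u) z v (Pi.single k 1)
        + e * fderiv ℝ (fderiv ℝ u) z v (Pi.single k I)) := by
    intro e k v
    have ha : ∀ w : Fin n → ℂ, DifferentiableAt ℝ (fun y => fderiv ℝ u y w) z := fun w =>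
      h1.clm_apply (differentiableAt_const _)
    have hb : ∀ w : Fin n → ℂ, fderiv ℝ (fun y => fderiv ℝ u y w) z v
        = fderiv ℝ (fderiv ℝ u) z v w := fun w => by
      rw [fderiv_clm_apply h1 (differentiableAt_const _)]
      simp
    unfold wd
    rw [fderiv_const_mul ((ha _).fun_add ((ha _).const_mul _)),
      fderiv_fun_add (ha _) ((ha _).const_mul _), fderiv_const_mul (ha _)]
    simp only [add_apply, smul_apply, hb, smul_eq_mul]
  unfold wd at key ⊢
  rw [key, key, key, key, hsym (Pi.single j 1) (Pi.single k 1), hsym (Pi.single j 1) (Pi.single k I),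
    hsym (Pi.single j I) (Pi.single k 1), hsym (Pi.single j I) (Pi.single k I)]
  ring

/-- The product of a function continuous on an open set `D` and a continuous function supported
in `D` is continuous. -/
lemma continuous_mul_of_tsupport {f g : (Fin n → ℂ) → ℂ} {D : Set (Fin n → ℂ)} (hD : IsOpen D)
    (hf : ContinuousOn f D) (hg : Continuous g) (hgD : tsupport g ⊆ D) :
    Continuous (fun z => f z * g z) := by
  refine continuous_iff_continuousAt.2 fun z => ?_
  by_cases hz : z ∈ tsupport g
  · exact (hf.continuousAt (hD.mem_nhds (hgD hz))).mul hg.continuousAt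
  · have : (fun z => f z * g z) =ᶠ[𝓝 z] fun _ => 0 := by
      filter_upwards [notMem_tsupport_iff_eventuallyEq.1 hz] with w hw
      simp [hw]
    exact continuousAt_const.congr this.symm

lemma contDiff_mul_of_tsupport {f g : (Fin n → ℂ) → ℂ} {D : Set (Fin n → ℂ)} (hD : IsOpen D)
    (hf : ContDiffOn ℝ (⊤ : ℕ∞) f D) (hg : ContDiff ℝ (⊤ : ℕ∞) g) (hgD : tsupport g ⊆ D) :
    ContDiff ℝ (⊤ : ℕ∞) (fun z => f z * g z) := by
  refine contDiff_iff_contDiffAt.2 fun z => ?_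
  by_cases hz : z ∈ tsupport g
  · exact (hf.contDiffAt (hD.mem_nhds (hgD hz))).mul hg.contDiffAt
  · have : (fun z => f z * g z) =ᶠ[𝓝 z] fun _ => 0 := by
      filter_upwards [notMem_tsupport_iff_eventuallyEq.1 hz] with w hw
      simp [hw]
    exact contDiffAt_const.congr_of_eventuallyEq this

lemma integrable_mul_of_tsupport {f g : (Fin n → ℂ) → ℂ} {D : Set (Fin n → ℂ)} (hD : IsOpen D)
    (hf : ContinuousOn f D) (hg : Continuous g) (hgc : HasCompactSupport g)
    (hgD : tsupport g ⊆ D) : Integrable (fun z => f z * g z) :=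
  (continuous_mul_of_tsupport hD hf hg hgD).integrable_of_hasCompactSupport hgc.mul_left

lemma isTestFun_mul {f g : (Fin n → ℂ) → ℂ} {D : Set (Fin n → ℂ)} (hD : IsOpen D)
    (hf : ContDiffOn ℝ (⊤ : ℕ∞) f D) (hg : IsTestFun n g D) :
    IsTestFun n (fun z => f z * g z) D :=
  ⟨contDiff_mul_of_tsupport hD hf hg.1 hg.2.2, hg.2.1.mul_left,
    (tsupport_mul_subset_right (f := f) (g := g)).trans hg.2.2⟩

lemma isTestFun_wd {c : ℂ} {j : Fin n} {g : (Fin n → ℂ) → ℂ} {D : Set (Fin n → ℂ)}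
    (hg : IsTestFun n g D) : IsTestFun n (wd c j g) D :=
  ⟨contDiff_wd hg.1, hasCompactSupport_wd hg.2.1, tsupport_wd_subset.trans hg.2.2⟩

lemma isTestFun_conj {g : (Fin n → ℂ) → ℂ} {D : Set (Fin n → ℂ)}
    (hg : IsTestFun n g D) : IsTestFun n (fun z => starRingEnd ℂ (g z)) D := by
  have h : tsupport (fun z => starRingEnd ℂ (g z)) ⊆ tsupport g :=
    closure_mono fun z hz h0 => hz (by simp [h0])
  exact ⟨conjCLE.contDiff.comp hg.1, hg.2.1.of_isClosed_subset (isClosed_tsupport _) h,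
    h.trans hg.2.2⟩

/-- Integration by parts against a compactly supported function. -/
lemma integral_mul_wd {f g : (Fin n → ℂ) → ℂ} {D : Set (Fin n → ℂ)} (hD : IsOpen D)
    (hf : ContDiffOn ℝ (⊤ : ℕ∞) f D) (hg : IsTestFun n g D) (c : ℂ) (j : Fin n) :
    ∫ z, f z * wd c j g z = - ∫ z, wd c j f z * g z := by
  obtain ⟨hg1, hgc, hgD⟩ := hg
  have hfd : ContDiffOn ℝ (⊤ : ℕ∞) (fderiv ℝ f) D := hf.fderiv_of_isOpen hD (by simp)
  have hgd : ContDiff ℝ (⊤ : ℕ∞) (fderiv ℝ g) := hg1.fderiv_right (by simp)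
  have hgs : ∀ v, tsupport (fun z => fderiv ℝ g z v) ⊆ tsupport g := fun v =>
    tsupport_fderiv_apply_subset ℝ v
  have i1 : ∀ v, Integrable (fun z => fderiv ℝ f z v * g z) := fun v =>
    integrable_mul_of_tsupport hD (hfd.continuousOn.clm_apply continuousOn_const) hg1.continuous
      hgc hgD
  have i2 : ∀ v, Integrable (fun z => f z * fderiv ℝ g z v) := fun v =>
    integrable_mul_of_tsupport hD hf.continuousOn (hgd.continuous.clm_apply continuous_const)
      (hgc.of_isClosed_subset (isClosed_tsupport _) (hgs v)) ((hgs v).trans hgD)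
  have i3 : Integrable (fun z => f z * g z) :=
    integrable_mul_of_tsupport hD hf.continuousOn hg1.continuous hgc hgD
  have hdf : ∀ x ∈ tsupport g, DifferentiableAt ℝ f x := fun x hx =>
    (hf.contDiffAt (hD.mem_nhds (hgD hx))).differentiableAt (by simp)
  have key : ∀ v, ∫ z, f z * fderiv ℝ g z v = - ∫ z, fderiv ℝ f z v * g z := fun v =>
    integral_mul_fderiv_eq_neg_fderiv_mul_of_integrable (i1 v) (i2 v) i3 hdf
      (fun x _ => hg1.differentiable (by simp) x)
  have e1 : ∀ z, f z * wd c j g z = (1 / 2) * (f z * fderiv ℝ g z (Pi.single j 1))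
      + (c / 2) * (f z * fderiv ℝ g z (Pi.single j I)) := fun z => by simp only [wd]; ring
  have e2 : ∀ z, wd c j f z * g z = (1 / 2) * (fderiv ℝ f z (Pi.single j 1) * g z)
      + (c / 2) * (fderiv ℝ f z (Pi.single j I) * g z) := fun z => by simp only [wd]; ring
  simp only [e1, e2]
  rw [integral_add ((i2 _).const_mul _) ((i2 _).const_mul _),
    integral_add ((i1 _).const_mul _) ((i1 _).const_mul _)]
  simp only [integral_const_mul, key]
  ring

lemma contDiff_ofReal {φ : (Fin n → ℂ) → ℝ} (hφ : ContDiff ℝ (⊤ : ℕ∞) φ) :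
    ContDiff ℝ (⊤ : ℕ∞) (fun z => (φ z : ℂ)) := ofRealCLM.contDiff.comp hφ

lemma wd_exp_neg {φ : (Fin n → ℂ) → ℝ} {z : Fin n → ℂ} (hφ : DifferentiableAt ℝ φ z) (c : ℂ)
    (j : Fin n) : wd c j (fun w => ((Real.exp (-φ w) : ℝ) : ℂ)) z
      = -((Real.exp (-φ z) : ℝ) : ℂ) * wd c j (fun w => (φ w : ℂ)) z := by
  have h1 : HasFDerivAt (fun w => (φ w : ℂ)) (ofRealCLM.comp (fderiv ℝ φ z)) z :=
    ofRealCLM.hasFDerivAt.comp z hφ.hasFDerivAt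
  have h2 : HasFDerivAt (fun w => ((Real.exp (-φ w) : ℝ) : ℂ))
      (ofRealCLM.comp (Real.exp (-φ z) • -fderiv ℝ φ z)) z :=
    ofRealCLM.hasFDerivAt.comp z hφ.hasFDerivAt.neg.exp
  simp only [wd, h1.fderiv, h2.fderiv]
  simp
  ring

/-- The operator `f ↦ ∂f/∂z_j - (∂φ/∂z_j) f`, minus the adjoint of `∂/∂z̄_j` in
`L²(e^{-φ})`. -/
noncomputable def wadj (φ : (Fin n → ℂ) → ℝ) (j : Fin n) (f : (Fin n → ℂ) → ℂ)
    (z : Fin n → ℂ) : ℂ :=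
  dz j f z - dz j (fun w => (φ w : ℂ)) z * f z

lemma contDiff_wadj {φ : (Fin n → ℂ) → ℝ} (hφ : ContDiff ℝ (⊤ : ℕ∞) φ) {j : Fin n}
    {f : (Fin n → ℂ) → ℂ} (hf : ContDiff ℝ (⊤ : ℕ∞) f) : ContDiff ℝ (⊤ : ℕ∞) (wadj φ j f) :=
  (contDiff_wd hf).sub ((contDiff_wd (contDiff_ofReal hφ)).mul hf)

lemma isTestFun_wadj {φ : (Fin n → ℂ) → ℝ} (hφ : ContDiff ℝ (⊤ : ℕ∞) φ) {j : Fin n}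
    {f : (Fin n → ℂ) → ℂ} (hf : IsTestFun n f univ) : IsTestFun n (wadj φ j f) univ := by
  refine ⟨contDiff_wadj hφ hf.1, ?_, subset_univ _⟩
  exact (hasCompactSupport_wd hf.2.1).sub (hf.2.1.mul_left)

section KMH

variable {φ : (Fin n → ℂ) → ℝ}

lemma integral_wadj_mul_conj (hφ : ContDiff ℝ (⊤ : ℕ∞) φ)
    {j : Fin n} {f h : (Fin n → ℂ) → ℂ} (hf : ContDiff ℝ (⊤ : ℕ∞) f)
    (hh : IsTestFun n h univ) :
    ∫ z, wadj φ j f z * starRingEnd ℂ (h z) * (Real.exp (-φ z) : ℝ)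
      = - ∫ z, f z * starRingEnd ℂ (dzb j h z) * (Real.exp (-φ z) : ℝ) := by
  have hW : ContDiff ℝ (⊤ : ℕ∞) (fun z => ((Real.exp (-φ z) : ℝ) : ℂ)) :=
    contDiff_ofReal (Real.contDiff_exp.comp hφ.neg)
  have hc := isTestFun_conj hh
  have ht : IsTestFun n (fun z => ((Real.exp (-φ z) : ℝ) : ℂ) * starRingEnd ℂ (h z)) univ :=
    isTestFun_mul isOpen_univ hW.contDiffOn hc
  have key := integral_mul_wd isOpen_univ hf.contDiffOn ht (-I) j
  have e : ∀ z, wd (-I) j (fun z => ((Real.exp (-φ z) : ℝ) : ℂ) * starRingEnd ℂ (h z)) z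
      = (Real.exp (-φ z) : ℝ) * starRingEnd ℂ (dzb j h z)
        - (Real.exp (-φ z) : ℝ) * dz j (fun w => (φ w : ℂ)) z * starRingEnd ℂ (h z) := by
    intro z
    rw [wd_mul (hW.differentiable (by simp) z) (hc.1.differentiable (by simp) z),
      wd_exp_neg (hφ.differentiable (by simp) z), wd_conj]
    simp only [map_neg, conj_I, neg_neg]
    ring
  have hφc := contDiff_wd (c := -I) (j := j) (contDiff_ofReal hφ)
  have i1 : Integrable (fun z => f z * ((Real.exp (-φ z) : ℝ) * starRingEnd ℂ (dzb j h z))) :=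
    (integrable_mul_of_tsupport isOpen_univ hf.continuous.continuousOn
      (isTestFun_mul isOpen_univ hW.contDiffOn (isTestFun_conj (isTestFun_wd (c := I) (j := j)
        hh))).1.continuous
      (isTestFun_mul isOpen_univ hW.contDiffOn (isTestFun_conj (isTestFun_wd (c := I) (j := j)
        hh))).2.1 (subset_univ _))
  have i2 : Integrable (fun z => f z * dz j (fun w => (φ w : ℂ)) z *
      ((Real.exp (-φ z) : ℝ) * starRingEnd ℂ (h z))) :=
    integrable_mul_of_tsupport isOpen_univ (hf.continuous.mul hφc.continuous).continuousOn
      ht.1.continuous ht.2.1 (subset_univ _)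
  have i3 : Integrable (fun z => dz j f z * ((Real.exp (-φ z) : ℝ) * starRingEnd ℂ (h z))) :=
    integrable_mul_of_tsupport isOpen_univ (contDiff_wd hf).continuous.continuousOn
      ht.1.continuous ht.2.1 (subset_univ _)
  calc _ = ∫ z, (dz j f z * ((Real.exp (-φ z) : ℝ) * starRingEnd ℂ (h z)) -
        f z * dz j (fun w => (φ w : ℂ)) z * ((Real.exp (-φ z) : ℝ) * starRingEnd ℂ (h z))) := by
        refine integral_congr_ae (.of_forall fun z => ?_)
        simp only [wadj]; ring
    _ = - ((∫ z, f z * ((Real.exp (-φ z) : ℝ) * starRingEnd ℂ (dzb j h z))) -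
        ∫ z, f z * dz j (fun w => (φ w : ℂ)) z * ((Real.exp (-φ z) : ℝ) * starRingEnd ℂ (h z)))
        - ∫ z, f z * dz j (fun w => (φ w : ℂ)) z *
          ((Real.exp (-φ z) : ℝ) * starRingEnd ℂ (h z)) := by
        rw [integral_sub i3 i2, ← integral_sub i1 i2]
        congr 1
        rw [eq_neg_iff_add_eq_zero, ← eq_neg_iff_add_eq_zero.1 key, add_comm]
        congr 1
        refine integral_congr_ae (.of_forall fun z => ?_)
        simp only [e]; ring
    _ = _ := by
        rw [neg_sub, sub_sub_cancel_left]
        congr 1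
        refine integral_congr_ae (.of_forall fun z => ?_)
        simp only; ring

lemma integral_mul_conj_wadj (hφ : ContDiff ℝ (⊤ : ℕ∞) φ)
    {k : Fin n} {f h : (Fin n → ℂ) → ℂ} (hf : IsTestFun n f univ)
    (hh : ContDiff ℝ (⊤ : ℕ∞) h) :
    ∫ z, f z * starRingEnd ℂ (wadj φ k h z) * (Real.exp (-φ z) : ℝ)
      = - ∫ z, dzb k f z * starRingEnd ℂ (h z) * (Real.exp (-φ z) : ℝ) := by
  have := congrArg (starRingEnd ℂ) (integral_wadj_mul_conj hφ (j := k) hh hf)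
  rw [map_neg, ← integral_conj, ← integral_conj] at this
  simp only [map_mul, conj_conj, conj_ofReal] at this
  calc _ = _ := integral_congr_ae (.of_forall fun z => by ring)
    _ = _ := this
    _ = _ := congrArg _ (integral_congr_ae (.of_forall fun z => by ring))

lemma dzb_wadj (hφ : ContDiff ℝ (⊤ : ℕ∞) φ)
    {j k : Fin n} {f : (Fin n → ℂ) → ℂ} (hf : ContDiff ℝ (⊤ : ℕ∞) f)
    (z : Fin n → ℂ) : dzb k (wadj φ j f) z
      = wadj φ j (dzb k f) z - dzb k (dz j (fun w => (φ w : ℂ))) z * f z := by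
  have h1 := contDiff_wd (c := -I) (j := j) (contDiff_ofReal hφ)
  have h2 := contDiff_wd (c := -I) (j := j) hf
  unfold wadj
  rw [dzb, wd_sub (h2.differentiable (by simp) z) ((h1.mul hf).differentiable (by simp) z),
    wd_mul (h1.differentiable (by simp) z) (hf.differentiable (by simp) z),
    wd_comm hf.contDiffAt]
  ring

/-- The polarized Kohn–Morrey–Hörmander identity. -/
lemma integral_wadj_mul_conj_wadj (hφ : ContDiff ℝ (⊤ : ℕ∞) φ)
    {j k : Fin n} {f h : (Fin n → ℂ) → ℂ}
    (hf : IsTestFun n f univ) (hh : IsTestFun n h univ) :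
    ∫ z, wadj φ j f z * starRingEnd ℂ (wadj φ k h z) * (Real.exp (-φ z) : ℝ)
      = (∫ z, dzb k f z * starRingEnd ℂ (dzb j h z) * (Real.exp (-φ z) : ℝ))
        + ∫ z, dzb k (dz j (fun w => (φ w : ℂ))) z * f z * starRingEnd ℂ (h z)
            * (Real.exp (-φ z) : ℝ) := by
  rw [integral_mul_conj_wadj hφ (isTestFun_wadj hφ hf) hh.1]
  have hW : ContDiff ℝ (⊤ : ℕ∞) (fun z => ((Real.exp (-φ z) : ℝ) : ℂ)) :=
    contDiff_ofReal (Real.contDiff_exp.comp hφ.neg)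
  have ht : IsTestFun n (fun z => ((Real.exp (-φ z) : ℝ) : ℂ) * starRingEnd ℂ (h z)) univ :=
    isTestFun_mul isOpen_univ hW.contDiffOn (isTestFun_conj hh)
  have i1 : Integrable (fun z => wadj φ j (dzb k f) z *
      (((Real.exp (-φ z) : ℝ) : ℂ) * starRingEnd ℂ (h z))) :=
    integrable_mul_of_tsupport isOpen_univ
      (contDiff_wadj hφ (contDiff_wd hf.1)).continuous.continuousOn ht.1.continuous ht.2.1
      (subset_univ _)
  have i2 : Integrable (fun z => (dzb k (dz j (fun w => (φ w : ℂ))) z * f z) *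
      (((Real.exp (-φ z) : ℝ) : ℂ) * starRingEnd ℂ (h z))) :=
    integrable_mul_of_tsupport isOpen_univ
      ((contDiff_wd (contDiff_wd (contDiff_ofReal hφ))).mul hf.1).continuous.continuousOn
      ht.1.continuous ht.2.1 (subset_univ _)
  calc _ = -((∫ z, wadj φ j (dzb k f) z * (((Real.exp (-φ z) : ℝ) : ℂ) * starRingEnd ℂ (h z))) -
        ∫ z, (dzb k (dz j (fun w => (φ w : ℂ))) z * f z) *
          (((Real.exp (-φ z) : ℝ) : ℂ) * starRingEnd ℂ (h z))) := by
        rw [← integral_sub i1 i2]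
        congr 1
        refine integral_congr_ae (.of_forall fun z => ?_)
        simp only [dzb_wadj hφ hf.1]
        ring
    _ = -((∫ z, wadj φ j (dzb k f) z * starRingEnd ℂ (h z) * (Real.exp (-φ z) : ℝ)) -
        ∫ z, dzb k (dz j (fun w => (φ w : ℂ))) z * f z * starRingEnd ℂ (h z)
            * (Real.exp (-φ z) : ℝ)) := by
        congr 2 <;>
        · refine integral_congr_ae (.of_forall fun z => ?_)
          simp only
          ring
    _ = _ := by
        rw [integral_wadj_mul_conj hφ (contDiff_wd hf.1) hh]
        ring

/-- The Kohn–Morrey–Hörmander inequality for compactly supported smooth forms. -/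
theorem kmh_smooth (hφ : ContDiff ℝ (⊤ : ℕ∞) φ)
    {g : Fin n → (Fin n → ℂ) → ℂ} (hg : ∀ j, IsTestFun n (g j) univ) :
    ∫ z, (∑ j, ∑ k, dzb k (dz j (fun w => (φ w : ℂ))) z * g j z * starRingEnd ℂ (g k z)).re
        * Real.exp (-φ z)
      ≤ (∫ z, ‖∑ j, wadj φ j (g j) z‖ ^ 2 * Real.exp (-φ z))
        + (1 / 2) * ∑ j, ∑ k, ∫ z, ‖dzb k (g j) z - dzb j (g k) z‖ ^ 2 * Real.exp (-φ z) := by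
  have hW : ContDiff ℝ (⊤ : ℕ∞) (fun z => ((Real.exp (-φ z) : ℝ) : ℂ)) :=
    contDiff_ofReal (Real.contDiff_exp.comp hφ.neg)
  have int3 : ∀ a b : (Fin n → ℂ) → ℂ, Continuous a → IsTestFun n b univ →
      Integrable (fun z => a z * starRingEnd ℂ (b z) * (Real.exp (-φ z) : ℝ)) := by
    intro a b ha hb
    have := integrable_mul_of_tsupport isOpen_univ (ha.fun_mul hW.continuous).continuousOn
      (isTestFun_conj hb).1.continuous (isTestFun_conj hb).2.1 (subset_univ _)
    exact this.congr (.of_forall fun z => by simp only; ring)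
  have hgd : ∀ j k, IsTestFun n (dzb k (g j)) univ := fun j k => isTestFun_wd (hg j)
  have hgw : ∀ j, IsTestFun n (wadj φ j (g j)) univ := fun j => isTestFun_wadj hφ (hg j)
  have hφ2 : ∀ j k, Continuous (dzb k (dz j (fun w => (φ w : ℂ)))) := fun j k =>
    (contDiff_wd (contDiff_wd (contDiff_ofReal hφ))).continuous
  have iA := fun j k => int3 _ _ (hgw j).1.continuous (hgw k)
  have iB := fun j k => int3 _ _ (hgd j k).1.continuous (hgd k j)
  have iC : ∀ j k, Integrable (fun z => dzb k (dz j (fun w => (φ w : ℂ))) z * g j z *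
      starRingEnd ℂ (g k z) * (Real.exp (-φ z) : ℝ)) := fun j k =>
    int3 _ _ ((hφ2 j k).fun_mul (hg j).1.continuous) (hg k)
  have iD : ∀ j k, Integrable (fun z => ‖dzb k (g j) z - dzb j (g k) z‖ ^ 2 * Real.exp (-φ z)) := by
    intro j k
    refine Continuous.integrable_of_hasCompactSupport ?_ ?_
    · have := (hgd j k).1.continuous
      have := (hgd k j).1.continuous
      have := hφ.continuous
      fun_prop
    · exact (((hgd j k).2.1.sub (hgd k j).2.1).comp_left (g := fun x => ‖x‖ ^ 2) (by simp)).mul_right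
  have hid : (∫ z, (∑ j, ∑ k, dzb k (dz j (fun w => (φ w : ℂ))) z * g j z *
        starRingEnd ℂ (g k z) * (Real.exp (-φ z) : ℝ)))
      = (∫ z, ∑ j, ∑ k, wadj φ j (g j) z * starRingEnd ℂ (wadj φ k (g k) z) *
          (Real.exp (-φ z) : ℝ))
        - ∫ z, ∑ j, ∑ k, dzb k (g j) z * starRingEnd ℂ (dzb j (g k) z) *
          (Real.exp (-φ z) : ℝ) := by
    rw [integral_finsetSum _ (fun j _ => integrable_finsetSum _ fun k _ => iA j k),
      integral_finsetSum _ (fun j _ => integrable_finsetSum _ fun k _ => iB j k),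
      integral_finsetSum _ (fun j _ => integrable_finsetSum _ fun k _ => iC j k),
      ← Finset.sum_sub_distrib]
    refine Finset.sum_congr rfl fun j _ => ?_
    rw [integral_finsetSum _ (fun k _ => iA j k), integral_finsetSum _ (fun k _ => iB j k),
      integral_finsetSum _ (fun k _ => iC j k), ← Finset.sum_sub_distrib]
    refine Finset.sum_congr rfl fun k _ => ?_
    rw [integral_wadj_mul_conj_wadj hφ (hg j) (hg k)]
    ring
  have hre := congrArg Complex.re hid
  rw [sub_re] at hre
  have rr : ∀ F : (Fin n → ℂ) → ℂ, Integrable F → (∫ z, F z).re = ∫ z, (F z).re :=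
    fun F hF => (integral_re hF).symm
  rw [rr _ (integrable_finsetSum _ (fun j _ => integrable_finsetSum _ fun k _ => iA j k)),
    rr _ (integrable_finsetSum _ (fun j _ => integrable_finsetSum _ fun k _ => iB j k)),
    rr _ (integrable_finsetSum _ (fun j _ => integrable_finsetSum _ fun k _ => iC j k))] at hre
  have eA : ∀ z, (∑ j, ∑ k, wadj φ j (g j) z * starRingEnd ℂ (wadj φ k (g k) z) *
      (Real.exp (-φ z) : ℝ)).re = ‖∑ j, wadj φ j (g j) z‖ ^ 2 * Real.exp (-φ z) := by
    intro z
    have : ∑ j, ∑ k, wadj φ j (g j) z * starRingEnd ℂ (wadj φ k (g k) z) *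
      ((Real.exp (-φ z) : ℝ) : ℂ) = ((‖∑ j, wadj φ j (g j) z‖ ^ 2 * Real.exp (-φ z) : ℝ) : ℂ) := by
      push_cast
      rw [← mul_conj', map_sum, Finset.sum_mul_sum, Finset.sum_mul]
      refine Finset.sum_congr rfl fun j _ => ?_
      rw [Finset.sum_mul]
    rw [this, ofReal_re]
  have eC : ∀ z, (∑ j, ∑ k, dzb k (dz j (fun w => (φ w : ℂ))) z * g j z *
        starRingEnd ℂ (g k z) * (Real.exp (-φ z) : ℝ)).re
      = (∑ j, ∑ k, dzb k (dz j (fun w => (φ w : ℂ))) z * g j z * starRingEnd ℂ (g k z)).re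
        * Real.exp (-φ z) := by
    intro z
    rw [← re_mul_ofReal, Finset.sum_mul]
    simp only [Finset.sum_mul]
  have eB : ∀ z, -(1 / 2) * ∑ j, ∑ k, ‖dzb k (g j) z - dzb j (g k) z‖ ^ 2 * Real.exp (-φ z)
      ≤ (∑ j, ∑ k, dzb k (g j) z * starRingEnd ℂ (dzb j (g k) z) * (Real.exp (-φ z) : ℝ)).re := by
    intro z
    have hpt : ∀ j k, -(1 / 2) * (‖dzb k (g j) z - dzb j (g k) z‖ ^ 2 * Real.exp (-φ z))
        = (dzb k (g j) z * starRingEnd ℂ (dzb j (g k) z) * (Real.exp (-φ z) : ℝ)).re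
          - (1 / 2) * (‖dzb k (g j) z‖ ^ 2 * Real.exp (-φ z))
          - (1 / 2) * (‖dzb j (g k) z‖ ^ 2 * Real.exp (-φ z)) := by
      intro j k
      rw [re_mul_ofReal, ← normSq_eq_norm_sq, ← normSq_eq_norm_sq, ← normSq_eq_norm_sq, normSq_sub]
      ring
    simp only [Finset.mul_sum]
    rw [re_sum]
    simp only [re_sum]
    simp only [hpt, Finset.sum_sub_distrib]
    have : 0 ≤ ∑ j, ∑ k, 1 / 2 * (‖dzb k (g j) z‖ ^ 2 * Real.exp (-φ z)) :=
      Finset.sum_nonneg fun j _ => Finset.sum_nonneg fun k _ => by positivity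
    have : 0 ≤ ∑ j, ∑ k, 1 / 2 * (‖dzb j (g k) z‖ ^ 2 * Real.exp (-φ z)) :=
      Finset.sum_nonneg fun j _ => Finset.sum_nonneg fun k _ => by positivity
    linarith
  simp only [eA, eC] at hre
  rw [hre]
  have hB := integral_mono ((integrable_finsetSum _ (fun j _ => integrable_finsetSum _
    fun k _ => iD j k)).const_mul (-(1 / 2)))
    (integrable_finsetSum _ (fun j _ => integrable_finsetSum _ fun k _ => iB j k)).re eB
  rw [integral_const_mul, integral_finsetSum _ (fun j _ => integrable_finsetSum _
    fun k _ => iD j k)] at hB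
  simp only [integral_finsetSum _ (fun k _ => iD _ k)] at hB
  have hB' : -(1 / 2) * ∑ j, ∑ k, ∫ z, ‖dzb k (g j) z - dzb j (g k) z‖ ^ 2 * Real.exp (-φ z)
      ≤ ∫ z, (∑ j, ∑ k, dzb k (g j) z * starRingEnd ℂ (dzb j (g k) z) *
          (Real.exp (-φ z) : ℝ)).re := hB
  linarith

end KMH

section Mollifier

/-- The (unnormalized) bump function of the unit ball of `ℂⁿ`, depending on the moduli of the
coordinates only. -/
noncomputable def bump0 (y : Fin n → ℂ) : ℝ := expNegInvGlue (1 - ∑ j, ‖y j‖ ^ 2)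

/-- The normalized mollifier at scale `δ`. -/
noncomputable def bump (δ : ℝ) (y : Fin n → ℂ) : ℝ :=
  (∫ w : Fin n → ℂ, bump0 w)⁻¹ * (δ ^ (2 * n))⁻¹ * bump0 (δ⁻¹ • y)

lemma contDiff_sum_sq : ContDiff ℝ (⊤ : ℕ∞) (fun y : Fin n → ℂ => ∑ j, ‖y j‖ ^ 2) :=
  ContDiff.sum fun j _ => (contDiff_apply ℝ ℂ j).norm_sq ℝ

lemma contDiff_bump0 : ContDiff ℝ (⊤ : ℕ∞) (bump0 (n := n)) :=
  expNegInvGlue.contDiff.comp (contDiff_const.sub contDiff_sum_sq)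

lemma norm_lt_one_of_bump0_ne {y : Fin n → ℂ} (h : bump0 y ≠ 0) : ‖y‖ < 1 := by
  by_contra! h1
  refine h (expNegInvGlue.zero_of_nonpos ?_)
  have hne : Nonempty (Fin n) := by
    by_contra hn
    rw [not_nonempty_iff] at hn
    simp [Subsingleton.elim y 0] at h1
    linarith
  obtain ⟨j, -, hj⟩ := Finset.exists_mem_eq_sup' (Finset.univ_nonempty (α := Fin n))
    (fun j => ‖y j‖₊)
  have : ‖y‖ ≤ ‖y j‖ := (pi_norm_le_iff_of_nonneg (norm_nonneg _)).2 fun i => by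
    have := Finset.le_sup' (fun j => ‖y j‖₊) (Finset.mem_univ i)
    rw [hj] at this
    exact_mod_cast this
  have h2 : ‖y j‖ ^ 2 ≤ ∑ j, ‖y j‖ ^ 2 :=
    Finset.single_le_sum (f := fun j => ‖y j‖ ^ 2) (fun i _ => by positivity) (Finset.mem_univ j)
  nlinarith

lemma hasCompactSupport_bump0 : HasCompactSupport (bump0 (n := n)) :=
  HasCompactSupport.of_support_subset_isCompact (isCompact_closedBall 0 1) fun y hy => by
    simpa using (norm_lt_one_of_bump0_ne hy).le

lemma integral_bump0_pos : 0 < ∫ w : Fin n → ℂ, bump0 w :=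
  contDiff_bump0.continuous.integral_pos_of_hasCompactSupport_nonneg_nonzero
    hasCompactSupport_bump0 (fun _ => expNegInvGlue.nonneg _)
    (x := 0) (expNegInvGlue.pos_of_pos (by simp)).ne'

lemma bump_nonneg {δ : ℝ} (hδ : 0 < δ) (y : Fin n → ℂ) : 0 ≤ bump δ y :=
  mul_nonneg (mul_nonneg (inv_nonneg.2 integral_bump0_pos.le) (inv_nonneg.2 (pow_nonneg hδ.le _)))
    (expNegInvGlue.nonneg _)

lemma contDiff_bump (δ : ℝ) : ContDiff ℝ (⊤ : ℕ∞) (bump (n := n) δ) :=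
  contDiff_const.mul (contDiff_bump0.comp (contDiff_const_smul _))

lemma norm_lt_of_bump_ne {δ : ℝ} (hδ : 0 < δ) {y : Fin n → ℂ} (h : bump δ y ≠ 0) : ‖y‖ < δ := by
  have := norm_lt_one_of_bump0_ne (right_ne_zero_of_mul h)
  rw [norm_smul, norm_inv, Real.norm_of_nonneg hδ.le, inv_mul_lt_iff₀ hδ, mul_one] at this
  exact this

lemma tsupport_bump {δ : ℝ} (hδ : 0 < δ) :
    tsupport (bump (n := n) δ) ⊆ Metric.closedBall 0 δ :=
  closure_minimal (fun y hy => by simpa using (norm_lt_of_bump_ne hδ hy).le)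
    Metric.isClosed_closedBall

lemma hasCompactSupport_bump {δ : ℝ} (hδ : 0 < δ) : HasCompactSupport (bump (n := n) δ) :=
  (isCompact_closedBall 0 δ).of_isClosed_subset (isClosed_tsupport _) (tsupport_bump hδ)

lemma integrable_bump {δ : ℝ} (hδ : 0 < δ) : Integrable (bump (n := n) δ) :=
  (contDiff_bump δ).continuous.integrable_of_hasCompactSupport (hasCompactSupport_bump hδ)

lemma finrank_pi_complex : Module.finrank ℝ (Fin n → ℂ) = 2 * n := by
  rw [Module.finrank_pi_fintype]
  simp [Complex.finrank_real_complex, mul_comm]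

lemma integral_bump {δ : ℝ} (hδ : 0 < δ) : ∫ y : Fin n → ℂ, bump δ y = 1 := by
  unfold bump
  rw [integral_const_mul, Measure.integral_comp_smul, finrank_pi_complex]
  have := integral_bump0_pos (n := n)
  rw [smul_eq_mul, abs_of_pos (by positivity), inv_pow, inv_inv]
  field_simp

lemma bump_smul (δ : ℝ) (a : ℂ) (ha : ‖a‖ = 1) (y : Fin n → ℂ) : bump δ (a • y) = bump δ y := by
  simp [bump, bump0, ha]

lemma exists_bump_le : ∃ C : ℝ, 0 < C ∧ ∀ δ > 0, ∀ y : Fin n → ℂ,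
    bump δ y ≤ C * (δ ^ (2 * n))⁻¹ := by
  obtain ⟨C, hC⟩ := hasCompactSupport_bump0.exists_bound_of_continuous
    (contDiff_bump0 (n := n)).continuous
  have hi := integral_bump0_pos (n := n)
  refine ⟨(∫ w : Fin n → ℂ, bump0 w)⁻¹ * (|C| + 1), by positivity, fun δ hδ y => ?_⟩
  have h1 : bump0 (δ⁻¹ • y) ≤ |C| + 1 :=
    (le_abs_self _).trans ((hC (δ⁻¹ • y)).trans ((le_abs_self C).trans (by linarith)))
  unfold bump
  have h2 := mul_le_mul_of_nonneg_left h1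
    (by positivity : 0 ≤ (∫ w : Fin n → ℂ, bump0 w)⁻¹ * (δ ^ (2 * n))⁻¹)
  linarith

variable {F : Type*} [NormedAddCommGroup F] [NormedSpace ℝ F]

/-- Mollification at scale `δ`. -/
noncomputable def moll (δ : ℝ) (f : (Fin n → ℂ) → F) (x : Fin n → ℂ) : F :=
  ∫ t, bump δ (x - t) • f t

lemma moll_eq_swap (δ : ℝ) (f : (Fin n → ℂ) → F) (x : Fin n → ℂ) :
    moll δ f x = ∫ y, bump δ y • f (x - y) := by
  rw [moll, ← integral_sub_left_eq_self _ _ x]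
  simp

lemma moll_eq_convolution (δ : ℝ) (f : (Fin n → ℂ) → F) :
    moll δ f = convolution f (bump δ) (ContinuousLinearMap.lsmul ℝ ℝ).flip volume := rfl

lemma integrable_moll_integrand {δ : ℝ} (hδ : 0 < δ) {f : (Fin n → ℂ) → F}
    (hf : LocallyIntegrable f) (x : Fin n → ℂ) : Integrable (fun t => bump δ (x - t) • f t) :=
  (hasCompactSupport_bump hδ).convolutionExists_right
    (ContinuousLinearMap.lsmul ℝ ℝ).flip hf (contDiff_bump δ).continuous x

lemma contDiff_moll [CompleteSpace F] {δ : ℝ} (hδ : 0 < δ) {f : (Fin n → ℂ) → F}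
    (hf : LocallyIntegrable f) : ContDiff ℝ (⊤ : ℕ∞) (moll δ f) := by
  rw [moll_eq_convolution]
  exact (hasCompactSupport_bump hδ).contDiff_convolution_right _ hf (contDiff_bump δ)

lemma moll_congr {δ : ℝ} (hδ : 0 < δ) {f g : (Fin n → ℂ) → F} {x : Fin n → ℂ}
    (h : ∀ t ∈ Metric.ball x δ, f t = g t) : moll δ f x = moll δ g x := by
  refine integral_congr_ae (.of_forall fun t => ?_)
  by_cases ht : bump δ (x - t) = 0
  · simp [ht]
  · simp only
    rw [h t (by simpa [dist_eq_norm, norm_sub_rev] using norm_lt_of_bump_ne hδ ht)]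

lemma support_moll_subset {δ : ℝ} (hδ : 0 < δ) (f : (Fin n → ℂ) → F) :
    tsupport (moll δ f) ⊆ Metric.cthickening δ (tsupport f) := by
  refine closure_minimal (fun x hx => ?_) Metric.isClosed_cthickening
  by_contra h
  refine hx ?_
  rw [moll_congr (g := fun _ => 0) hδ]
  · simp [moll]
  · intro t ht
    by_contra h0
    refine h (Metric.mem_cthickening_of_dist_le x t δ _ (subset_tsupport _ h0) ?_)
    rw [dist_comm]; exact (Metric.mem_ball.1 ht).le

lemma norm_moll_sub_le [CompleteSpace F] {δ : ℝ} (hδ : 0 < δ) {f : (Fin n → ℂ) → F}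
    (hf : LocallyIntegrable f)
    {x : Fin n → ℂ} {ε : ℝ} (h : ∀ t ∈ Metric.ball x δ, ‖f t - f x‖ ≤ ε) :
    ‖moll δ f x - f x‖ ≤ ε := by
  have hb : Integrable (fun t => bump δ (x - t)) := (integrable_bump hδ).comp_sub_left x
  have h1 : ∫ t, bump δ (x - t) = 1 := by
    rw [integral_sub_left_eq_self (fun t => bump δ t) volume x, integral_bump hδ]
  have : moll δ f x - f x = ∫ t, bump δ (x - t) • (f t - f x) := by
    simp only [smul_sub]
    rw [integral_sub (integrable_moll_integrand hδ hf x) (hb.smul_const _), integral_smul_const, h1,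
      one_smul]
    rfl
  rw [this]
  calc _ ≤ ∫ t, bump δ (x - t) * ε := by
        refine norm_integral_le_of_norm_le (hb.mul_const _) (.of_forall fun t => ?_)
        rw [norm_smul, Real.norm_of_nonneg (bump_nonneg hδ _)]
        by_cases ht : bump δ (x - t) = 0
        · simp [ht]
        · exact mul_le_mul_of_nonneg_left (h t (by
            simpa [dist_eq_norm, norm_sub_rev] using norm_lt_of_bump_ne hδ ht)) (bump_nonneg hδ _)
    _ = ε := by rw [integral_mul_const, h1, one_mul]

/-- Averaging over rotations. -/
lemma moll_eq_integral_circle [CompleteSpace F] {δ : ℝ} (hδ : 0 < δ) {f : (Fin n → ℂ) → F}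
    {x : Fin n → ℂ}
    (hf : ContinuousOn f (Metric.closedBall x δ)) :
    moll δ f x = ∫ y, bump δ y • ((2 * Real.pi)⁻¹ •
      ∫ θ in (0:ℝ)..(2 * Real.pi), f (x + (Complex.exp (θ * I)) • y)) := by
  have hrot : ∀ θ : ℝ, moll δ f x = ∫ y, bump δ y • f (x + (Complex.exp (θ * I)) • y) := by
    intro θ
    have hnorm : ‖-Complex.exp (θ * I)‖ = 1 := by rw [norm_neg, norm_exp_ofReal_mul_I]
    let u : Circle := ⟨-Complex.exp (θ * I), by simp [Submonoid.unitSphere, hnorm]⟩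
    let e : (Fin n → ℂ) → (Fin n → ℂ) := fun y j => (-Complex.exp (θ * I)) * y j
    have he : MeasurePreserving e volume volume :=
      volume_preserving_pi fun j => (rotation u).measurePreserving
    have hne : (-Complex.exp (θ * I)) ≠ 0 := by
      intro h; rw [h] at hnorm; simp at hnorm
    have hemb : MeasurableEmbedding e := by
      have := (Homeomorph.smulOfNeZero (α := Fin n → ℂ) _ hne).measurableEmbedding
      exact this
    rw [moll_eq_swap, ← he.integral_comp hemb]
    refine integral_congr_ae (.of_forall fun y => ?_)
    have e1 : e y = (-Complex.exp (θ * I)) • y := rfl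
    simp only [e1, bump_smul δ _ hnorm]
    simp [sub_eq_add_neg]
  have hcont : Continuous (Function.uncurry fun (θ : ℝ) (y : Fin n → ℂ) =>
      bump δ y • f (x + (Complex.exp (θ * I)) • y)) := by
    refine continuous_iff_continuousAt.2 fun p => ?_
    have hs : ContinuousAt (fun p : ℝ × (Fin n → ℂ) => x + (Complex.exp (p.1 * I)) • p.2) p := by
      fun_prop
    by_cases hp : ‖p.2‖ < δ
    · have h1 : ContinuousAt f (x + (Complex.exp (p.1 * I)) • p.2) :=
        (hf.mono Metric.ball_subset_closedBall).continuousAt (Metric.isOpen_ball.mem_nhds (by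
          simpa [norm_smul, norm_exp_ofReal_mul_I] using hp))
      have h2 : ContinuousAt (fun p : ℝ × (Fin n → ℂ) =>
          f (x + (Complex.exp (p.1 * I)) • p.2)) p := ContinuousAt.comp h1 hs
      exact ((contDiff_bump δ).continuous.comp continuous_snd).continuousAt.smul h2
    · obtain ⟨M, hM⟩ := (isCompact_closedBall x δ).exists_bound_of_continuousOn hf
      have hb0 : bump δ p.2 = 0 := by
        by_contra h; exact hp (norm_lt_of_bump_ne hδ h)
      have hlim : Tendsto (fun q : ℝ × (Fin n → ℂ) => bump δ q.2 * M) (𝓝 p) (𝓝 0) := by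
        have := (((contDiff_bump (n := n) δ).continuous.comp
          (continuous_snd (X := ℝ))).mul_const M).tendsto p
        simpa [hb0] using this
      have : ContinuousAt (fun q : ℝ × (Fin n → ℂ) =>
          bump δ q.2 • f (x + (Complex.exp (q.1 * I)) • q.2)) p := by
        unfold ContinuousAt
        simp only [hb0, zero_smul]
        refine squeeze_zero_norm (fun q => ?_) hlim
        rw [norm_smul, Real.norm_of_nonneg (bump_nonneg hδ _)]
        by_cases hq : bump δ q.2 = 0
        · simp [hq]
        · refine mul_le_mul_of_nonneg_left (hM _ ?_) (bump_nonneg hδ _)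
          simpa [norm_smul, norm_exp_ofReal_mul_I] using (norm_lt_of_bump_ne hδ hq).le
      exact this
  have hint : Integrable (Function.uncurry fun (θ : ℝ) (y : Fin n → ℂ) =>
      bump δ y • f (x + (Complex.exp (θ * I)) • y))
      ((volume.restrict (uIoc 0 (2 * Real.pi))).prod volume) := by
    rw [← Measure.restrict_univ (μ := (volume : Measure (Fin n → ℂ))), Measure.prod_restrict]
    have hc : IntegrableOn (Function.uncurry fun (θ : ℝ) (y : Fin n → ℂ) =>
      bump δ y • f (x + (Complex.exp (θ * I)) • y))
      (uIcc 0 (2 * Real.pi) ×ˢ Metric.closedBall 0 δ) (volume.prod volume) :=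
      hcont.continuousOn.integrableOn_compact (isCompact_uIcc.prod (isCompact_closedBall _ _))
    refine hc.of_forall_sdiff_eq_zero (measurableSet_uIoc.prod MeasurableSet.univ) ?_
    rintro ⟨θ, y⟩ ⟨⟨h1, -⟩, h2⟩
    have hb0 : bump δ y = 0 := by
      by_contra h
      exact h2 ⟨uIoc_subset_uIcc h1, by simpa using (norm_lt_of_bump_ne hδ h).le⟩
    simp [hb0]
  have hpi : (0:ℝ) ≤ 2 * Real.pi := by positivity
  have hsw := integral_integral_swap hint
  rw [uIoc_of_le hpi] at hsw
  simp only [← intervalIntegral.integral_of_le hpi, ← hrot, intervalIntegral.integral_const,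
    sub_zero, intervalIntegral.integral_smul] at hsw
  simp only [smul_comm (bump δ _) (2 * Real.pi)⁻¹]
  rw [integral_smul, ← hsw, smul_smul, inv_mul_cancel₀ (by positivity), one_smul]

end Mollifier

section Approx

lemma wd_comp_sub {c : ℂ} {j : Fin n} (u : (Fin n → ℂ) → ℂ) (x t : Fin n → ℂ)
    (hu : DifferentiableAt ℝ u (x - t)) :
    wd c j (fun s => u (x - s)) t = - wd c j u (x - t) := by
  have h : HasFDerivAt (fun s => u (x - s)) ((fderiv ℝ u (x - t)).comp
      (-ContinuousLinearMap.id ℝ (Fin n → ℂ))) t :=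
    hu.hasFDerivAt.comp t ((hasFDerivAt_id t).const_sub x)
  simp only [wd, h.fderiv]
  simp
  ring

lemma isTestFun_bump_sub {δ : ℝ} (hδ : 0 < δ) {x : Fin n → ℂ} {D : Set (Fin n → ℂ)}
    (hx : Metric.closedBall x δ ⊆ D) : IsTestFun n (fun t => (bump δ (x - t) : ℂ)) D := by
  have hs : tsupport (fun t => (bump δ (x - t) : ℂ)) ⊆ Metric.closedBall x δ := by
    refine closure_minimal (fun t ht => ?_) Metric.isClosed_closedBall
    have : bump δ (x - t) ≠ 0 := fun h => ht (by simp [h])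
    simpa [dist_eq_norm, norm_sub_rev] using (norm_lt_of_bump_ne hδ this).le
  refine ⟨?_, (isCompact_closedBall x δ).of_isClosed_subset (isClosed_tsupport _) hs, hs.trans hx⟩
  exact ofRealCLM.contDiff.comp ((contDiff_bump δ).comp (contDiff_const.sub contDiff_id))

/-- Derivatives of a mollification fall on the kernel. -/
lemma wd_moll {δ : ℝ} (hδ : 0 < δ) {f : (Fin n → ℂ) → ℂ} (hf : LocallyIntegrable f) (c : ℂ)
    (j : Fin n) (x : Fin n → ℂ) :
    wd c j (moll δ f) x = - ∫ t, f t * wd c j (fun s => (bump δ (x - s) : ℂ)) t := by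
  have hB : ContDiff ℝ (⊤ : ℕ∞) (fun s : Fin n → ℂ => (bump δ s : ℂ)) :=
    ofRealCLM.contDiff.comp (contDiff_bump δ)
  have hBc : HasCompactSupport (fun s : Fin n → ℂ => (bump δ s : ℂ)) :=
    (hasCompactSupport_bump hδ).comp_left (g := ((↑) : ℝ → ℂ)) (by simp)
  have e : moll δ f = convolution f (fun s : Fin n → ℂ => (bump δ s : ℂ))
      (ContinuousLinearMap.mul ℝ ℂ) volume := by
    funext y
    simp only [moll, convolution, ContinuousLinearMap.mul_apply', real_smul]
    exact integral_congr_ae (.of_forall fun t => mul_comm _ _)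
  have hder : ∀ v, fderiv ℝ (moll δ f) x v
      = ∫ t, f t * fderiv ℝ (fun s : Fin n → ℂ => (bump δ s : ℂ)) (x - t) v := by
    intro v
    rw [e, (hBc.hasFDerivAt_convolution_right (ContinuousLinearMap.mul ℝ ℂ) hf
      (hB.of_le (by exact_mod_cast le_top)) x).fderiv,
      convolution_precompR_apply _ hf (hBc.fderiv ℝ) (hB.continuous_fderiv (by simp))]
    rfl
  have hi : ∀ v, Integrable fun t =>
      f t * fderiv ℝ (fun s : Fin n → ℂ => (bump δ s : ℂ)) (x - t) v := fun v =>
    HasCompactSupport.convolutionExists_right (ContinuousLinearMap.mul ℝ ℂ)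
      (hBc.fderiv_apply ℝ v) hf
      ((hB.continuous_fderiv (by simp)).clm_apply continuous_const) x
  simp only [wd_comp_sub _ _ _ (hB.differentiable (by simp) _), mul_neg, integral_neg, neg_neg]
  rw [wd, hder, hder]
  simp only [wd]
  rw [← integral_const_mul, ← integral_add (hi _) ((hi _).const_mul _), ← integral_const_mul]
  refine integral_congr_ae (.of_forall fun t => ?_)
  simp only
  ring

lemma moll_eq_integral_mul (δ : ℝ) (f : (Fin n → ℂ) → ℂ) (x : Fin n → ℂ) :
    moll δ f x = ∫ t, f t * (bump δ (x - t) : ℂ) := by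
  simp only [moll, real_smul, mul_comm]

lemma moll_congr_ae {F : Type*} [NormedAddCommGroup F] [NormedSpace ℝ F] {δ : ℝ}
    {f g : (Fin n → ℂ) → F} (h : f =ᵐ[volume] g) :
    moll δ f = moll δ g := by
  funext x
  refine integral_congr_ae ?_
  filter_upwards [h] with t ht
  simp [ht]

lemma tendsto_eLpNorm_translate {f : (Fin n → ℂ) → ℂ} (hf : MemLp f 2) :
    Tendsto (fun y => eLpNorm (fun x => f (x - y) - f x) 2 volume) (𝓝 0) (𝓝 0) := by
  have : Fact ((1 : ENNReal) ≤ 2) := ⟨by norm_num⟩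
  let g : C(Fin n → ℂ, C(Fin n → ℂ, Fin n → ℂ)) :=
    (ContinuousMap.mk (fun a : (Fin n → ℂ) × (Fin n → ℂ) => a.2 - a.1) (by fun_prop)).curry
  have hg : ∀ y, MeasurePreserving (g y) volume volume := fun y =>
    measurePreserving_sub_right volume y
  have hc : Continuous fun y => Lp.compMeasurePreserving (g y) (hg y) (hf.toLp f) :=
    continuous_const.compMeasurePreservingLp g.continuous hg (by simp)
  have h0 := (hc.sub continuous_const : Continuous fun y =>
    Lp.compMeasurePreserving (g y) (hg y) (hf.toLp f) - hf.toLp f).enorm.tendsto 0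
  have e0 : Lp.compMeasurePreserving (g 0) (hg 0) (hf.toLp f) = hf.toLp f := by
    rw [Lp.toLp_compMeasurePreserving]
    refine MemLp.toLp_congr _ _ (.of_forall fun x => ?_)
    simp [g]
  simp only [Pi.sub_apply, e0, sub_self, enorm_zero] at h0
  refine h0.congr fun y => ?_
  rw [Lp.toLp_compMeasurePreserving, ← MemLp.toLp_sub, Lp.enorm_toLp]
  rfl

lemma eLpNorm_two_sq {α : Type*} [MeasurableSpace α] {μ : Measure α} (f : α → ℂ) :
    eLpNorm f 2 μ ^ 2 = ∫⁻ x, ‖f x‖ₑ ^ 2 ∂μ := by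
  have := eLpNorm_nnreal_pow_eq_lintegral (f := f) (μ := μ) (p := 2) (by simp)
  simpa using this

/-- Mollifications converge in `L²`. -/
theorem tendsto_eLpNorm_moll {f : (Fin n → ℂ) → ℂ} (hf : MemLp f 2) :
    Tendsto (fun δ => eLpNorm (fun x => moll δ f x - f x) 2 volume) (𝓝[>] 0) (𝓝 0) := by
  wlog hm : StronglyMeasurable f generalizing f
  · have h1 := hf.1.ae_eq_mk
    have := this ((memLp_congr_ae h1).1 hf) hf.1.stronglyMeasurable_mk
    refine this.congr fun δ => ?_
    rw [← moll_congr_ae h1]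
    refine eLpNorm_congr_ae ?_
    filter_upwards [h1] with x hx
    rw [hx]
  have hfl : LocallyIntegrable f := hf.locallyIntegrable (by norm_num)
  rw [ENNReal.tendsto_nhds_zero]
  intro ε hε
  have htr := (ENNReal.tendsto_nhds_zero.1 (tendsto_eLpNorm_translate hf)) ε hε
  obtain ⟨r, hr, hball⟩ := Metric.eventually_nhds_iff_ball.1 htr
  filter_upwards [Ioo_mem_nhdsGT hr] with δ hδ
  have hδ0 : 0 < δ := hδ.1
  have hbm : Measurable fun y : Fin n → ℂ => ENNReal.ofReal (bump δ y) :=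
    (contDiff_bump δ).continuous.measurable.ennreal_ofReal
  let μ : Measure (Fin n → ℂ) := volume.withDensity fun y => ENNReal.ofReal (bump δ y)
  have : IsProbabilityMeasure μ := ⟨by
    rw [withDensity_apply _ MeasurableSet.univ, Measure.restrict_univ,
      ← ofReal_integral_eq_lintegral_ofReal (integrable_bump hδ0)
        (.of_forall fun y => bump_nonneg hδ0 y), integral_bump hδ0, ENNReal.ofReal_one]⟩
  have hjm : Measurable fun p : (Fin n → ℂ) × (Fin n → ℂ) => f (p.1 - p.2) - f p.1 :=
    (hm.measurable.comp (measurable_fst.sub measurable_snd)).sub (hm.measurable.comp measurable_fst)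
  have hpt : ∀ x, ‖moll δ f x - f x‖ₑ ^ 2 ≤ ∫⁻ y, ‖f (x - y) - f x‖ₑ ^ 2 ∂μ := by
    intro x
    have hmx : Measurable fun y => f (x - y) - f x := hjm.comp measurable_prodMk_left
    have h1 : ‖moll δ f x - f x‖ₑ ≤ eLpNorm (fun y => f (x - y) - f x) 1 μ := by
      have hi1 : Integrable fun y => bump δ y • f (x - y) := by
        have := (integrable_moll_integrand hδ0 hfl x).comp_sub_left x
        simpa using this
      have e : moll δ f x - f x = ∫ y, bump δ y • (f (x - y) - f x) := by
        simp only [smul_sub]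
        rw [integral_sub hi1 ((integrable_bump hδ0).smul_const _), integral_smul_const,
          integral_bump hδ0, one_smul, moll_eq_swap]
      rw [e, eLpNorm_one_eq_lintegral_enorm, lintegral_withDensity_eq_lintegral_mul _ hbm
        hmx.enorm]
      refine (enorm_integral_le_lintegral_enorm _).trans (lintegral_mono fun y => ?_)
      rw [enorm_smul, Pi.mul_apply, Real.enorm_of_nonneg (bump_nonneg hδ0 y)]
    have h2 := eLpNorm_le_eLpNorm_of_exponent_le (μ := μ) (p := 1) (q := 2) (by norm_num)
      hmx.aestronglyMeasurable
    calc _ ≤ eLpNorm (fun y => f (x - y) - f x) 2 μ ^ 2 := by gcongr; exact h1.trans h2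
      _ = _ := eLpNorm_two_sq _
  have hsq : eLpNorm (fun x => moll δ f x - f x) 2 volume ^ 2 ≤ ε ^ 2 := by
    calc _ = ∫⁻ x, ‖moll δ f x - f x‖ₑ ^ 2 := eLpNorm_two_sq _
      _ ≤ ∫⁻ x, ∫⁻ y, ‖f (x - y) - f x‖ₑ ^ 2 ∂μ := lintegral_mono hpt
      _ = ∫⁻ y, (∫⁻ x, ‖f (x - y) - f x‖ₑ ^ 2) ∂μ :=
          lintegral_lintegral_swap (hjm.enorm.pow_const 2).aemeasurable
      _ = ∫⁻ y, ENNReal.ofReal (bump δ y) * ∫⁻ x, ‖f (x - y) - f x‖ₑ ^ 2 := by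
          have hmy : Measurable fun y => ∫⁻ x, ‖f (x - y) - f x‖ₑ ^ 2 :=
            (hjm.enorm.pow_const 2).lintegral_prod_left'
          rw [lintegral_withDensity_eq_lintegral_mul _ hbm hmy]
          rfl
      _ ≤ ∫⁻ y, ENNReal.ofReal (bump δ y) * ε ^ 2 := by
          refine lintegral_mono fun y => ?_
          by_cases hy : bump δ y = 0
          · simp [hy]
          · have := hball y (by simpa using (norm_lt_of_bump_ne hδ0 hy).trans hδ.2)
            simp only
            rw [← eLpNorm_two_sq]
            gcongr
      _ = ε ^ 2 := by
          rw [lintegral_mul_const _ hbm, ← ofReal_integral_eq_lintegral_ofReal (integrable_bump hδ0)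
            (.of_forall fun y => bump_nonneg hδ0 y), integral_bump hδ0, ENNReal.ofReal_one, one_mul]
  exact (ENNReal.pow_le_pow_left_iff two_ne_zero).1 hsq

end Approx

section Weyl

lemma tendsto_integral_mul_conj {α : Type*} [MeasurableSpace α] {μ : Measure α}
    {a b : ℕ → α → ℂ} {a₀ b₀ : α → ℂ} (ha : ∀ i, MemLp (a i) 2 μ) (hb : ∀ i, MemLp (b i) 2 μ)
    (ha₀ : MemLp a₀ 2 μ) (hb₀ : MemLp b₀ 2 μ)
    (hta : Tendsto (fun i => eLpNorm (fun x => a i x - a₀ x) 2 μ) atTop (𝓝 0))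
    (htb : Tendsto (fun i => eLpNorm (fun x => b i x - b₀ x) 2 μ) atTop (𝓝 0)) :
    Tendsto (fun i => ∫ x, a i x * starRingEnd ℂ (b i x) ∂μ) atTop
      (𝓝 (∫ x, a₀ x * starRingEnd ℂ (b₀ x) ∂μ)) := by
  have key : ∀ {f g : α → ℂ} (hf : MemLp f 2 μ) (hg : MemLp g 2 μ),
      inner ℂ (hg.toLp g) (hf.toLp f) = ∫ x, f x * starRingEnd ℂ (g x) ∂μ := by
    intro f g hf hg
    rw [L2.inner_def]
    refine integral_congr_ae ?_
    filter_upwards [hf.coeFn_toLp, hg.coeFn_toLp] with x h1 h2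
    rw [h1, h2]
    simp
  have cv : ∀ {f : ℕ → α → ℂ} {f₀ : α → ℂ} (hf : ∀ i, MemLp (f i) 2 μ) (hf₀ : MemLp f₀ 2 μ),
      Tendsto (fun i => eLpNorm (fun x => f i x - f₀ x) 2 μ) atTop (𝓝 0) →
      Tendsto (fun i => (hf i).toLp (f i)) atTop (𝓝 (hf₀.toLp f₀)) := by
    intro f f₀ hf hf₀ h
    exact (Lp.tendsto_Lp_iff_tendsto_eLpNorm'' _ hf _ hf₀).2 h
  have := (cv hb hb₀ htb).inner (𝕜 := ℂ) (cv ha ha₀ hta)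
  rw [key ha₀ hb₀] at this
  exact this.congr fun i => key (ha i) (hb i)

lemma memLp_moll {δ : ℝ} (hδ : 0 < δ) {f : (Fin n → ℂ) → ℂ} (hf : LocallyIntegrable f)
    (hc : HasCompactSupport f) (p : ENNReal) : MemLp (moll δ f) p :=
  (contDiff_moll hδ hf).continuous.memLp_of_hasCompactSupport
    (hc.isCompact.cthickening.of_isClosed_subset (isClosed_tsupport _) (support_moll_subset hδ f))

lemma tendsto_one_div_nhdsGT : Tendsto (fun i : ℕ => 1 / ((i : ℝ) + 1)) atTop (𝓝[>] 0) :=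
  tendsto_nhdsWithin_iff.2 ⟨tendsto_one_div_add_atTop_nhds_zero_nat,
    .of_forall fun _ => mem_Ioi.2 Nat.one_div_pos_of_nat⟩

/-- Mean value property of holomorphic functions. -/
lemma moll_eq_self_of_differentiableOn {δ : ℝ} (hδ : 0 < δ) {f : (Fin n → ℂ) → ℂ}
    {V : Set (Fin n → ℂ)} (hf : DifferentiableOn ℂ f V) {x : Fin n → ℂ}
    (hx : Metric.closedBall x δ ⊆ V) : moll δ f x = f x := by
  rw [moll_eq_integral_circle hδ (hf.continuousOn.mono hx)]
  have : ∀ y, bump δ y • ((2 * Real.pi)⁻¹ •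
      ∫ θ in (0:ℝ)..(2 * Real.pi), f (x + (Complex.exp (θ * I)) • y)) = bump δ y • f x := by
    intro y
    by_cases hy : bump δ y = 0
    · simp [hy]
    congr 1
    have hyδ := norm_lt_of_bump_ne hδ hy
    have hd : DifferentiableOn ℂ (fun t : ℂ => f (x + t • y)) (Metric.closedBall 0 1) := by
      refine hf.comp (by fun_prop) fun t ht => hx ?_
      have : ‖t‖ ≤ 1 := by simpa using ht
      simp only [Metric.mem_closedBall, dist_self_add_left, norm_smul]
      nlinarith [norm_nonneg y]
    have hdc : DiffContOnCl ℂ (fun t : ℂ => f (x + t • y)) (Metric.ball 0 |1|) := by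
      refine (hd.mono ?_).diffContOnCl
      rw [abs_one]
      exact Metric.closure_ball_subset_closedBall
    have := hdc.circleAverage
    simpa [Real.circleAverage, circleMap] using this
  simp only [this]
  rw [integral_smul_const, integral_bump hδ, one_smul]

lemma dzb_eq_zero {f : (Fin n → ℂ) → ℂ} {z : Fin n → ℂ} (hf : DifferentiableAt ℂ f z) (j : Fin n) :
    dzb j f z = 0 := by
  have h : fderiv ℝ f z = (fderiv ℂ f z).restrictScalars ℝ := hf.fderiv_restrictScalars ℝ
  have h2 : (Pi.single j I : Fin n → ℂ) = I • Pi.single j 1 := by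
    rw [← Pi.single_smul]; simp
  simp only [wd, h, ContinuousLinearMap.coe_restrictScalars', h2, map_smul, smul_eq_mul]
  rw [← mul_assoc, I_mul_I]
  ring

lemma pi_eq_sum_single (v : Fin n → ℂ) : v = ∑ j, ((v j).re • (Pi.single j 1 : Fin n → ℂ)
    + (v j).im • (Pi.single j I : Fin n → ℂ)) := by
  conv_lhs => rw [← Finset.univ_sum_single v]
  refine Finset.sum_congr rfl fun j _ => ?_
  rw [← Pi.single_smul, ← Pi.single_smul, ← Pi.single_add]
  congr 1
  simp [re_add_im]

lemma differentiableAt_of_dzb_eq_zero {f : (Fin n → ℂ) → ℂ} {z : Fin n → ℂ}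
    (hf : DifferentiableAt ℝ f z) (h : ∀ j, dzb j f z = 0) : DifferentiableAt ℂ f z := by
  rw [differentiableAt_iff_restrictScalars ℝ hf]
  refine ⟨∑ j, (fderiv ℝ f z (Pi.single j 1)) • ContinuousLinearMap.proj (R := ℂ) j, ?_⟩
  have hI : ∀ j, fderiv ℝ f z (Pi.single j I) = I * fderiv ℝ f z (Pi.single j 1) := by
    intro j
    have := h j
    simp only [wd] at this
    have h2 : fderiv ℝ f z (Pi.single j 1) + I * fderiv ℝ f z (Pi.single j I) = 0 := by
      simpa using this
    linear_combination (-I) * h2 + fderiv ℝ f z (Pi.single j I) * I_mul_I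
  ext v
  conv_rhs => rw [pi_eq_sum_single v, map_sum]
  simp only [map_add, map_smul, hI, ContinuousLinearMap.coe_restrictScalars', sum_apply, smul_apply,
    ContinuousLinearMap.proj_apply, real_smul, smul_eq_mul]
  refine Finset.sum_congr rfl fun j _ => ?_
  conv_lhs => rw [← re_add_im (v j)]
  ring

lemma contDiffOn_of_differentiableOn {f : (Fin n → ℂ) → ℂ} {V : Set (Fin n → ℂ)} (hV : IsOpen V)
    (hf : DifferentiableOn ℂ f V) : ContDiffOn ℝ (⊤ : ℕ∞) f V := by
  intro x hx
  obtain ⟨r, hr, hrV⟩ := Metric.nhds_basis_closedBall.mem_iff.1 (hV.mem_nhds hx)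
  let g := (Metric.closedBall x r).indicator f
  have hg : LocallyIntegrable g := by
    refine Integrable.locallyIntegrable ?_
    rw [integrable_indicator_iff Metric.isClosed_closedBall.measurableSet]
    exact (hf.continuousOn.mono hrV).integrableOn_compact (isCompact_closedBall _ _)
  have h2 : (0:ℝ) < r / 2 := by positivity
  have he : f =ᶠ[𝓝 x] moll (r / 2) g := by
    filter_upwards [Metric.ball_mem_nhds x h2] with y hy
    have hsub : Metric.closedBall y (r / 2) ⊆ Metric.closedBall x r :=
      Metric.closedBall_subset_closedBall' (by have := Metric.mem_ball.1 hy; linarith)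
    rw [← moll_eq_self_of_differentiableOn h2 hf (hsub.trans hrV)]
    refine moll_congr h2 fun t ht => ?_
    exact (indicator_of_mem (hsub (Metric.ball_subset_closedBall ht)) f).symm
  exact ((contDiff_moll h2 hg).contDiffAt.congr_of_eventuallyEq he).contDiffWithinAt

/-- Weyl's lemma for `∂̄`. -/
theorem exists_holomorphic_of_weak {h : (Fin n → ℂ) → ℂ} {Ω : Set (Fin n → ℂ)} (hΩ : IsOpen Ω)
    (hh : MemLp h 2) (hc : HasCompactSupport h)
    (hw : ∀ j, ∀ ψ, IsTestFun n ψ Ω → ∫ z, h z * dzb j ψ z = 0) :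
    ∃ F : (Fin n → ℂ) → ℂ, DifferentiableOn ℂ F Ω ∧ ∀ᵐ z, z ∈ Ω → h z = F z := by
  have hhl : LocallyIntegrable h := hh.locallyIntegrable (by norm_num)
  let d : ℕ → ℝ := fun i => 1 / ((i : ℝ) + 1)
  have hd : ∀ i, 0 < d i := fun i => Nat.one_div_pos_of_nat
  have hdl : Tendsto d atTop (𝓝[>] 0) := tendsto_one_div_nhdsGT
  have hdz : ∀ {δ : ℝ}, 0 < δ → ∀ {x}, Metric.closedBall x δ ⊆ Ω →
      DifferentiableAt ℂ (moll δ h) x := by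
    intro δ hδ x hx
    refine differentiableAt_of_dzb_eq_zero ((contDiff_moll hδ hhl).differentiable (by simp) x)
      fun j => ?_
    rw [dzb, wd_moll hδ hhl, hw j _ (isTestFun_bump_sub hδ hx), neg_zero]
  have hL2 := (tendsto_eLpNorm_moll hh).comp hdl
  have hmem : ∀ i, MemLp (moll (d i) h) 2 := fun i => memLp_moll (hd i) hhl hc 2
  have hloc : ∀ x₀ ∈ Ω, ∃ r > 0, (∀ x ∈ Metric.ball x₀ r, DifferentiableAt ℂ (moll (r / 2) h) x) ∧
      ∀ x ∈ Metric.ball x₀ r, Tendsto (fun i => moll (d i) h x) atTop (𝓝 (moll (r / 2) h x)) := by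
    intro x₀ hx₀
    obtain ⟨R, hR, hRV⟩ := Metric.nhds_basis_closedBall.mem_iff.1 (hΩ.mem_nhds hx₀)
    have h3 : 0 < R / 3 := by positivity
    have h6 : 0 < R / 3 / 2 := by positivity
    have hsub : ∀ x ∈ Metric.ball x₀ (R / 3), Metric.closedBall x (R / 3 / 2)
        ⊆ Metric.ball x₀ (2 * (R / 3)) := fun x hx =>
      Metric.closedBall_subset_ball' (by have := Metric.mem_ball.1 hx; linarith)
    refine ⟨R / 3, h3, fun x hx => hdz h6 ((hsub x hx).trans
      ((Metric.ball_subset_closedBall.trans (Metric.closedBall_subset_closedBall (by linarith))).trans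
        hRV)), fun x hx => ?_⟩
    have ev : ∀ᶠ i in atTop, moll (R / 3 / 2) (moll (d i) h) x = moll (d i) h x := by
      have : ∀ᶠ i in atTop, d i < R / 3 :=
        (hdl.mono_right nhdsWithin_le_nhds).eventually_lt_const h3
      filter_upwards [this] with i hi
      refine moll_eq_self_of_differentiableOn h6 (fun y hy =>
        (hdz (hd i) ?_).differentiableWithinAt) (hsub x hx)
      exact (Metric.closedBall_subset_closedBall' (by
        have := Metric.mem_ball.1 hy; linarith)).trans hRV
    have hb : MemLp (fun t => (bump (R / 3 / 2) (x - t) : ℂ)) 2 :=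
      (isTestFun_bump_sub h6 (subset_univ _)).1.continuous.memLp_of_hasCompactSupport
        (isTestFun_bump_sub h6 (subset_univ _)).2.1
    have lim := tendsto_integral_mul_conj hmem (fun _ => hb) hh hb hL2 (by simp)
    simp only [conj_ofReal, ← moll_eq_integral_mul] at lim
    exact lim.congr' ev
  refine ⟨fun x => limUnder atTop (fun i => moll (d i) h x), fun x₀ hx₀ => ?_, ?_⟩
  · obtain ⟨r, hr, h1, h2⟩ := hloc x₀ hx₀
    refine ((h1 x₀ (Metric.mem_ball_self hr)).congr_of_eventuallyEq ?_).differentiableWithinAt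
    filter_upwards [Metric.ball_mem_nhds x₀ hr] with x hx
    exact (h2 x hx).limUnder_eq
  · have hm : TendstoInMeasure volume (fun i => moll (d i) h) atTop h :=
      tendstoInMeasure_of_tendsto_eLpNorm two_ne_zero (fun i => (hmem i).1) hh.1 hL2
    obtain ⟨ns, hns, hae⟩ := hm.exists_seq_tendsto_ae
    filter_upwards [hae] with x hx hxΩ
    obtain ⟨r, hr, h1, h2⟩ := hloc x hxΩ
    have h3 := h2 x (Metric.mem_ball_self hr)
    rw [h3.limUnder_eq]
    exact tendsto_nhds_unique hx (h3.comp hns.tendsto_atTop)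

end Weyl

section WeakKMH

/-- Convergence in `L²`, bundled with membership. -/
structure TendstoL2 {α : Type*} [MeasurableSpace α] (μ : Measure α) (a : ℕ → α → ℂ) (a₀ : α → ℂ) :
    Prop where
  memLp : ∀ i, MemLp (a i) 2 μ
  memLp_lim : MemLp a₀ 2 μ
  tendsto : Tendsto (fun i => eLpNorm (fun x => a i x - a₀ x) 2 μ) atTop (𝓝 0)

namespace TendstoL2

variable {α : Type*} [MeasurableSpace α] {μ : Measure α} {a b : ℕ → α → ℂ} {a₀ b₀ : α → ℂ}

lemma sub (ha : TendstoL2 μ a a₀) (hb : TendstoL2 μ b b₀) :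
    TendstoL2 μ (fun i x => a i x - b i x) (fun x => a₀ x - b₀ x) := by
  refine ⟨fun i => (ha.1 i).sub (hb.1 i), ha.2.sub hb.2, ?_⟩
  have h0 := ha.3.add hb.3
  rw [add_zero] at h0
  refine tendsto_of_tendsto_of_tendsto_of_le_of_le tendsto_const_nhds h0 (fun _ => zero_le) fun i => ?_
  have := eLpNorm_sub_le (p := 2) (μ := μ) ((ha.1 i).sub ha.2).1 ((hb.1 i).sub hb.2).1 (by norm_num)
  refine le_trans (le_of_eq ?_) this
  congr 1
  ext x
  simp only [Pi.sub_apply]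
  ring

lemma sum {ι : Type*} {s : Finset ι} {a : ι → ℕ → α → ℂ} {a₀ : ι → α → ℂ}
    (h : ∀ j ∈ s, TendstoL2 μ (a j) (a₀ j)) :
    TendstoL2 μ (fun i x => ∑ j ∈ s, a j i x) (fun x => ∑ j ∈ s, a₀ j x) := by
  classical
  induction s using Finset.induction_on with
  | empty => exact ⟨fun i => by simp, by simp, by simp⟩
  | insert k s hk ih =>
    have h1 := h k (Finset.mem_insert_self _ _)
    have h2 := ih fun j hj => h j (Finset.mem_insert_of_mem hj)
    have h3 : TendstoL2 μ (fun _ _ => 0) (fun _ => 0) := ⟨fun i => by simp, by simp, by simp⟩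
    simpa [Finset.sum_insert hk, sub_neg_eq_add] using h1.sub (h3.sub h2)

lemma bdd_mul {w : α → ℂ} (hw : AEStronglyMeasurable w μ) {C : ℝ} (hC : ∀ x, ‖w x‖ ≤ C)
    (ha : TendstoL2 μ a a₀) : TendstoL2 μ (fun i x => w x * a i x) (fun x => w x * a₀ x) := by
  have hm : ∀ {f : α → ℂ}, MemLp f 2 μ → MemLp (fun x => w x * f x) 2 μ := fun hf =>
    hf.of_le_mul (c := C) (hw.mul hf.1) (.of_forall fun x => by
      rw [norm_mul]; exact mul_le_mul_of_nonneg_right (hC x) (norm_nonneg _))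
  refine ⟨fun i => hm (ha.1 i), hm ha.2, ?_⟩
  have h0 : Tendsto (fun i => ENNReal.ofReal C * eLpNorm (fun x => a i x - a₀ x) 2 μ) atTop (𝓝 0) := by
    have := ENNReal.Tendsto.const_mul ha.3 (Or.inr (ENNReal.ofReal_ne_top (r := C)))
    simpa using this
  refine tendsto_of_tendsto_of_tendsto_of_le_of_le tendsto_const_nhds h0 (fun _ => zero_le) fun i => ?_
  refine eLpNorm_le_mul_eLpNorm_of_ae_le_mul (.of_forall fun x => ?_) 2
  rw [← mul_sub, norm_mul]
  exact mul_le_mul_of_nonneg_right (hC x) (norm_nonneg _)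

lemma integral_mul_conj (ha : TendstoL2 μ a a₀) (hb : TendstoL2 μ b b₀) :
    Tendsto (fun i => ∫ x, a i x * starRingEnd ℂ (b i x) ∂μ) atTop
      (𝓝 (∫ x, a₀ x * starRingEnd ℂ (b₀ x) ∂μ)) :=
  tendsto_integral_mul_conj ha.1 hb.1 ha.2 hb.2 ha.3 hb.3

lemma integral_norm_sq {w : α → ℝ} (hw : AEStronglyMeasurable w μ) {C : ℝ} (hC : ∀ x, ‖w x‖ ≤ C)
    (ha : TendstoL2 μ a a₀) :
    Tendsto (fun i => ∫ x, ‖a i x‖ ^ 2 * w x ∂μ) atTop (𝓝 (∫ x, ‖a₀ x‖ ^ 2 * w x ∂μ)) := by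
  have h := (ha.bdd_mul (w := fun x => (w x : ℂ)) (continuous_ofReal.comp_aestronglyMeasurable hw) (C := C)
    (fun x => by simpa using hC x)).integral_mul_conj ha
  have e : ∀ f : α → ℂ, ∫ x, (w x : ℂ) * f x * starRingEnd ℂ (f x) ∂μ
      = ((∫ x, ‖f x‖ ^ 2 * w x ∂μ : ℝ) : ℂ) := by
    intro f
    rw [← integral_complex_ofReal]
    refine integral_congr_ae (.of_forall fun x => ?_)
    simp only
    rw [mul_assoc, mul_conj, normSq_eq_norm_sq]
    push_cast
    ring
  simp only [e] at h
  exact_mod_cast (continuous_re.tendsto _).comp h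

end TendstoL2

lemma tendstoL2_moll {f : (Fin n → ℂ) → ℂ} (hf : MemLp f 2) (hc : HasCompactSupport f) :
    TendstoL2 volume (fun i => moll (1 / ((i : ℝ) + 1)) f) f :=
  ⟨fun _ => memLp_moll Nat.one_div_pos_of_nat (hf.locallyIntegrable (by norm_num)) hc 2, hf,
    (tendsto_eLpNorm_moll hf).comp tendsto_one_div_nhdsGT⟩

lemma isTestFun_moll {δ : ℝ} (hδ : 0 < δ) {f : (Fin n → ℂ) → ℂ} (hf : LocallyIntegrable f)
    (hc : HasCompactSupport f) : IsTestFun n (moll δ f) univ :=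
  ⟨contDiff_moll hδ hf, hc.isCompact.cthickening.of_isClosed_subset (isClosed_tsupport _)
    (support_moll_subset hδ f), subset_univ _⟩

/-- The Kohn–Morrey–Hörmander inequality for compactly supported forms in the minimal `L²` class. -/
theorem kmh_weak {φ : (Fin n → ℂ) → ℝ} (hφ : ContDiff ℝ (⊤ : ℕ∞) φ) (hφc : HasCompactSupport φ)
    {G : Fin n → (Fin n → ℂ) → ℂ} (hG : ∀ j, MemLp (G j) 2) (hGc : ∀ j, HasCompactSupport (G j))
    {m : (Fin n → ℂ) → ℂ} (hm : MemLp m 2) (hmc : HasCompactSupport m)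
    (hmw : ∀ ψ, IsTestFun n ψ univ → ∑ j, ∫ z, G j z * dz j ψ z = -∫ z, m z * ψ z)
    {σ : Fin n → Fin n → (Fin n → ℂ) → ℂ} (hσ : ∀ j k, MemLp (σ j k) 2)
    (hσc : ∀ j k, HasCompactSupport (σ j k))
    (hσw : ∀ j k, ∀ ψ, IsTestFun n ψ univ →
      (∫ z, G j z * dzb k ψ z) - ∫ z, G k z * dzb j ψ z = -∫ z, σ j k z * ψ z) :
    ∫ z, (∑ j, ∑ k, dzb k (dz j (fun w => (φ w : ℂ))) z * G j z * starRingEnd ℂ (G k z)).re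
        * Real.exp (-φ z) ≤
      (∫ z, ‖m z - ∑ j, dz j (fun w => (φ w : ℂ)) z * G j z‖ ^ 2 * Real.exp (-φ z)) +
        (1 / 2) * ∑ j, ∑ k, ∫ z, ‖σ j k z‖ ^ 2 * Real.exp (-φ z) := by
  set d : ℕ → ℝ := fun i => 1 / ((i : ℝ) + 1) with hd_def
  have hd : ∀ i, 0 < d i := fun i => Nat.one_div_pos_of_nat
  have hloc : ∀ {f : (Fin n → ℂ) → ℂ}, MemLp f 2 → LocallyIntegrable f :=
    fun hf => hf.locallyIntegrable (by norm_num)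
  have hφC : ContDiff ℝ (⊤ : ℕ∞) (fun w => (φ w : ℂ)) := contDiff_ofReal hφ
  have hφCc : HasCompactSupport (fun w => (φ w : ℂ)) := hφc.comp_left (g := fun t : ℝ => (t : ℂ)) rfl
  obtain ⟨E, hE⟩ : ∃ E, ∀ z, ‖Real.exp (-φ z)‖ ≤ E := by
    obtain ⟨B, hB⟩ := hφc.exists_bound_of_continuous hφ.continuous
    refine ⟨Real.exp B, fun z => ?_⟩
    rw [Real.norm_eq_abs, abs_of_pos (Real.exp_pos _), Real.exp_le_exp]
    exact (neg_le_abs _).trans (hB z)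
  have hEm : AEStronglyMeasurable (fun z => Real.exp (-φ z)) :=
    (Real.continuous_exp.comp hφ.continuous.neg).aestronglyMeasurable
  have hdz : ∀ j, Continuous (dz j (fun w => (φ w : ℂ))) := fun j => (contDiff_wd hφC).continuous
  have hH : ∀ j k, Continuous (dzb k (dz j (fun w => (φ w : ℂ)))) := fun j k =>
    (contDiff_wd (contDiff_wd hφC)).continuous
  have hGT : ∀ j, TendstoL2 volume (fun i => moll (d i) (G j)) (G j) := fun j =>
    tendstoL2_moll (hG j) (hGc j)
  have hA : TendstoL2 volume (fun i z => moll (d i) m z - ∑ j, dz j (fun w => (φ w : ℂ)) z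
      * moll (d i) (G j) z) (fun z => m z - ∑ j, dz j (fun w => (φ w : ℂ)) z * G j z) := by
    refine (tendstoL2_moll hm hmc).sub (TendstoL2.sum fun j _ => ?_)
    obtain ⟨B, hB⟩ := (hasCompactSupport_wd (c := -I) (j := j) hφCc).exists_bound_of_continuous
      (hdz j)
    exact (hGT j).bdd_mul (hdz j).aestronglyMeasurable hB
  have hint : ∀ j k i, Integrable (fun z => (dzb k (dz j (fun w => (φ w : ℂ))) z
      * (Real.exp (-φ z) : ℂ)) * moll (d i) (G j) z * starRingEnd ℂ (moll (d i) (G k) z)) := by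
    intro j k i
    refine Continuous.integrable_of_hasCompactSupport ?_ ?_
    · have h1 := (contDiff_moll (hd i) (hloc (hG j))).continuous
      have h2 := (contDiff_moll (hd i) (hloc (hG k))).continuous
      have h3 := hφ.continuous
      have h4 := hH j k
      fun_prop
    · exact ((isTestFun_moll (hd i) (hloc (hG j)) (hGc j)).2.1.mul_left).mul_right
  have hint' : ∀ j k, Integrable (fun z => (dzb k (dz j (fun w => (φ w : ℂ))) z
      * (Real.exp (-φ z) : ℂ)) * G j z * starRingEnd ℂ (G k z)) := by
    intro j k
    obtain ⟨B, hB⟩ := ((hasCompactSupport_wd (c := I) (j := k) (hasCompactSupport_wd (c := -I)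
      (j := j) hφCc)).mul_right (f' := fun z => (Real.exp (-φ z) : ℂ))).exists_bound_of_continuous
      ((hH j k).mul (by have := hφ.continuous; fun_prop))
    have := ((hGT j).bdd_mul (((hH j k).mul (by have := hφ.continuous; fun_prop :
      Continuous (fun z => (Real.exp (-φ z) : ℂ)))).aestronglyMeasurable) hB).2
    exact this.integrable_mul (hG k).star
  have hL : ∀ j k, Tendsto (fun i => ∫ z, (dzb k (dz j (fun w => (φ w : ℂ))) z
      * (Real.exp (-φ z) : ℂ)) * moll (d i) (G j) z * starRingEnd ℂ (moll (d i) (G k) z)) atTop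
      (𝓝 (∫ z, (dzb k (dz j (fun w => (φ w : ℂ))) z
      * (Real.exp (-φ z) : ℂ)) * G j z * starRingEnd ℂ (G k z))) := by
    intro j k
    obtain ⟨B, hB⟩ := ((hasCompactSupport_wd (c := I) (j := k) (hasCompactSupport_wd (c := -I)
      (j := j) hφCc)).mul_right (f' := fun z => (Real.exp (-φ z) : ℂ))).exists_bound_of_continuous
      ((hH j k).mul (by have := hφ.continuous; fun_prop))
    exact ((hGT j).bdd_mul (((hH j k).mul (by have := hφ.continuous; fun_prop :
      Continuous (fun z => (Real.exp (-φ z) : ℂ)))).aestronglyMeasurable) hB).integral_mul_conj (hGT k)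
  have split : ∀ g : Fin n → (Fin n → ℂ) → ℂ, (∀ j k, Integrable (fun z =>
      (dzb k (dz j (fun w => (φ w : ℂ))) z * (Real.exp (-φ z) : ℂ)) * g j z
        * starRingEnd ℂ (g k z))) →
      ∫ z, (∑ j, ∑ k, dzb k (dz j (fun w => (φ w : ℂ))) z * g j z * starRingEnd ℂ (g k z)).re
        * Real.exp (-φ z) = (∑ j, ∑ k, ∫ z, (dzb k (dz j (fun w => (φ w : ℂ))) z
      * (Real.exp (-φ z) : ℂ)) * g j z * starRingEnd ℂ (g k z)).re := by
    intro g hg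
    have h2 : ∀ j, ∑ k, ∫ z, (dzb k (dz j (fun w => (φ w : ℂ))) z
      * (Real.exp (-φ z) : ℂ)) * g j z * starRingEnd ℂ (g k z) = ∫ z, ∑ k,
        (dzb k (dz j (fun w => (φ w : ℂ))) z
      * (Real.exp (-φ z) : ℂ)) * g j z * starRingEnd ℂ (g k z) := fun j =>
      (integral_finsetSum _ fun k _ => hg j k).symm
    simp only [h2]
    rw [← integral_finsetSum _ fun j _ => integrable_finsetSum _ fun k _ => hg j k]
    rw [← RCLike.re_eq_complex_re, ← integral_re (integrable_finsetSum _ fun j _ =>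
      integrable_finsetSum _ fun k _ => hg j k)]
    refine integral_congr_ae (.of_forall fun z => ?_)
    simp only [RCLike.re_eq_complex_re]
    rw [← re_mul_ofReal, Finset.sum_mul]
    simp only [Finset.sum_mul]
    congr 1
    refine Finset.sum_congr rfl fun j _ => Finset.sum_congr rfl fun k _ => ?_
    ring
  have hLHS : Tendsto (fun i => ∫ z, (∑ j, ∑ k, dzb k (dz j (fun w => (φ w : ℂ))) z
      * moll (d i) (G j) z * starRingEnd ℂ (moll (d i) (G k) z)).re * Real.exp (-φ z)) atTop
      (𝓝 (∫ z, (∑ j, ∑ k, dzb k (dz j (fun w => (φ w : ℂ))) z * G j z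
        * starRingEnd ℂ (G k z)).re * Real.exp (-φ z))) := by
    rw [split G hint']
    have : ∀ i, _ := fun i => split (fun j => moll (d i) (G j)) (fun j k => hint j k i)
    simp only [this]
    exact (continuous_re.tendsto _).comp
      (tendsto_finsetSum _ fun j _ => tendsto_finsetSum _ fun k _ => hL j k)
  have hR1 := hA.integral_norm_sq hEm hE
  have hR2 : Tendsto (fun i => (1 / 2 : ℝ) * ∑ j, ∑ k, ∫ z, ‖moll (d i) (σ j k) z‖ ^ 2
      * Real.exp (-φ z)) atTop (𝓝 ((1 / 2 : ℝ) * ∑ j, ∑ k, ∫ z, ‖σ j k z‖ ^ 2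
      * Real.exp (-φ z))) :=
    (tendsto_finsetSum _ fun j _ => tendsto_finsetSum _ fun k _ =>
      (tendstoL2_moll (hσ j k) (hσc j k)).integral_norm_sq hEm hE).const_mul _
  refine le_of_tendsto_of_tendsto' hLHS (hR1.add hR2) fun i => ?_
  have key := kmh_smooth hφ (g := fun j => moll (d i) (G j))
    (fun j => isTestFun_moll (hd i) (hloc (hG j)) (hGc j))
  refine key.trans (le_of_eq ?_)
  have htest : ∀ x : Fin n → ℂ, IsTestFun n (fun t => (bump (d i) (x - t) : ℂ)) univ := fun x =>
    isTestFun_bump_sub (hd i) (subset_univ _)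
  congr 1
  · refine integral_congr_ae (.of_forall fun x => ?_)
    simp only
    congr 3
    simp only [wadj, Finset.sum_sub_distrib]
    congr 1
    simp only [dz, wd_moll (hd i) (hloc (hG _))]
    rw [Finset.sum_neg_distrib, moll_eq_integral_mul, neg_eq_iff_eq_neg]
    exact hmw _ (htest x)
  · congr 1
    refine Finset.sum_congr rfl fun j _ => Finset.sum_congr rfl fun k _ => ?_
    refine integral_congr_ae (.of_forall fun x => ?_)
    simp only
    congr 3
    simp only [dzb, wd_moll (hd i) (hloc (hG _))]
    rw [moll_eq_integral_mul, neg_sub_neg, ← neg_sub, neg_eq_iff_eq_neg]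
    exact hσw j k _ (htest x)

end WeakKMH

section KeyEstimate

lemma exists_cutoff {K D : Set (Fin n → ℂ)} (hK : IsCompact K) (hD : IsOpen D) (hKD : K ⊆ D) :
    ∃ χ : (Fin n → ℂ) → ℝ, ContDiff ℝ (⊤ : ℕ∞) χ ∧ HasCompactSupport χ ∧ tsupport χ ⊆ D ∧
      (∀ᶠ z in 𝓝ˢ K, χ z = 1) ∧ ∀ z, χ z ∈ Icc (0 : ℝ) 1 := by
  obtain ⟨L, hL, hKL, hLD⟩ := exists_compact_between hK hD hKD
  obtain ⟨f, h1, h0, hI⟩ := exists_contMDiffMap_one_nhds_of_subset_interior (n := ((⊤ : ℕ∞)))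
    (modelWithCornersSelf ℝ (Fin n → ℂ)) hK.isClosed hKL
  have hs : tsupport f ⊆ L := closure_minimal (fun z hz => by
    by_contra h; exact hz (h0 z h)) hL.isClosed
  exact ⟨f, f.contMDiff.contDiff, hL.of_isClosed_subset (isClosed_tsupport _) hs, hs.trans hLD, h1, hI⟩

lemma memLp_mul_of_tsupport {w γ : (Fin n → ℂ) → ℂ} {D : Set (Fin n → ℂ)} (hD : IsOpen D)
    (hw : Continuous w) (hc : HasCompactSupport w) (hwD : tsupport w ⊆ D)
    (hγ : MemLp γ 2 (volume.restrict D)) : MemLp (fun z => w z * γ z) 2 := by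
  have e : (fun z => w z * γ z) = D.indicator (fun z => w z * γ z) := by
    ext z
    by_cases hz : z ∈ D
    · rw [indicator_of_mem hz]
    · rw [indicator_of_notMem hz, image_eq_zero_of_notMem_tsupport fun h => hz (hwD h), zero_mul]
  rw [e, memLp_indicator_iff_restrict hD.measurableSet]
  obtain ⟨C, hC⟩ := hc.exists_bound_of_continuous hw
  exact hγ.of_le_mul (c := C) (hw.aestronglyMeasurable.mul hγ.1) (.of_forall fun x => by
    rw [norm_mul]; exact mul_le_mul_of_nonneg_right (hC x) (norm_nonneg _))

lemma eq_zero_of_notMem_tsupport_wd {c : ℂ} {j : Fin n} {u : (Fin n → ℂ) → ℂ} {z : Fin n → ℂ}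
    (hz : z ∉ tsupport u) : wd c j u z = 0 :=
  image_eq_zero_of_notMem_tsupport fun h => hz (tsupport_wd_subset h)

lemma tsupport_ofReal_subset (χ : (Fin n → ℂ) → ℝ) :
    tsupport (fun z => (χ z : ℂ)) ⊆ tsupport χ :=
  closure_mono fun z hz h0 => hz (by simp [h0])

lemma wd_exp {φ : (Fin n → ℂ) → ℝ} {z : Fin n → ℂ} (hφ : DifferentiableAt ℝ φ z) (c : ℂ)
    (j : Fin n) : wd c j (fun w => ((Real.exp (φ w) : ℝ) : ℂ)) z
      = ((Real.exp (φ z) : ℝ) : ℂ) * wd c j (fun w => (φ w : ℂ)) z := by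
  have h1 : HasFDerivAt (fun w => (φ w : ℂ)) (ofRealCLM.comp (fderiv ℝ φ z)) z :=
    ofRealCLM.hasFDerivAt.comp z hφ.hasFDerivAt
  have h2 : HasFDerivAt (fun w => ((Real.exp (φ w) : ℝ) : ℂ))
      (ofRealCLM.comp (Real.exp (φ z) • fderiv ℝ φ z)) z :=
    ofRealCLM.hasFDerivAt.comp z hφ.hasFDerivAt.exp
  simp only [wd, h1.fderiv, h2.fderiv]
  simp
  ring

/-- The basic estimate for `η • g`, where `g = e^{Φ/2} γ` is weakly `∂̄`-closed and
`T = e^{-Φ/2} ∂̄^* g`. -/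
theorem cutoff_estimate {D : Set (Fin n → ℂ)} (hD : IsOpen D) {Φ : (Fin n → ℂ) → ℝ}
    (hΦ : ContDiffOn ℝ (⊤ : ℕ∞) Φ D) {η : (Fin n → ℂ) → ℝ} (hη : ContDiff ℝ (⊤ : ℕ∞) η)
    (hηc : HasCompactSupport η) (hηD : tsupport η ⊆ D)
    {γ : Fin n → (Fin n → ℂ) → ℂ} (hγ : ∀ j, MemLp (γ j) 2 (volume.restrict D))
    {T : (Fin n → ℂ) → ℂ} (hT : MemLp T 2 (volume.restrict D))
    (hcl : ∀ j k ψ, IsTestFun n ψ D → ∫ z, γ j z * (((Real.exp (Φ z / 2) : ℝ) : ℂ) * dzb k ψ z)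
      = ∫ z, γ k z * (((Real.exp (Φ z / 2) : ℝ) : ℂ) * dzb j ψ z))
    (ht : ∀ ψ, IsTestFun n ψ D → ∑ j, ∫ z, γ j z * (((Real.exp (-Φ z / 2) : ℝ) : ℂ) * dz j ψ z)
      = ∫ z, T z * (((Real.exp (-Φ z / 2) : ℝ) : ℂ) * ψ z)) :
    ∫ z, (∑ j, ∑ k, dzb k (dz j (fun w => (Φ w : ℂ))) z * γ j z * starRingEnd ℂ (γ k z)).re
        * η z ^ 2 ≤
      (∫ z, ‖(∑ j, dz j (fun w => (η w : ℂ)) z * γ j z) - η z * T z‖ ^ 2) +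
        (1 / 2) * ∑ j, ∑ k, ∫ z, ‖dzb k (fun w => (η w : ℂ)) z * γ j z
          - dzb j (fun w => (η w : ℂ)) z * γ k z‖ ^ 2 := by
  obtain ⟨χ, hχ, hχc, hχD, hχ1, -⟩ := exists_cutoff hηc hD hηD
  set φ : (Fin n → ℂ) → ℝ := fun z => Φ z * χ z with hφ_def
  have hφC : ContDiff ℝ (⊤ : ℕ∞) (fun z => (φ z : ℂ)) := by
    have := contDiff_mul_of_tsupport hD (f := fun z => (Φ z : ℂ)) (g := fun z => (χ z : ℂ))
      (ofRealCLM.contDiff.comp_contDiffOn hΦ) (contDiff_ofReal hχ) ((tsupport_ofReal_subset χ).trans hχD)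
    simpa [hφ_def] using this
  have hφ : ContDiff ℝ (⊤ : ℕ∞) φ := by
    have := reCLM.contDiff.comp hφC
    simpa [Function.comp_def] using this
  have hφc : HasCompactSupport φ := hχc.mul_left
  have hφη : ∀ z ∈ tsupport η, φ =ᶠ[𝓝 z] Φ := fun z hz => by
    filter_upwards [eventually_nhdsSet_iff_forall.1 hχ1 z hz] with w hw
    simp [hφ_def, hw]
  set e : (Fin n → ℂ) → ℂ := fun z => (η z : ℂ) with he_def
  have he : ContDiff ℝ (⊤ : ℕ∞) e := contDiff_ofReal hη
  have hets : tsupport e ⊆ tsupport η := tsupport_ofReal_subset η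
  have heD : tsupport e ⊆ D := hets.trans hηD
  have hec : HasCompactSupport e := hηc.of_isClosed_subset (isClosed_tsupport _) hets
  have he0 : ∀ {z}, z ∉ tsupport e → e z = 0 := fun h => image_eq_zero_of_notMem_tsupport h
  have hφe : ∀ z ∈ tsupport e, φ z = Φ z := fun z hz => (hφη z (hets hz)).eq_of_nhds
  set E : (Fin n → ℂ) → ℂ := fun z => ((Real.exp (φ z / 2) : ℝ) : ℂ) with hE_def
  have hE : ContDiff ℝ (⊤ : ℕ∞) E := contDiff_ofReal ((hφ.div_const 2).exp)
  set F : (Fin n → ℂ) → ℂ := fun z => ((Real.exp (φ z) : ℝ) : ℂ) with hF_def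
  have hF : ContDiff ℝ (⊤ : ℕ∞) F := contDiff_ofReal hφ.exp
  have hEF : ∀ z, ((Real.exp (-φ z / 2) : ℝ) : ℂ) * F z = E z := fun z => by
    rw [hE_def, hF_def]; simp only; rw [← ofReal_mul, ← Real.exp_add]; congr 2; ring
  have hE2 : ∀ z, ‖E z‖ ^ 2 * Real.exp (-φ z) = 1 := fun z => by
    rw [hE_def]; simp only
    rw [norm_real, Real.norm_eq_abs, abs_of_pos (Real.exp_pos _), sq, ← Real.exp_add,
      ← Real.exp_add]; simp
  have hdφ : ∀ j, ContDiff ℝ (⊤ : ℕ∞) (dz j (fun w => (φ w : ℂ))) := fun j => contDiff_wd hφC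
  have L2w : ∀ {w f : (Fin n → ℂ) → ℂ}, Continuous w → tsupport w ⊆ tsupport e →
      MemLp f 2 (volume.restrict D) → MemLp (fun z => w z * f z) 2 ∧
        HasCompactSupport (fun z => w z * f z) := fun {w f} hw hs hf => by
    have hwc : HasCompactSupport w := hec.of_isClosed_subset (isClosed_tsupport _) hs
    exact ⟨memLp_mul_of_tsupport hD hw hwc (hs.trans heD) hf, hwc.mul_right⟩
  have hit : ∀ {f ψ : (Fin n → ℂ) → ℂ}, MemLp f 2 → Continuous ψ → HasCompactSupport ψ →
      Integrable (fun z => f z * ψ z) := fun hf hψ hψc =>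
    MemLp.integrable_mul (p := 2) (q := 2) hf (hψ.memLp_of_hasCompactSupport hψc)
  -- the weights
  have w1 : Continuous (fun z => E z * e z) := (hE.mul he).continuous
  have s1 : tsupport (fun z => E z * e z) ⊆ tsupport e := tsupport_mul_subset_right
  have w2 : ∀ c j, Continuous (fun z => E z * wd c j e z) := fun c j =>
    (hE.mul (contDiff_wd he)).continuous
  have s2 : ∀ c j, tsupport (fun z => E z * wd c j e z) ⊆ tsupport e := fun c j =>
    tsupport_mul_subset_right.trans tsupport_wd_subset
  have w3 : ∀ j, Continuous (fun z => dz j (fun w => (φ w : ℂ)) z * (E z * e z)) := fun j =>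
    (hdφ j).continuous.mul w1
  have s3 : ∀ j, tsupport (fun z => dz j (fun w => (φ w : ℂ)) z * (E z * e z)) ⊆ tsupport e :=
    fun j => tsupport_mul_subset_right.trans s1
  have w4 : ∀ j, Continuous (fun z => dz j (fun w => (φ w : ℂ)) z * (E z * e z)
      + E z * dz j e z) := fun j => (w3 j).add (w2 _ j)
  have s4 : ∀ j, tsupport (fun z => dz j (fun w => (φ w : ℂ)) z * (E z * e z)
      + E z * dz j e z) ⊆ tsupport e := fun j =>
    closure_minimal (fun z hz => by
      by_contra h
      exact hz (by
        simp only
        rw [he0 h, show dz j e z = 0 from eq_zero_of_notMem_tsupport_wd h]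
        ring)) (isClosed_tsupport e)
  set G : Fin n → (Fin n → ℂ) → ℂ := fun j z => (E z * e z) * γ j z with hG_def
  set m : (Fin n → ℂ) → ℂ := fun z => (∑ j, (dz j (fun w => (φ w : ℂ)) z * (E z * e z)
      + E z * dz j e z) * γ j z) - (E z * e z) * T z with hm_def
  set σ : Fin n → Fin n → (Fin n → ℂ) → ℂ := fun j k z => (E z * dzb k e z) * γ j z
      - (E z * dzb j e z) * γ k z with hσ_def
  have hsumc : ∀ {f : Fin n → (Fin n → ℂ) → ℂ}, (∀ j, HasCompactSupport (f j)) →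
      HasCompactSupport (fun z => ∑ j, f j z) := by
    intro f hf
    have : (fun z => ∑ j, f j z) = ∑ j, f j := by ext z; simp
    rw [this]
    exact Finset.sum_induction _ HasCompactSupport (fun _ _ => HasCompactSupport.add)
      (HasCompactSupport.zero) fun j _ => hf j
  have hG : ∀ j, MemLp (G j) 2 ∧ HasCompactSupport (G j) := fun j => L2w w1 s1 (hγ j)
  have hm : MemLp m 2 ∧ HasCompactSupport m :=
    ⟨(memLp_finsetSum _ fun j _ => (L2w (w4 j) (s4 j) (hγ j)).1).sub (L2w w1 s1 hT).1,
      (hsumc fun j => (L2w (w4 j) (s4 j) (hγ j)).2).sub (L2w w1 s1 hT).2⟩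
  have hσ : ∀ j k, MemLp (σ j k) 2 ∧ HasCompactSupport (σ j k) := fun j k =>
    ⟨(L2w (w2 _ k) (s2 _ k) (hγ j)).1.sub (L2w (w2 _ j) (s2 _ j) (hγ k)).1,
      (L2w (w2 _ k) (s2 _ k) (hγ j)).2.sub (L2w (w2 _ j) (s2 _ j) (hγ k)).2⟩
  have hte : ∀ {ψ}, IsTestFun n ψ univ → IsTestFun n (fun z => e z * ψ z) D := fun {ψ} hψ =>
    ⟨he.mul hψ.1, hec.mul_right, (tsupport_mul_subset_left).trans heD⟩
  have hdiff : ∀ {u : (Fin n → ℂ) → ℂ}, ContDiff ℝ (⊤ : ℕ∞) u → ∀ z, DifferentiableAt ℝ u z :=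
    fun hu z => (hu.differentiable (by simp)) z
  have hmw : ∀ ψ, IsTestFun n ψ univ → ∑ j, ∫ z, G j z * dz j ψ z = -∫ z, m z * ψ z := by
    intro ψ hψ
    have h0 := ht _ (isTestFun_mul hD hF.contDiffOn (hte hψ))
    have h1 : ∀ j, ∫ z, γ j z * (((Real.exp (-Φ z / 2) : ℝ) : ℂ)
        * dz j (fun z => F z * (e z * ψ z)) z) = (∫ z, ((dz j (fun w => (φ w : ℂ)) z * (E z * e z)
      + E z * dz j e z) * γ j z) * ψ z) + ∫ z, G j z * dz j ψ z := by
      intro j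
      rw [← integral_add (hit (L2w (w4 j) (s4 j) (hγ j)).1 hψ.1.continuous hψ.2.1)
        (hit (hG j).1 (contDiff_wd hψ.1).continuous (hasCompactSupport_wd hψ.2.1))]
      refine integral_congr_ae (.of_forall fun z => ?_)
      simp only [dz, hG_def]
      rw [wd_mul (hdiff hF z) (hdiff (he.mul hψ.1) z), wd_mul (hdiff he z) (hdiff hψ.1 z), hF_def,
        wd_exp (hφ.differentiable (by simp) z)]
      by_cases hz : z ∈ tsupport e
      · rw [← hEF z, ← hφe z hz]; ring
      · rw [he0 hz, eq_zero_of_notMem_tsupport_wd hz]; ring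
    have h2 : ∫ z, T z * (((Real.exp (-Φ z / 2) : ℝ) : ℂ) * (F z * (e z * ψ z)))
        = ∫ z, (E z * e z) * T z * ψ z := by
      refine integral_congr_ae (.of_forall fun z => ?_)
      simp only
      by_cases hz : z ∈ tsupport e
      · rw [← hEF z, ← hφe z hz]; ring
      · rw [he0 hz]; ring
    rw [h2] at h0
    simp only [h1, Finset.sum_add_distrib] at h0
    have h3 : ∫ z, m z * ψ z = (∑ j, ∫ z, ((dz j (fun w => (φ w : ℂ)) z * (E z * e z)
      + E z * dz j e z) * γ j z) * ψ z) - ∫ z, (E z * e z) * T z * ψ z := by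
      rw [← integral_finsetSum _ fun j _ =>
        hit (L2w (w4 j) (s4 j) (hγ j)).1 hψ.1.continuous hψ.2.1, ← integral_sub
        (integrable_finsetSum _ fun j _ =>
          hit (L2w (w4 j) (s4 j) (hγ j)).1 hψ.1.continuous hψ.2.1)
        (hit (L2w w1 s1 hT).1 hψ.1.continuous hψ.2.1)]
      refine integral_congr_ae (.of_forall fun z => ?_)
      simp only [hm_def, sub_mul, Finset.sum_mul]
    rw [h3, ← h0]
    ring
  have hσw : ∀ j k, ∀ ψ, IsTestFun n ψ univ →
      (∫ z, G j z * dzb k ψ z) - ∫ z, G k z * dzb j ψ z = -∫ z, σ j k z * ψ z := by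
    intro j k ψ hψ
    have h0 := hcl j k _ (hte hψ)
    have h1 : ∀ j k, ∫ z, γ j z * (((Real.exp (Φ z / 2) : ℝ) : ℂ)
        * dzb k (fun z => e z * ψ z) z) = (∫ z, (E z * dzb k e z) * γ j z * ψ z)
          + ∫ z, G j z * dzb k ψ z := by
      intro j k
      rw [← integral_add (hit (L2w (w2 _ k) (s2 _ k) (hγ j)).1 hψ.1.continuous hψ.2.1)
        (hit (hG j).1 (contDiff_wd hψ.1).continuous (hasCompactSupport_wd hψ.2.1))]
      refine integral_congr_ae (.of_forall fun z => ?_)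
      simp only [dzb, hG_def]
      rw [wd_mul (hdiff he z) (hdiff hψ.1 z)]
      by_cases hz : z ∈ tsupport e
      · rw [hE_def, ← hφe z hz]; ring
      · rw [he0 hz, eq_zero_of_notMem_tsupport_wd hz]; ring
    rw [h1, h1] at h0
    have h3 : ∫ z, σ j k z * ψ z = (∫ z, (E z * dzb k e z) * γ j z * ψ z)
        - ∫ z, (E z * dzb j e z) * γ k z * ψ z := by
      rw [← integral_sub (hit (L2w (w2 _ k) (s2 _ k) (hγ j)).1 hψ.1.continuous hψ.2.1)
        (hit (L2w (w2 _ j) (s2 _ j) (hγ k)).1 hψ.1.continuous hψ.2.1)]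
      refine integral_congr_ae (.of_forall fun z => ?_)
      simp only [hσ_def, sub_mul]
    rw [h3]
    linear_combination h0
  have key := kmh_weak hφ hφc (fun j => (hG j).1) (fun j => (hG j).2) hm.1 hm.2 hmw
    (fun j k => (hσ j k).1) (fun j k => (hσ j k).2) hσw
  refine le_of_eq_of_le ?_ (key.trans (le_of_eq ?_))
  · refine integral_congr_ae (.of_forall fun z => ?_)
    simp only
    rw [← re_mul_ofReal, ← re_mul_ofReal, Finset.sum_mul, Finset.sum_mul]
    simp only [Finset.sum_mul]
    congr 1
    refine Finset.sum_congr rfl fun j _ => Finset.sum_congr rfl fun k _ => ?_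
    by_cases hz : z ∈ tsupport e
    · have h2 : dzb k (dz j (fun w => (φ w : ℂ))) z = dzb k (dz j (fun w => (Φ w : ℂ))) z := by
        refine wd_congr ?_
        filter_upwards [(hφη z (hets hz)).eventuallyEq_nhds] with y hy
        exact wd_congr (by filter_upwards [hy] with x hx; rw [hx])
      have h3 : E z * starRingEnd ℂ (E z) * ((Real.exp (-φ z) : ℝ) : ℂ) = 1 := by
        rw [mul_conj, normSq_eq_norm_sq, ← ofReal_mul, hE2, ofReal_one]
      have h4 : starRingEnd ℂ (e z) = e z := conj_ofReal _
      rw [h2]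
      simp only [hG_def, map_mul, h4, ofReal_pow]
      linear_combination (-(dzb k (dz j (fun w => (Φ w : ℂ))) z * γ j z * starRingEnd ℂ (γ k z)
        * e z ^ 2)) * h3
    · have h4 : (η z : ℂ) = 0 := he0 hz
      simp [hG_def, he0 hz, ofReal_eq_zero.1 h4]
  · have sq : ∀ z a, ‖E z * a‖ ^ 2 * Real.exp (-φ z) = ‖a‖ ^ 2 := fun z a => by
      rw [norm_mul, mul_pow]; linear_combination ‖a‖ ^ 2 * hE2 z
    congr 1
    · refine integral_congr_ae (.of_forall fun z => ?_)
      simp only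
      refine Eq.trans ?_ (sq z _)
      congr 3
      simp only [hm_def, hG_def, mul_sub, Finset.mul_sum, add_mul, Finset.sum_add_distrib]
      have h1 : ∑ j, dz j (fun w => (φ w : ℂ)) z * (E z * e z) * γ j z
          = ∑ j, dz j (fun w => (φ w : ℂ)) z * (E z * e z * γ j z) :=
        Finset.sum_congr rfl fun j _ => by ring
      have h2 : ∑ j, E z * dz j e z * γ j z = ∑ j, E z * (dz j e z * γ j z) :=
        Finset.sum_congr rfl fun j _ => by ring
      rw [h1, h2]
      change _ = _ - E z * (e z * T z)
      ring
    · congr 1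
      refine Finset.sum_congr rfl fun j _ => Finset.sum_congr rfl fun k _ => ?_
      refine integral_congr_ae (.of_forall fun z => ?_)
      simp only
      refine Eq.trans ?_ (sq z _)
      congr 3
      simp only [hσ_def]
      ring

end KeyEstimate

section KeyEstimate

/-- The Levi form of `Φ` at `z` in the direction `ξ`. -/
noncomputable def levi (Φ : (Fin n → ℂ) → ℝ) (z ξ : Fin n → ℂ) : ℝ :=
  (∑ j, ∑ k, dzb k (dz j (fun w => (Φ w : ℂ))) z * ξ j * starRingEnd ℂ (ξ k)).re

/-- Existence of cutoff functions exhausting `D` whose gradients are controlled by the Levi form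
of the weight `Φ`. -/
def HasGoodCutoffs (D : Set (Fin n → ℂ)) (Φ : (Fin n → ℂ) → ℝ) : Prop :=
  ∃ (η : ℕ → (Fin n → ℂ) → ℝ) (ε : ℕ → ℝ), Tendsto ε atTop (𝓝 0) ∧
    (∀ m, ContDiff ℝ (⊤ : ℕ∞) (η m) ∧ HasCompactSupport (η m) ∧ tsupport (η m) ⊆ D) ∧
    (∀ m z, η m z ∈ Icc (0 : ℝ) 1) ∧
    (∀ m, ∀ z ∈ D, ∀ ξ : Fin n → ℂ, (η m z ^ 2 + 4 * ∑ j, ‖dz j (fun w => (η m w : ℂ)) z‖ ^ 2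
      - ε m) * ∑ j, ‖ξ j‖ ^ 2 ≤ levi Φ z ξ * η m z ^ 2) ∧
    ∀ z ∈ D, Tendsto (fun m => η m z) atTop (𝓝 1)

lemma norm_dzb_ofReal (η : (Fin n → ℂ) → ℝ) (j : Fin n) (z : Fin n → ℂ) :
    ‖dzb j (fun w => (η w : ℂ)) z‖ = ‖dz j (fun w => (η w : ℂ)) z‖ := by
  have h : dzb j (fun w => (η w : ℂ)) z = starRingEnd ℂ (dz j (fun w => (η w : ℂ)) z) := by
    have := wd_conj (c := I) (j := j) (u := fun w => (η w : ℂ)) (z := z)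
    simpa using this
  rw [h, RCLike.norm_conj]

lemma norm_sum_mul_sq_le (a b : Fin n → ℂ) :
    ‖∑ j, a j * b j‖ ^ 2 ≤ (∑ j, ‖a j‖ ^ 2) * ∑ j, ‖b j‖ ^ 2 := by
  refine le_trans ?_ (Finset.sum_mul_sq_le_sq_mul_sq Finset.univ (fun j => ‖a j‖) (fun j => ‖b j‖))
  refine pow_le_pow_left₀ (norm_nonneg _) ((norm_sum_le _ _).trans (le_of_eq ?_)) 2
  simp

lemma norm_sub_sq_le (a b : ℂ) : ‖a - b‖ ^ 2 ≤ 2 * ‖a‖ ^ 2 + 2 * ‖b‖ ^ 2 := by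
  have h1 := norm_sub_le a b
  nlinarith [norm_nonneg (a - b), sq_nonneg (‖a‖ - ‖b‖), norm_nonneg a, norm_nonneg b]

/-- The a priori estimate `‖g‖² ≤ 2 ‖∂̄^* g‖²` for weakly `∂̄`-closed forms. -/
theorem key_estimate {D : Set (Fin n → ℂ)} (hD : IsOpen D) {Φ : (Fin n → ℂ) → ℝ}
    (hΦ : ContDiffOn ℝ (⊤ : ℕ∞) Φ D) (hg : HasGoodCutoffs D Φ)
    {γ : Fin n → (Fin n → ℂ) → ℂ} (hγ : ∀ j, MemLp (γ j) 2 (volume.restrict D))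
    {T : (Fin n → ℂ) → ℂ} (hT : MemLp T 2 (volume.restrict D))
    (hcl : ∀ j k ψ, IsTestFun n ψ D → ∫ z, γ j z * (((Real.exp (Φ z / 2) : ℝ) : ℂ) * dzb k ψ z)
      = ∫ z, γ k z * (((Real.exp (Φ z / 2) : ℝ) : ℂ) * dzb j ψ z))
    (ht : ∀ ψ, IsTestFun n ψ D → ∑ j, ∫ z, γ j z * (((Real.exp (-Φ z / 2) : ℝ) : ℂ) * dz j ψ z)
      = ∫ z, T z * (((Real.exp (-Φ z / 2) : ℝ) : ℂ) * ψ z)) :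
    ∫ z in D, ∑ j, ‖γ j z‖ ^ 2 ≤ 2 * ∫ z in D, ‖T z‖ ^ 2 := by
  obtain ⟨η, ε, hε, hη, h01, hlevi, hlim⟩ := hg
  have hsq : ∀ {f : (Fin n → ℂ) → ℂ}, MemLp f 2 (volume.restrict D) →
      IntegrableOn (fun z => ‖f z‖ ^ 2) D := fun hf => hf.integrable_norm_pow (by norm_num)
  have hS : IntegrableOn (fun z => ∑ j, ‖γ j z‖ ^ 2) D :=
    integrable_finsetSum _ fun j _ => hsq (hγ j)
  have hw : ∀ {w : (Fin n → ℂ) → ℝ} {f : (Fin n → ℂ) → ℝ}, Continuous w → HasCompactSupport w →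
      IntegrableOn f D → IntegrableOn (fun z => w z * f z) D := fun {w f} hw hc hf => by
    obtain ⟨C, hC⟩ := hc.exists_bound_of_continuous hw
    exact Integrable.bdd_mul (c := C) hf hw.aestronglyMeasurable (.of_forall hC)
  have main : ∀ m, ∫ z in D, η m z ^ 2 * ∑ j, ‖γ j z‖ ^ 2 ≤
      ε m * (∫ z in D, ∑ j, ‖γ j z‖ ^ 2) + 2 * ∫ z in D, ‖T z‖ ^ 2 := by
    intro m
    obtain ⟨hη1, hηc, hηD⟩ := hη m
    set e : (Fin n → ℂ) → ℂ := fun w => (η m w : ℂ) with he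
    have heC : ContDiff ℝ (⊤ : ℕ∞) e := contDiff_ofReal hη1
    have hec : HasCompactSupport e := hηc.of_isClosed_subset (isClosed_tsupport _)
      (tsupport_ofReal_subset _)
    have heD : tsupport e ⊆ D := (tsupport_ofReal_subset _).trans hηD
    have key := cutoff_estimate hD hΦ hη1 hηc hηD hγ hT hcl ht
    have hη0 : ∀ z, z ∉ D → η m z = 0 := fun z hz =>
      image_eq_zero_of_notMem_tsupport fun h => hz (hηD h)
    have hde0 : ∀ c j z, z ∉ D → wd c j e z = 0 := fun c j z hz =>
      eq_zero_of_notMem_tsupport_wd fun h => hz (heD h)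
    have cη : Continuous (fun z => η m z ^ 2) := hη1.continuous.pow 2
    have cηc : HasCompactSupport (fun z => η m z ^ 2) :=
      hηc.comp_left (g := fun t : ℝ => t ^ 2) (by simp)
    have cd : ∀ j, Continuous (fun z => ‖dz j e z‖ ^ 2) := fun j =>
      (contDiff_wd heC).continuous.norm.pow 2
    have cdc : ∀ j, HasCompactSupport (fun z => ‖dz j e z‖ ^ 2) := fun j =>
      (hasCompactSupport_wd hec).comp_left (g := fun t : ℂ => ‖t‖ ^ 2) (by simp)
    have iη := hw cη cηc hS
    have iηT := hw cη cηc (hsq hT)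
    have id : ∀ j, IntegrableOn (fun z => ‖dz j e z‖ ^ 2 * ∑ j, ‖γ j z‖ ^ 2) D := fun j =>
      hw (cd j) (cdc j) hS
    have iA : IntegrableOn (fun z => (∑ j, ‖dz j e z‖ ^ 2) * ∑ j, ‖γ j z‖ ^ 2) D := by
      simp only [Finset.sum_mul (s := Finset.univ) (f := fun j => ‖dz j e _‖ ^ 2)]
      exact integrable_finsetSum _ fun j _ => id j
    -- the Levi term
    have iL : IntegrableOn (fun z => levi Φ z (fun j => γ j z) * η m z ^ 2) D := by
      have : ∀ j k, IntegrableOn (fun z => (dzb k (dz j (fun w => (Φ w : ℂ))) z * (e z * e z)) *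
          (γ j z * starRingEnd ℂ (γ k z))) D := by
        intro j k
        have hc1 : Continuous (fun z => dzb k (dz j (fun w => (Φ w : ℂ))) z * (e z * e z)) :=
          continuous_mul_of_tsupport hD
            (contDiffOn_wd hD (contDiffOn_wd hD (ofRealCLM.contDiff.comp_contDiffOn hΦ))).continuousOn
            (heC.continuous.mul heC.continuous) ((tsupport_mul_subset_left).trans heD)
        have hc2 : HasCompactSupport (fun z => dzb k (dz j (fun w => (Φ w : ℂ))) z * (e z * e z)) :=
          (hec.mul_left (f := e)).mul_left
        obtain ⟨C, hC⟩ := hc2.exists_bound_of_continuous hc1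
        exact Integrable.bdd_mul (c := C) (MemLp.integrable_mul (p := 2) (q := 2) (hγ j) (hγ k).star)
          hc1.aestronglyMeasurable (.of_forall hC)
      have h2 : IntegrableOn (fun z => ∑ j, ∑ k, (dzb k (dz j (fun w => (Φ w : ℂ))) z * (e z * e z)) *
          (γ j z * starRingEnd ℂ (γ k z))) D :=
        integrable_finsetSum _ fun j _ => integrable_finsetSum _ fun k _ => this j k
      refine h2.re.congr (.of_forall fun z => ?_)
      simp only [levi, RCLike.re_eq_complex_re]
      rw [← re_mul_ofReal, Finset.sum_mul]
      simp only [Finset.sum_mul]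
      congr 1
      refine Finset.sum_congr rfl fun j _ => Finset.sum_congr rfl fun k _ => ?_
      simp only [he]
      push_cast
      ring
    have i2 : IntegrableOn (fun z => η m z ^ 2 * (∑ j, ‖γ j z‖ ^ 2) + 4 * ((∑ j, ‖dz j e z‖ ^ 2)
        * ∑ j, ‖γ j z‖ ^ 2)) D := iη.add (iA.const_mul 4)
    have i1 : IntegrableOn (fun z => η m z ^ 2 * (∑ j, ‖γ j z‖ ^ 2) + 4 * ((∑ j, ‖dz j e z‖ ^ 2)
        * ∑ j, ‖γ j z‖ ^ 2) - ε m * ∑ j, ‖γ j z‖ ^ 2) D := i2.sub (hS.const_mul _)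
    have hL : ∫ z in D, (η m z ^ 2 * (∑ j, ‖γ j z‖ ^ 2) + 4 * ((∑ j, ‖dz j e z‖ ^ 2)
        * ∑ j, ‖γ j z‖ ^ 2) - ε m * ∑ j, ‖γ j z‖ ^ 2) ≤ ∫ z,
        (∑ j, ∑ k, dzb k (dz j (fun w => (Φ w : ℂ))) z * γ j z * starRingEnd ℂ (γ k z)).re
        * η m z ^ 2 := by
      refine le_of_le_of_eq ?_ (setIntegral_eq_integral_of_forall_compl_eq_zero (s := D)
        fun z hz => by rw [hη0 z hz]; simp)
      refine setIntegral_mono_on i1 iL hD.measurableSet fun z hz => ?_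
      have := hlevi m z hz (fun j => γ j z)
      refine le_trans (le_of_eq ?_) this
      ring
    have hR1 : ∫ z, ‖(∑ j, dz j e z * γ j z) - η m z * T z‖ ^ 2 ≤
        ∫ z in D, (2 * ((∑ j, ‖dz j e z‖ ^ 2) * ∑ j, ‖γ j z‖ ^ 2)
          + 2 * (η m z ^ 2 * ‖T z‖ ^ 2)) := by
      rw [← setIntegral_eq_integral_of_forall_compl_eq_zero (s := D) fun z hz => by
        simp [hη0 z hz, dz, hde0 _ _ z hz]]
      refine integral_mono_of_nonneg (.of_forall fun z => by positivity)
        ((iA.const_mul 2).add (iηT.const_mul 2)) (.of_forall fun z => ?_)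
      refine (norm_sub_sq_le _ _).trans (add_le_add ?_ (le_of_eq ?_))
      · exact mul_le_mul_of_nonneg_left (norm_sum_mul_sq_le _ _) (by norm_num)
      · rw [norm_mul, mul_pow, norm_real, Real.norm_eq_abs, sq_abs]
    have hR2 : ∀ j k, ∫ z, ‖dzb k e z * γ j z - dzb j e z * γ k z‖ ^ 2 ≤
        ∫ z in D, (2 * (‖dz k e z‖ ^ 2 * ‖γ j z‖ ^ 2) + 2 * (‖dz j e z‖ ^ 2 * ‖γ k z‖ ^ 2)) := by
      intro j k
      rw [← setIntegral_eq_integral_of_forall_compl_eq_zero (s := D) fun z hz => by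
        simp [dzb, hde0 _ _ z hz]]
      refine integral_mono_of_nonneg (.of_forall fun z => by positivity)
        (((hw (cd k) (cdc k) (hsq (hγ j))).const_mul 2).add
          ((hw (cd j) (cdc j) (hsq (hγ k))).const_mul 2)) (.of_forall fun z => ?_)
      refine (norm_sub_sq_le _ _).trans (le_of_eq ?_)
      simp only [he, norm_mul, mul_pow, norm_dzb_ofReal]
    have hR2' : (1 / 2 : ℝ) * ∑ j, ∑ k, ∫ z, ‖dzb k e z * γ j z - dzb j e z * γ k z‖ ^ 2 ≤
        ∫ z in D, 2 * ((∑ j, ‖dz j e z‖ ^ 2) * ∑ j, ‖γ j z‖ ^ 2) := by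
      have hi : ∀ j k, IntegrableOn (fun z => 2 * (‖dz k e z‖ ^ 2 * ‖γ j z‖ ^ 2)
          + 2 * (‖dz j e z‖ ^ 2 * ‖γ k z‖ ^ 2)) D := fun j k =>
        ((hw (cd k) (cdc k) (hsq (hγ j))).const_mul 2).add
          ((hw (cd j) (cdc j) (hsq (hγ k))).const_mul 2)
      calc _ ≤ (1 / 2 : ℝ) * ∑ j, ∑ k, ∫ z in D, (2 * (‖dz k e z‖ ^ 2 * ‖γ j z‖ ^ 2)
            + 2 * (‖dz j e z‖ ^ 2 * ‖γ k z‖ ^ 2)) :=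
            mul_le_mul_of_nonneg_left (Finset.sum_le_sum fun j _ => Finset.sum_le_sum fun k _ =>
              hR2 j k) (by norm_num)
        _ = (1 / 2 : ℝ) * ∫ z in D, ∑ j, ∑ k, (2 * (‖dz k e z‖ ^ 2 * ‖γ j z‖ ^ 2)
            + 2 * (‖dz j e z‖ ^ 2 * ‖γ k z‖ ^ 2)) := by
            rw [integral_finsetSum _ fun j _ => integrable_finsetSum _ fun k _ => hi j k]
            congr 1
            refine Finset.sum_congr rfl fun j _ => ?_
            rw [integral_finsetSum _ fun k _ => hi j k]
        _ = _ := by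
            rw [← integral_const_mul]
            refine integral_congr_ae (.of_forall fun z => ?_)
            simp only [Finset.sum_add_distrib, ← Finset.mul_sum, ← Finset.sum_mul]
            ring
    have h5 := hL.trans (key.trans (add_le_add hR1 hR2'))
    have e1 : ∫ z in D, (η m z ^ 2 * (∑ j, ‖γ j z‖ ^ 2) + 4 * ((∑ j, ‖dz j e z‖ ^ 2)
        * ∑ j, ‖γ j z‖ ^ 2) - ε m * ∑ j, ‖γ j z‖ ^ 2) = (∫ z in D, η m z ^ 2 * (∑ j, ‖γ j z‖ ^ 2))
        + 4 * (∫ z in D, (∑ j, ‖dz j e z‖ ^ 2) * ∑ j, ‖γ j z‖ ^ 2)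
        - ε m * ∫ z in D, ∑ j, ‖γ j z‖ ^ 2 := by
      rw [integral_sub i2 (hS.const_mul _), integral_add iη (iA.const_mul 4),
        integral_const_mul, integral_const_mul]
    have e2 : ∫ z in D, (2 * ((∑ j, ‖dz j e z‖ ^ 2) * ∑ j, ‖γ j z‖ ^ 2)
          + 2 * (η m z ^ 2 * ‖T z‖ ^ 2)) = 2 * (∫ z in D, (∑ j, ‖dz j e z‖ ^ 2) * ∑ j, ‖γ j z‖ ^ 2)
          + 2 * ∫ z in D, η m z ^ 2 * ‖T z‖ ^ 2 := by
      rw [integral_add (iA.const_mul 2) (iηT.const_mul 2), integral_const_mul, integral_const_mul]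
    have e3 : ∫ z in D, η m z ^ 2 * ‖T z‖ ^ 2 ≤ ∫ z in D, ‖T z‖ ^ 2 :=
      setIntegral_mono_on iηT (hsq hT) hD.measurableSet fun z _ => by
        have := h01 m z
        exact mul_le_of_le_one_left (by positivity) (pow_le_one₀ this.1 this.2)
    rw [e1, e2, integral_const_mul] at h5
    linarith
  have t1 : Tendsto (fun m => ∫ z in D, η m z ^ 2 * ∑ j, ‖γ j z‖ ^ 2) atTop
      (𝓝 (∫ z in D, ∑ j, ‖γ j z‖ ^ 2)) := by
    refine tendsto_integral_of_dominated_convergence (fun z => ∑ j, ‖γ j z‖ ^ 2)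
      (fun m => ((hη m).1.continuous.pow 2).aestronglyMeasurable.mul hS.1) hS
      (fun m => .of_forall fun z => ?_) ?_
    · have := h01 m z
      rw [Real.norm_eq_abs, abs_of_nonneg (by positivity)]
      exact mul_le_of_le_one_left (by positivity) (pow_le_one₀ this.1 this.2)
    · filter_upwards [ae_restrict_mem hD.measurableSet] with z hz
      have := ((hlim z hz).pow 2).mul_const (∑ j, ‖γ j z‖ ^ 2)
      simpa using this
  have t2 : Tendsto (fun m => ε m * (∫ z in D, ∑ j, ‖γ j z‖ ^ 2) + 2 * ∫ z in D, ‖T z‖ ^ 2) atTop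
      (𝓝 (2 * ∫ z in D, ‖T z‖ ^ 2)) := by
    have := (hε.mul_const (∫ z in D, ∑ j, ‖γ j z‖ ^ 2)).add_const (2 * ∫ z in D, ‖T z‖ ^ 2)
    simpa using this
  exact le_of_tendsto_of_tendsto' t1 t2 main

end KeyEstimate

section Apriori

open scoped InnerProductSpace

lemma exists_proj {H : Type*} [NormedAddCommGroup H] [InnerProductSpace ℂ H] [CompleteSpace H]
    (S : Set H) (b : H) : ∃ g : H, (∀ s ∈ S, ⟪s, g⟫_ℂ = 0) ∧
      ∀ v, (∀ s ∈ S, ⟪s, v⟫_ℂ = 0) → ⟪v, g⟫_ℂ = ⟪v, b⟫_ℂ := by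
  have hmem : ∀ v, (∀ s ∈ S, ⟪s, v⟫_ℂ = 0) ↔ v ∈ (Submodule.span ℂ S)ᗮ := by
    intro v
    rw [Submodule.mem_orthogonal]
    refine ⟨fun h u hu => ?_, fun h s hs => h s (Submodule.subset_span hs)⟩
    induction hu using Submodule.span_induction with
    | mem x hx => exact h x hx
    | zero => simp
    | add x y _ _ hx hy => rw [inner_add_left, hx, hy, add_zero]
    | smul a x _ hx => rw [inner_smul_left, hx, mul_zero]
  refine ⟨(Submodule.span ℂ S)ᗮ.starProjection b, (hmem _).2 (Submodule.coe_mem _), fun v hv => ?_⟩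
  have h := Submodule.starProjection_inner_eq_zero (K := (Submodule.span ℂ S)ᗮ) b v ((hmem v).1 hv)
  rw [inner_sub_left, sub_eq_zero] at h
  rw [← inner_conj_symm, ← h, inner_conj_symm]

/-- The Hilbert space of square-integrable `n`-tuples of functions. -/
abbrev L2Tuple (n : ℕ) (μ : Measure (Fin n → ℂ)) := PiLp 2 (fun _ : Fin n => Lp ℂ 2 μ)

/-- The element of `L2Tuple n μ` with given components. -/
noncomputable def toTuple {μ : Measure (Fin n → ℂ)} (f : Fin n → (Fin n → ℂ) → ℂ)
    (hf : ∀ j, MemLp (f j) 2 μ) : L2Tuple n μ := WithLp.toLp 2 fun j => (hf j).toLp (f j)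

lemma inner_toTuple {μ : Measure (Fin n → ℂ)} {f g : Fin n → (Fin n → ℂ) → ℂ}
    (hf : ∀ j, MemLp (f j) 2 μ) (hg : ∀ j, MemLp (g j) 2 μ) :
    ⟪toTuple f hf, toTuple g hg⟫_ℂ = ∑ j, ∫ z, starRingEnd ℂ (f j z) * g j z ∂μ := by
  rw [PiLp.inner_apply]
  refine Finset.sum_congr rfl fun j _ => ?_
  simp only [toTuple, L2.inner_def]
  refine integral_congr_ae ?_
  filter_upwards [(hf j).coeFn_toLp, (hg j).coeFn_toLp] with z h1 h2
  rw [h1, h2, RCLike.inner_apply, mul_comm]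

lemma norm_sq_toTuple {μ : Measure (Fin n → ℂ)} {f : Fin n → (Fin n → ℂ) → ℂ}
    (hf : ∀ j, MemLp (f j) 2 μ) : ‖toTuple f hf‖ ^ 2 = ∫ z, ∑ j, ‖f j z‖ ^ 2 ∂μ := by
  have h : ((‖toTuple f hf‖ ^ 2 : ℝ) : ℂ) = ((∫ z, ∑ j, ‖f j z‖ ^ 2 ∂μ : ℝ) : ℂ) := by
    have h0 := inner_self_eq_norm_sq_to_K (𝕜 := ℂ) (toTuple f hf)
    rw [ofReal_pow, ← RCLike.ofReal_eq_complex_ofReal, ← h0, inner_toTuple hf hf,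
      integral_finsetSum _ fun j _ => (hf j).integrable_norm_pow (by norm_num)]
    push_cast
    refine Finset.sum_congr rfl fun j _ => ?_
    refine Eq.trans ?_ integral_complex_ofReal
    refine integral_congr_ae (.of_forall fun z => ?_)
    simp only [conj_mul']
    push_cast
    rfl
  exact_mod_cast h

lemma exists_toTuple {μ : Measure (Fin n → ℂ)} (v : L2Tuple n μ) :
    ∃ (f : Fin n → (Fin n → ℂ) → ℂ) (hf : ∀ j, MemLp (f j) 2 μ), v = toTuple f hf := by
  refine ⟨fun j => v j, fun j => Lp.memLp _, ?_⟩
  ext1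
  simp [toTuple]

lemma memLp_test_mul {D : Set (Fin n → ℂ)} (hD : IsOpen D) {f ψ : (Fin n → ℂ) → ℂ}
    (hf : ContinuousOn f D) (hψ : IsTestFun n ψ D) :
    MemLp (fun z => f z * ψ z) 2 (volume.restrict D) :=
  ((continuous_mul_of_tsupport hD hf hψ.1.continuous hψ.2.2).memLp_of_hasCompactSupport
    hψ.2.1.mul_left).restrict D

lemma setIntegral_eq_of_test {D : Set (Fin n → ℂ)} {f ψ : (Fin n → ℂ) → ℂ}
    (hψ : IsTestFun n ψ D) : ∫ z in D, f z * ψ z = ∫ z, f z * ψ z :=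
  setIntegral_eq_integral_of_forall_compl_eq_zero fun z hz => by
    rw [image_eq_zero_of_notMem_tsupport (f := ψ) fun h => hz (hψ.2.2 h), mul_zero]

lemma integral_dzb_mul_dzb {D : Set (Fin n → ℂ)} (hD : IsOpen D) {β ψ : (Fin n → ℂ) → ℂ}
    (hβ : ContDiffOn ℝ (⊤ : ℕ∞) β D) (hψ : IsTestFun n ψ D) (j k : Fin n) :
    ∫ z, dzb j β z * dzb k ψ z = ∫ z, dzb k β z * dzb j ψ z := by
  rw [integral_mul_wd hD (contDiffOn_wd hD hβ) hψ, integral_mul_wd hD (contDiffOn_wd hD hβ) hψ]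
  congr 1
  refine integral_congr_ae (.of_forall fun z => ?_)
  by_cases hz : z ∈ D
  · simp only [wd_comm (c := I) (d := I) (j := k) (k := j) (hβ.contDiffAt (hD.mem_nhds hz))]
  · simp only [image_eq_zero_of_notMem_tsupport (f := ψ) fun h => hz (hψ.2.2 h), mul_zero]

lemma exp_half_mul_cancel (t : ℝ) (a b : ℂ) :
    (((Real.exp (-t / 2) : ℝ) : ℂ) * a) * (((Real.exp (t / 2) : ℝ) : ℂ) * b) = a * b := by
  have : ((Real.exp (-t / 2) : ℝ) : ℂ) * ((Real.exp (t / 2) : ℝ) : ℂ) = 1 := by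
    rw [← ofReal_mul, ← Real.exp_add]
    simp [neg_div]
  linear_combination (a * b) * this

/-- Hörmander's a priori estimate in dual form. -/
theorem dual_estimate {D : Set (Fin n → ℂ)} (hD : IsOpen D) {Φ : (Fin n → ℂ) → ℝ}
    (hΦ : ContDiffOn ℝ (⊤ : ℕ∞) Φ D) (hg : HasGoodCutoffs D Φ) {β : (Fin n → ℂ) → ℂ}
    (hβ : ContDiffOn ℝ (⊤ : ℕ∞) β D)
    (hA : ∀ j, MemLp (fun z => ((Real.exp (-Φ z / 2) : ℝ) : ℂ) * dzb j β z) 2 (volume.restrict D))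
    {q : Fin n → (Fin n → ℂ) → ℂ} (hq : ∀ j, IsTestFun n (q j) D) :
    ‖∑ j, ∫ z, dzb j β z * q j z‖ ^ 2 ≤ (∫ z in D, ∑ j, ‖dzb j β z‖ ^ 2 * Real.exp (-Φ z)) *
      (2 * ∫ z in D, ‖∑ j, dzb j (q j) z‖ ^ 2 * Real.exp (Φ z)) := by
  set μ := (volume : Measure (Fin n → ℂ)).restrict D
  set E : (Fin n → ℂ) → ℂ := fun z => ((Real.exp (Φ z / 2) : ℝ) : ℂ) with hE
  set E' : (Fin n → ℂ) → ℂ := fun z => ((Real.exp (-Φ z / 2) : ℝ) : ℂ) with hE'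
  have cE : ContinuousOn E D :=
    continuous_ofReal.comp_continuousOn (Real.continuous_exp.comp_continuousOn
      (hΦ.continuousOn.div_const 2))
  have cE' : ContinuousOn E' D :=
    continuous_ofReal.comp_continuousOn (Real.continuous_exp.comp_continuousOn
      (hΦ.continuousOn.neg.div_const 2))
  have conjE : ∀ z, starRingEnd ℂ (E z) = E z := fun z => conj_ofReal _
  have conjE' : ∀ z, starRingEnd ℂ (E' z) = E' z := fun z => conj_ofReal _
  have mem1 : ∀ {ψ}, IsTestFun n ψ D → MemLp (fun z => E z * ψ z) 2 μ := fun h =>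
    memLp_test_mul hD cE h
  -- the closedness relations, as orthogonality to a set of tuples
  have memS : ∀ j k ψ, IsTestFun n ψ D → ∀ i, MemLp (fun z => starRingEnd ℂ
      (E z * ((if i = j then dzb k ψ z else 0) - (if i = k then dzb j ψ z else 0)))) 2 μ := by
    intro j k ψ hψ i
    have h1 : MemLp (fun z => (if i = j then (1:ℂ) else 0) * (E z * dzb k ψ z)
      - (if i = k then (1:ℂ) else 0) * (E z * dzb j ψ z)) 2 μ :=
      ((mem1 (isTestFun_wd hψ)).const_mul _).sub ((mem1 (isTestFun_wd hψ)).const_mul _)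
    refine h1.star.ae_eq (.of_forall fun z => ?_)
    simp only [Pi.star_apply, RCLike.star_def]
    congr 1
    split_ifs <;> simp [mul_sub]
  let S : Set (L2Tuple n μ) := {s | ∃ j k ψ, ∃ h : IsTestFun n ψ D, s = toTuple _ (memS j k ψ h)}
  have hS : ∀ (γ : Fin n → (Fin n → ℂ) → ℂ) (hγ : ∀ j, MemLp (γ j) 2 μ),
      (∀ s ∈ S, ⟪s, toTuple γ hγ⟫_ℂ = 0) ↔ ∀ j k ψ, IsTestFun n ψ D →
        ∫ z, γ j z * (E z * dzb k ψ z) = ∫ z, γ k z * (E z * dzb j ψ z) := by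
    intro γ hγ
    have key : ∀ j k ψ (h : IsTestFun n ψ D), ⟪toTuple _ (memS j k ψ h), toTuple γ hγ⟫_ℂ =
        (∫ z, γ j z * (E z * dzb k ψ z)) - ∫ z, γ k z * (E z * dzb j ψ z) := by
      intro j k ψ h
      have hi : ∀ i l, IntegrableOn (fun z => γ i z * (E z * dzb l ψ z)) D := fun i l =>
        MemLp.integrable_mul (p := 2) (q := 2) (hγ i) (mem1 (isTestFun_wd h))
      have hs : ∀ i l, ∫ z, γ i z * (E z * dzb l ψ z) = ∫ z in D, γ i z * (E z * dzb l ψ z) := by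
        intro i l
        simp only [← mul_assoc]
        exact (setIntegral_eq_of_test (isTestFun_wd h)).symm
      rw [inner_toTuple, hs, hs]
      have : ∀ i, ∫ z, starRingEnd ℂ (starRingEnd ℂ (E z * ((if i = j then dzb k ψ z else 0) -
          (if i = k then dzb j ψ z else 0)))) * γ i z ∂μ =
          (if i = j then ∫ z in D, γ i z * (E z * dzb k ψ z) else 0) -
          (if i = k then ∫ z in D, γ i z * (E z * dzb j ψ z) else 0) := by
        intro i
        simp only [conj_conj]
        have h1 : ∀ z, E z * ((if i = j then dzb k ψ z else 0) - (if i = k then dzb j ψ z else 0))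
            * γ i z = (if i = j then (1:ℂ) else 0) * (γ i z * (E z * dzb k ψ z)) -
              (if i = k then (1:ℂ) else 0) * (γ i z * (E z * dzb j ψ z)) := by
          intro z
          split_ifs <;> ring
        simp only [h1]
        rw [integral_sub ((hi _ _).const_mul _) ((hi _ _).const_mul _), integral_const_mul,
          integral_const_mul]
        simp only [ite_mul, one_mul, zero_mul]
      simp only [this, Finset.sum_sub_distrib, Finset.sum_ite_eq', Finset.mem_univ, if_true]
    constructor
    · intro h j k ψ hψ
      have := h _ ⟨j, k, ψ, hψ, rfl⟩
      rwa [key j k ψ hψ, sub_eq_zero] at this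
    · rintro h s ⟨j, k, ψ, hψ, rfl⟩
      rw [key j k ψ hψ, h j k ψ hψ, sub_self]
  have hclosed : ∀ {f : (Fin n → ℂ) → ℂ} (_ : ContDiffOn ℝ (⊤ : ℕ∞) f D)
      (hf : ∀ j, MemLp (fun z => E' z * dzb j f z) 2 μ),
      ∀ s ∈ S, ⟪s, toTuple (fun j z => E' z * dzb j f z) hf⟫_ℂ = 0 := by
    intro f hf1 hf
    rw [hS]
    intro j k ψ hψ
    simp only [hE, hE', exp_half_mul_cancel]
    exact integral_dzb_mul_dzb hD hf1 hψ j k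
  have hbm : ∀ j, MemLp (fun z => E z * starRingEnd ℂ (q j z)) 2 μ := fun j =>
    mem1 (isTestFun_conj (hq j))
  obtain ⟨v, hv1, hv2⟩ := exists_proj S (toTuple (fun j z => E z * starRingEnd ℂ (q j z)) hbm)
  obtain ⟨γ, hγ, rfl⟩ := exists_toTuple v
  have hsum : IsTestFun n (fun z => ∑ j, dzb j (q j) z) D := by
    have h : ∀ j, IsTestFun n (dzb j (q j)) D := fun j => isTestFun_wd (hq j)
    have hss : Function.support (fun z => ∑ j, dzb j (q j) z) ⊆ ⋃ j, tsupport (dzb j (q j)) := by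
      intro z hz
      obtain ⟨j, -, hj⟩ := Finset.exists_ne_zero_of_sum_ne_zero hz
      exact mem_iUnion.2 ⟨j, subset_tsupport _ hj⟩
    have hts : tsupport (fun z => ∑ j, dzb j (q j) z) ⊆ ⋃ j, tsupport (dzb j (q j)) :=
      closure_minimal hss (isClosed_iUnion_of_finite fun j => isClosed_tsupport _)
    exact ⟨ContDiff.sum fun j _ => (h j).1,
      (isCompact_iUnion fun j => (h j).2.1).of_isClosed_subset (isClosed_tsupport _) hts,
      hts.trans (iUnion_subset fun j => (h j).2.2)⟩
  set T : (Fin n → ℂ) → ℂ := fun z => -(E z * starRingEnd ℂ (∑ j, dzb j (q j) z)) with hTd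
  have hT : MemLp T 2 μ := (mem1 (isTestFun_conj hsum)).neg
  have hkey := key_estimate hD hΦ hg hγ hT ((hS γ hγ).1 hv1) (by
    intro ψ hψ
    have hψ' := isTestFun_conj hψ
    have hm : ∀ j, MemLp (fun z => E' z * dzb j (fun w => starRingEnd ℂ (ψ w)) z) 2 μ := fun j =>
      memLp_test_mul hD cE' (isTestFun_wd hψ')
    have h := hv2 _ (hclosed hψ'.1.contDiffOn hm)
    rw [inner_toTuple, inner_toTuple] at h
    have hc : ∀ j z, starRingEnd ℂ (E' z * dzb j (fun w => starRingEnd ℂ (ψ w)) z)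
        = E' z * dz j ψ z := by
      intro j z
      rw [map_mul, conjE', dzb, wd_conj, conj_conj, conj_I]
    simp only [hc] at h
    calc ∑ j, ∫ z, γ j z * (E' z * dz j ψ z) = ∑ j, ∫ z, E' z * dz j ψ z * γ j z ∂μ := by
          refine Finset.sum_congr rfl fun j _ => ?_
          rw [show (fun z => γ j z * (E' z * dz j ψ z)) = fun z => (γ j z * E' z) * dz j ψ z by
            ext z; ring, ← setIntegral_eq_of_test (isTestFun_wd hψ)]
          exact integral_congr_ae (.of_forall fun z => by ring)
      _ = ∑ j, ∫ z, E' z * dz j ψ z * (E z * starRingEnd ℂ (q j z)) ∂μ := h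
      _ = ∑ j, ∫ z, starRingEnd ℂ (q j z) * dz j ψ z := by
          refine Finset.sum_congr rfl fun j _ => ?_
          rw [← setIntegral_eq_of_test (isTestFun_wd hψ)]
          refine integral_congr_ae (.of_forall fun z => ?_)
          simp only [hE, hE', exp_half_mul_cancel]
          ring
      _ = ∑ j, -∫ z, starRingEnd ℂ (dzb j (q j) z) * ψ z := by
          refine Finset.sum_congr rfl fun j _ => ?_
          rw [integral_mul_wd hD (isTestFun_conj (hq j)).1.contDiffOn hψ]
          simp only [wd_conj, map_neg, conj_I, neg_neg]
      _ = ∫ z, -(starRingEnd ℂ (∑ j, dzb j (q j) z)) * ψ z := by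
          rw [Finset.sum_neg_distrib, ← integral_finsetSum, ← integral_neg]
          · refine integral_congr_ae (.of_forall fun z => ?_)
            simp only [map_sum, ← Finset.sum_mul, neg_mul]
          · intro j _
            exact integrable_mul_of_tsupport hD (isTestFun_conj
              (isTestFun_wd (hq j))).1.continuous.continuousOn hψ.1.continuous hψ.2.1 hψ.2.2
      _ = ∫ z, T z * (E' z * ψ z) := by
          refine integral_congr_ae (.of_forall fun z => ?_)
          simp only [hTd]
          have := exp_half_mul_cancel (Φ z) (ψ z) (-(starRingEnd ℂ (∑ j, dzb j (q j) z)))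
          linear_combination -this)
  have hv3 := hv2 _ (hclosed hβ hA)
  rw [inner_toTuple hA hbm] at hv3
  have hlhs : ‖∑ j, ∫ z, dzb j β z * q j z‖ =
      ‖⟪toTuple (fun j z => E' z * dzb j β z) hA, toTuple γ hγ⟫_ℂ‖ := by
    rw [hv3, ← RCLike.norm_conj, map_sum]
    congr 1
    refine Finset.sum_congr rfl fun j _ => ?_
    rw [← setIntegral_eq_of_test (hq j), ← integral_conj]
    refine integral_congr_ae (.of_forall fun z => ?_)
    simp only [map_mul, conj_ofReal]
    exact (exp_half_mul_cancel _ _ _).symm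
  have hE2 : ∀ z, ‖E z‖ ^ 2 = Real.exp (Φ z) := fun z => by
    rw [hE, norm_real, Real.norm_eq_abs, sq_abs, ← Real.exp_nat_mul]
    congr 1
    push_cast
    ring
  have hE2' : ∀ z, ‖E' z‖ ^ 2 = Real.exp (-Φ z) := fun z => by
    rw [hE', norm_real, Real.norm_eq_abs, sq_abs, ← Real.exp_nat_mul]
    congr 1
    push_cast
    ring
  rw [hlhs]
  calc _ ≤ (‖toTuple (fun j z => E' z * dzb j β z) hA‖ * ‖toTuple γ hγ‖) ^ 2 :=
        pow_le_pow_left₀ (norm_nonneg _) (norm_inner_le_norm _ _) 2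
    _ = (∫ z in D, ∑ j, ‖dzb j β z‖ ^ 2 * Real.exp (-Φ z)) * ∫ z in D, ∑ j, ‖γ j z‖ ^ 2 := by
        rw [mul_pow, norm_sq_toTuple, norm_sq_toTuple]
        simp only [norm_mul, mul_pow, hE2']
        simp only [mul_comm (Real.exp _)]
        rfl
    _ ≤ (∫ z in D, ∑ j, ‖dzb j β z‖ ^ 2 * Real.exp (-Φ z)) * (2 * ∫ z in D, ‖T z‖ ^ 2) :=
        mul_le_mul_of_nonneg_left hkey (integral_nonneg fun z =>
          Finset.sum_nonneg fun j _ => by positivity)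
    _ = _ := by
        simp only [hTd, norm_neg, norm_mul, mul_pow, hE2, RCLike.norm_conj, mul_comm (Real.exp _)]
        rfl

end Apriori

section LeviCalculus

lemma wd_comp_real {s : (Fin n → ℂ) → ℝ} {k : ℝ → ℝ} {k' : ℝ} {z : Fin n → ℂ}
    (hs : DifferentiableAt ℝ s z) (hk : HasDerivAt k k' (s z)) (c : ℂ) (j : Fin n) :
    wd c j (fun w => ((k (s w) : ℝ) : ℂ)) z = (k' : ℂ) * wd c j (fun w => (s w : ℂ)) z := by
  have h1 : HasFDerivAt (fun w => (s w : ℂ)) (ofRealCLM.comp (fderiv ℝ s z)) z :=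
    ofRealCLM.hasFDerivAt.comp z hs.hasFDerivAt
  have h2 : HasFDerivAt (fun w => ((k (s w) : ℝ) : ℂ)) (ofRealCLM.comp (k' • fderiv ℝ s z)) z :=
    ofRealCLM.hasFDerivAt.comp z (hk.comp_hasFDerivAt z hs.hasFDerivAt)
  simp only [wd, h1.fderiv, h2.fderiv]
  simp
  ring

lemma dzb_ofReal_eq_conj (s : (Fin n → ℂ) → ℝ) (j : Fin n) (z : Fin n → ℂ) :
    dzb j (fun w => (s w : ℂ)) z = starRingEnd ℂ (dz j (fun w => (s w : ℂ)) z) := by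
  have := wd_conj (c := I) (j := j) (u := fun w => (s w : ℂ)) (z := z)
  simpa using this

lemma contDiffOn_ofReal {s : (Fin n → ℂ) → ℝ} {D : Set (Fin n → ℂ)}
    (hs : ContDiffOn ℝ (⊤ : ℕ∞) s D) : ContDiffOn ℝ (⊤ : ℕ∞) (fun z => (s z : ℂ)) D :=
  ofRealCLM.contDiff.comp_contDiffOn hs

/-- The chain rule for the Levi form. -/
lemma levi_comp {D : Set (Fin n → ℂ)} (hD : IsOpen D) {s : (Fin n → ℂ) → ℝ}
    (hs : ContDiffOn ℝ (⊤ : ℕ∞) s D) {k k1 : ℝ → ℝ} {k2 : ℝ} {z : Fin n → ℂ} (hz : z ∈ D)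
    (hk : ∀ w ∈ D, HasDerivAt k (k1 (s w)) (s w)) (hk1 : HasDerivAt k1 k2 (s z))
    (ξ : Fin n → ℂ) : levi (fun w => k (s w)) z ξ = k1 (s z) * levi s z ξ
      + k2 * ‖∑ j, dz j (fun w => (s w : ℂ)) z * ξ j‖ ^ 2 := by
  have hsd : ∀ w ∈ D, DifferentiableAt ℝ s w := fun w hw =>
    (hs.contDiffAt (hD.mem_nhds hw)).differentiableAt (by simp)
  have h1 : ∀ j l, dzb l (dz j (fun w => ((k (s w) : ℝ) : ℂ))) z =
      (k2 : ℂ) * (starRingEnd ℂ (dz l (fun w => (s w : ℂ)) z) * dz j (fun w => (s w : ℂ)) z)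
        + (k1 (s z) : ℂ) * dzb l (dz j (fun w => (s w : ℂ))) z := by
    intro j l
    have he : dz j (fun w => ((k (s w) : ℝ) : ℂ)) =ᶠ[𝓝 z]
        fun w => ((k1 (s w) : ℝ) : ℂ) * dz j (fun w => (s w : ℂ)) w := by
      filter_upwards [hD.mem_nhds hz] with w hw
      exact wd_comp_real (hsd w hw) (hk w hw) _ _
    have hd : DifferentiableAt ℝ (fun w => ((k1 (s w) : ℝ) : ℂ)) z :=
      ofRealCLM.differentiableAt.comp z (hk1.differentiableAt.comp z (hsd z hz))
    have hd2 : DifferentiableAt ℝ (dz j (fun w => (s w : ℂ))) z :=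
      ((contDiffOn_wd hD (contDiffOn_ofReal hs)).contDiffAt (hD.mem_nhds hz)).differentiableAt
        (by simp)
    rw [dzb, wd_congr he, wd_mul hd hd2, wd_comp_real (hsd z hz) hk1, ← dzb_ofReal_eq_conj]
    ring
  have h2 : ∑ j, ∑ l, (starRingEnd ℂ (dz l (fun w => (s w : ℂ)) z) * dz j (fun w => (s w : ℂ)) z)
      * ξ j * starRingEnd ℂ (ξ l) = ((‖∑ j, dz j (fun w => (s w : ℂ)) z * ξ j‖ ^ 2 : ℝ) : ℂ) := by
    rw [ofReal_pow, ← mul_conj', map_sum, Finset.sum_mul_sum]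
    refine Finset.sum_congr rfl fun j _ => Finset.sum_congr rfl fun l _ => ?_
    rw [map_mul]
    ring
  unfold levi
  simp only [h1, add_mul, Finset.sum_add_distrib, mul_assoc (k2 : ℂ), mul_assoc (k1 (s z) : ℂ),
    ← Finset.mul_sum, h2, add_re, re_ofReal_mul, ofReal_re]
  ring

lemma levi_add {D : Set (Fin n → ℂ)} (hD : IsOpen D) {s t : (Fin n → ℂ) → ℝ}
    (hs : ContDiffOn ℝ (⊤ : ℕ∞) s D) (ht : ContDiffOn ℝ (⊤ : ℕ∞) t D) {z : Fin n → ℂ} (hz : z ∈ D)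
    (ξ : Fin n → ℂ) : levi (fun w => s w + t w) z ξ = levi s z ξ + levi t z ξ := by
  have hd : ∀ {f : (Fin n → ℂ) → ℂ}, ContDiffOn ℝ (⊤ : ℕ∞) f D → ∀ w ∈ D,
      DifferentiableAt ℝ f w := fun hf w hw =>
    (hf.contDiffAt (hD.mem_nhds hw)).differentiableAt (by simp)
  have h1 : ∀ j l, dzb l (dz j (fun w => ((s w + t w : ℝ) : ℂ))) z =
      dzb l (dz j (fun w => (s w : ℂ))) z + dzb l (dz j (fun w => (t w : ℂ))) z := by
    intro j l
    have he : dz j (fun w => ((s w + t w : ℝ) : ℂ)) =ᶠ[𝓝 z]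
        fun w => dz j (fun w => (s w : ℂ)) w + dz j (fun w => (t w : ℂ)) w := by
      filter_upwards [hD.mem_nhds hz] with w hw
      simp only [ofReal_add]
      exact wd_add (hd (contDiffOn_ofReal hs) w hw) (hd (contDiffOn_ofReal ht) w hw)
    rw [dzb, wd_congr he, wd_add (hd (contDiffOn_wd hD (contDiffOn_ofReal hs)) z hz)
      (hd (contDiffOn_wd hD (contDiffOn_ofReal ht)) z hz)]
  unfold levi
  simp only [h1, add_mul, Finset.sum_add_distrib, add_re]

/-- The squared Euclidean distance to `p`. -/
noncomputable def dsq (p z : Fin n → ℂ) : ℝ := ∑ i, ‖z i - p i‖ ^ 2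

lemma contDiff_dsq (p : Fin n → ℂ) : ContDiff ℝ (⊤ : ℕ∞) (dsq p) :=
  ContDiff.sum fun j _ => ((contDiff_apply ℝ ℂ j).sub contDiff_const).norm_sq ℝ

lemma dsq_nonneg (p z : Fin n → ℂ) : 0 ≤ dsq p z := Finset.sum_nonneg fun _ _ => by positivity

lemma wd_coord (c : ℂ) (j i : Fin n) (p z : Fin n → ℂ) :
    wd c j (fun w => w i - p i) z = if i = j then (1 / 2) * (1 + c * I) else 0 := by
  have h : HasFDerivAt (fun w : Fin n → ℂ => w i - p i)
      (ContinuousLinearMap.proj (R := ℝ) (φ := fun _ : Fin n => ℂ) i) z :=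
    (ContinuousLinearMap.proj (R := ℝ) (φ := fun _ : Fin n => ℂ) i).hasFDerivAt.sub_const _
  rw [wd, h.fderiv]
  by_cases hij : i = j
  · subst hij; simp
  · simp [hij]

lemma differentiableAt_coord (i : Fin n) (p z : Fin n → ℂ) :
    DifferentiableAt ℝ (fun w : Fin n → ℂ => w i - p i) z := by fun_prop

lemma dz_dsq (p z : Fin n → ℂ) (j : Fin n) :
    dz j (fun w => (dsq p w : ℂ)) z = starRingEnd ℂ (z j - p j) := by
  have h : (fun w => (dsq p w : ℂ)) =
      fun w => ∑ i, starRingEnd ℂ (w i - p i) * (w i - p i) := by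
    ext w
    simp only [dsq, conj_mul']
    push_cast
    rfl
  have hc : ∀ i, DifferentiableAt ℝ (fun w : Fin n → ℂ => starRingEnd ℂ (w i - p i)) z := fun i =>
    conjCLE.differentiableAt.comp z (differentiableAt_coord i p z)
  rw [h, dz, wd_sum fun i _ => (hc i).fun_mul (differentiableAt_coord i p z)]
  rw [Finset.sum_eq_single j]
  · rw [wd_mul (hc j) (differentiableAt_coord j p z), wd_conj, wd_coord, wd_coord]
    simp
    ring
  · intro i _ hij
    rw [wd_mul (hc i) (differentiableAt_coord i p z), wd_conj, wd_coord, wd_coord]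
    simp [hij]
  · simp

lemma levi_dsq (p z ξ : Fin n → ℂ) : levi (dsq p) z ξ = ∑ j, ‖ξ j‖ ^ 2 := by
  have h1 : ∀ j l, dzb l (dz j (fun w => (dsq p w : ℂ))) z = if j = l then 1 else 0 := by
    intro j l
    rw [show dz j (fun w => (dsq p w : ℂ)) = fun w => starRingEnd ℂ (w j - p j) from
      funext fun w => dz_dsq p w j, dzb, wd_conj, wd_coord]
    split_ifs <;> norm_num [conj_ofNat]
  unfold levi
  simp only [h1, ite_mul, one_mul, zero_mul, Finset.sum_ite_eq, Finset.mem_univ, if_true, mul_conj',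
    re_sum]
  refine Finset.sum_congr rfl fun j _ => ?_
  rw [← ofReal_pow, ofReal_re]

lemma levi_log_dsq_nonneg (p z ξ : Fin n → ℂ) {ε : ℝ} (hε : 0 < ε) {K : ℝ} (hK : 0 ≤ K) :
    0 ≤ levi (fun w => K * Real.log (dsq p w + ε)) z ξ := by
  have hp : ∀ w, 0 < dsq p w + ε := fun w => by linarith [dsq_nonneg p w]
  have h := levi_comp (s := dsq p) (k := fun t => K * Real.log (t + ε))
    (k1 := fun t => K * (t + ε)⁻¹) (k2 := K * (-1 / (dsq p z + ε) ^ 2)) (z := z)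
    isOpen_univ (contDiff_dsq p).contDiffOn (mem_univ z) (fun w _ => ?_) ?_ ξ
  · rw [h, levi_dsq]
    have hcs : ‖∑ j, dz j (fun w => (dsq p w : ℂ)) z * ξ j‖ ^ 2 ≤ dsq p z * ∑ j, ‖ξ j‖ ^ 2 := by
      simp only [dz_dsq]
      refine (norm_sum_mul_sq_le _ _).trans (le_of_eq ?_)
      simp [dsq, -map_sub]
    have hS : (0:ℝ) ≤ ∑ j, ‖ξ j‖ ^ 2 := Finset.sum_nonneg fun _ _ => by positivity
    have : K * (dsq p z + ε)⁻¹ * ∑ j, ‖ξ j‖ ^ 2 + K * (-1 / (dsq p z + ε) ^ 2) *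
        ‖∑ j, dz j (fun w => (dsq p w : ℂ)) z * ξ j‖ ^ 2 = K * ((dsq p z + ε) ^ 2)⁻¹ *
        ((dsq p z + ε) * (∑ j, ‖ξ j‖ ^ 2) - ‖∑ j, dz j (fun w => (dsq p w : ℂ)) z * ξ j‖ ^ 2) := by
      have := (hp z).ne'
      field_simp
      ring
    rw [this]
    have := hp z
    refine mul_nonneg (by positivity) ?_
    nlinarith [mul_nonneg hε.le hS]
  · have := ((hasDerivAt_id (dsq p w)).add_const ε).log (hp w).ne'
    simpa using this.const_mul K
  · have := ((hasDerivAt_id (dsq p z)).add_const ε).inv (hp z).ne'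
    exact this.const_mul K

/-- The Levi form as the average of two second derivatives. -/
lemma levi_eq_second_deriv {Φ : (Fin n → ℂ) → ℝ} {z : Fin n → ℂ}
    (hΦ : ContDiffAt ℝ (⊤ : ℕ∞) Φ z) (ξ : Fin n → ℂ) :
    levi Φ z ξ = (1 / 4) * (fderiv ℝ (fderiv ℝ Φ) z ξ ξ
      + fderiv ℝ (fderiv ℝ Φ) z (I • ξ) (I • ξ)) := by
  set B := fderiv ℝ (fderiv ℝ Φ) z with hB
  have h2 : ContDiffAt ℝ (⊤ : ℕ∞) (fderiv ℝ Φ) z := hΦ.fderiv_right (by simp)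
  have h1 : DifferentiableAt ℝ (fderiv ℝ Φ) z := h2.differentiableAt (by simp)
  have hsym : ∀ v w, B v w = B w v := hΦ.isSymmSndFDerivAt (by
    simpa using WithTop.coe_le_coe.2 (le_top : (2 : ℕ∞) ≤ ⊤))
  have hev : ∀ᶠ w in 𝓝 z, DifferentiableAt ℝ Φ w := by
    have : ContDiffAt ℝ 1 Φ z := hΦ.of_le (by simp)
    filter_upwards [this.eventually (by simp)] with w hw using hw.differentiableAt (by simp)
  have hdz : ∀ j, dz j (fun w => (Φ w : ℂ)) =ᶠ[𝓝 z] fun w =>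
      (1 / 2) * ((fderiv ℝ Φ w (Pi.single j 1) : ℂ) - I * (fderiv ℝ Φ w (Pi.single j I) : ℂ)) := by
    intro j
    filter_upwards [hev] with w hw
    have h1 : HasFDerivAt (fun w => (Φ w : ℂ)) (ofRealCLM.comp (fderiv ℝ Φ w)) w :=
      ofRealCLM.hasFDerivAt.comp w hw.hasFDerivAt
    rw [dz, wd, h1.fderiv]
    simp [sub_eq_add_neg]
  have hBd : ∀ v : Fin n → ℂ, HasFDerivAt (fun w => (fderiv ℝ Φ w v : ℂ))
      (ofRealCLM.comp ((ContinuousLinearMap.apply ℝ ℝ v).comp B)) z := fun v =>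
    ofRealCLM.hasFDerivAt.comp z
      ((ContinuousLinearMap.apply ℝ ℝ v).hasFDerivAt.comp z h1.hasFDerivAt)
  have hdd : ∀ j l, dzb l (dz j (fun w => (Φ w : ℂ))) z = (1 / 4) *
      ((B (Pi.single l 1) (Pi.single j 1) + B (Pi.single l I) (Pi.single j I) : ℝ)
        + I * (B (Pi.single l I) (Pi.single j 1) - B (Pi.single l 1) (Pi.single j I) : ℝ)) := by
    intro j l
    have hf : HasFDerivAt (fun w => (1 / 2 : ℂ) * ((fderiv ℝ Φ w (Pi.single j 1) : ℂ)
      - I * (fderiv ℝ Φ w (Pi.single j I) : ℂ))) _ z :=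
      ((hBd (Pi.single j 1)).sub ((hBd (Pi.single j I)).const_mul I)).const_mul (1 / 2)
    rw [dzb, wd_congr (hdz j), wd, hf.fderiv]
    simp
    linear_combination (-1 / 4 : ℂ) * (B (Pi.single l I) (Pi.single j I)) * I_sq
  have hξ : ξ = ∑ j, ((ξ j).re • (Pi.single j 1 : Fin n → ℂ)
    + (ξ j).im • (Pi.single j I : Fin n → ℂ)) := pi_eq_sum_single ξ
  have hIξ : I • ξ = ∑ j, (-(ξ j).im • (Pi.single j 1 : Fin n → ℂ)
    + (ξ j).re • (Pi.single j I : Fin n → ℂ)) := by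
    rw [pi_eq_sum_single (I • ξ)]
    simp
  have e1 : B ξ ξ + B (I • ξ) (I • ξ) = ∑ j, ∑ l,
      (((ξ j).re * (ξ l).re + (ξ j).im * (ξ l).im) *
        (B (Pi.single j 1) (Pi.single l 1) + B (Pi.single j I) (Pi.single l I))
      + ((ξ j).re * (ξ l).im - (ξ j).im * (ξ l).re) *
        (B (Pi.single j 1) (Pi.single l I) - B (Pi.single j I) (Pi.single l 1))) := by
    rw [hIξ]
    conv_lhs => enter [1]; rw [hξ]
    simp only [map_sum, map_add, map_smul, sum_apply, add_apply, smul_apply, smul_eq_mul,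
      Finset.mul_sum, ← Finset.sum_add_distrib]
    refine Finset.sum_congr rfl fun j _ => Finset.sum_congr rfl fun l _ => ?_
    rw [hsym (Pi.single l 1) (Pi.single j 1), hsym (Pi.single l I) (Pi.single j I),
      hsym (Pi.single l I) (Pi.single j 1), hsym (Pi.single l 1) (Pi.single j I)]
    ring
  rw [e1, Finset.mul_sum, levi, re_sum]
  refine Finset.sum_congr rfl fun j _ => ?_
  rw [Finset.mul_sum, re_sum]
  refine Finset.sum_congr rfl fun l _ => ?_
  rw [hdd, hsym (Pi.single l 1) (Pi.single j 1), hsym (Pi.single l I) (Pi.single j I),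
    hsym (Pi.single l I) (Pi.single j 1), hsym (Pi.single l 1) (Pi.single j I)]
  simp [mul_re, mul_im, add_re, add_im]
  ring

end LeviCalculus

section GoodCutoffs

lemma expNegInvGlue_of_pos {x : ℝ} (hx : 0 < x) : expNegInvGlue x = Real.exp (-x⁻¹) := by
  simp [expNegInvGlue, hx.not_ge]

lemma expNegInvGlue_le_one (x : ℝ) : expNegInvGlue x ≤ 1 := by
  rcases le_or_gt x 0 with hx | hx
  · rw [expNegInvGlue.zero_of_nonpos hx]; norm_num
  · rw [expNegInvGlue_of_pos hx]
    exact Real.exp_le_one_iff.2 (by have := inv_pos.2 hx; linarith)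

lemma hasDerivAt_expNegInvGlue (x : ℝ) :
    HasDerivAt expNegInvGlue ((x⁻¹) ^ 2 * expNegInvGlue x) x := by
  have := expNegInvGlue.hasDerivAt_polynomial_eval_inv_mul 1 x
  simpa using this

/-- The derivative of `t ↦ expNegInvGlue ((t - M⁻²) M / a)` is controlled by `t⁻⁴`, up to an error
which is small for large `M`. -/
lemma cutoff_deriv_bound {L N a : ℝ} (hL : 0 ≤ L) (ha : 0 < a) (h : 64 * L * a ^ 2 ≤ N) {M : ℝ}
    (hM : 1 ≤ M) {y : ℝ} (hy : 0 < y) :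
    4 * (L * ((M / a) * ((((y - (M ^ 2)⁻¹) * (M / a))⁻¹) ^ 2 *
      expNegInvGlue ((y - (M ^ 2)⁻¹) * (M / a)))) ^ 2) - 4 * L * 40320 / (a ^ 6 * M ^ 2)
      ≤ N * (y ^ 4)⁻¹ * expNegInvGlue ((y - (M ^ 2)⁻¹) * (M / a)) ^ 2 := by
  have hM0 : 0 < M := by linarith
  have hN : 0 ≤ N := le_trans (by positivity) h
  set ν := (M ^ 2)⁻¹ with hν
  have hν0 : 0 < ν := by positivity
  have hMa : 0 < M / a := by positivity
  set τ := (y - ν) * (M / a) with hτ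
  have herr : 0 ≤ 4 * L * 40320 / (a ^ 6 * M ^ 2) := by positivity
  rcases le_or_gt τ 0 with h0 | h0
  · rw [expNegInvGlue.zero_of_nonpos h0]
    simp only [mul_zero, ne_eq, OfNat.ofNat_ne_zero, not_false_eq_true, zero_pow]
    linarith
  · have hyν : 0 < y - ν := by
      by_contra hc
      exact absurd h0 (not_lt.2 (mul_nonpos_of_nonpos_of_nonneg (not_lt.1 hc) hMa.le))
    set E := expNegInvGlue τ with hE
    rcases le_or_gt ν (y - ν) with h1 | h1
    · have h2 : 4 * (L * ((M / a) * ((τ⁻¹) ^ 2 * E)) ^ 2) ≤ N * (y ^ 4)⁻¹ * E ^ 2 := by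
        have e : 4 * (L * ((M / a) * ((τ⁻¹) ^ 2 * E)) ^ 2)
            = (4 * L * a ^ 2 / M ^ 2) * ((y - ν) ^ 4)⁻¹ * E ^ 2 := by
          rw [hτ]
          field_simp
        rw [e]
        refine mul_le_mul_of_nonneg_right ?_ (sq_nonneg _)
        have h3 : ((y - ν) ^ 4)⁻¹ ≤ 16 * (y ^ 4)⁻¹ := by
          have : y ^ 4 ≤ 16 * (y - ν) ^ 4 := by
            calc y ^ 4 ≤ (2 * (y - ν)) ^ 4 := pow_le_pow_left₀ hy.le (by linarith) 4
              _ = _ := by ring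
          rw [inv_le_iff_one_le_mul₀ (by positivity), mul_assoc, mul_comm (y ^ 4)⁻¹, ← mul_assoc,
            ← div_eq_mul_inv, one_le_div (by positivity)]
          exact this
        calc 4 * L * a ^ 2 / M ^ 2 * ((y - ν) ^ 4)⁻¹ ≤ 4 * L * a ^ 2 * (16 * (y ^ 4)⁻¹) := by
              refine mul_le_mul ?_ h3 (by positivity) (by positivity)
              exact div_le_self (by positivity) (one_le_pow₀ hM)
          _ = 64 * L * a ^ 2 * (y ^ 4)⁻¹ := by ring
          _ ≤ _ := mul_le_mul_of_nonneg_right h (by positivity)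
      linarith
    · have h2 : 4 * (L * ((M / a) * ((τ⁻¹) ^ 2 * E)) ^ 2) ≤ 4 * L * 40320 / (a ^ 6 * M ^ 2) := by
        set x := τ⁻¹ with hx
        have hx0 : 0 < x := inv_pos.2 h0
        have hxM : a * M ≤ x := by
          rw [hx, le_inv_comm₀ (by positivity) h0]
          calc τ ≤ ν * (M / a) := mul_le_mul_of_nonneg_right h1.le hMa.le
            _ = (a * M)⁻¹ := by rw [hν]; field_simp
        have hE2 : E = Real.exp (-x) := expNegInvGlue_of_pos h0
        have h8 : x ^ 8 * E ^ 2 ≤ 40320 := by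
          have h9 := Real.pow_div_factorial_le_exp x hx0.le 8
          have h10 : x ^ 8 ≤ 40320 * Real.exp x := by
            rw [div_le_iff₀ (by positivity)] at h9
            norm_num [Nat.factorial] at h9
            linarith
          have h11 : Real.exp x * E = 1 := by rw [hE2, ← Real.exp_add]; simp
          have hEp : 0 < E := hE2 ▸ Real.exp_pos _
          have hE1 : E ≤ 1 := expNegInvGlue_le_one _
          calc x ^ 8 * E ^ 2 ≤ 40320 * Real.exp x * E ^ 2 :=
                mul_le_mul_of_nonneg_right h10 (sq_nonneg _)
            _ = 40320 * (Real.exp x * E) * E := by ring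
            _ ≤ 40320 := by rw [h11]; linarith
        rw [le_div_iff₀ (by positivity)]
        calc 4 * (L * ((M / a) * (x ^ 2 * E)) ^ 2) * (a ^ 6 * M ^ 2)
            = 4 * L * ((a * M) ^ 4 * (x ^ 4 * E ^ 2)) := by field_simp
          _ ≤ 4 * L * (x ^ 4 * (x ^ 4 * E ^ 2)) := by
              refine mul_le_mul_of_nonneg_left (mul_le_mul_of_nonneg_right
                (pow_le_pow_left₀ (by positivity) hxM 4) (by positivity)) (by positivity)
          _ = 4 * L * (x ^ 8 * E ^ 2) := by ring
          _ ≤ _ := mul_le_mul_of_nonneg_left h8 (by positivity)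
      have h3 : 0 ≤ N * (y ^ 4)⁻¹ * E ^ 2 := by positivity
      linarith

/-- If the weight blows up fast enough at the boundary part `{s = c}`, then good cutoffs exist. -/
theorem hasGoodCutoffs {D : Set (Fin n → ℂ)} (hD : IsOpen D) {s : (Fin n → ℂ) → ℝ}
    (hs : ContDiffOn ℝ (⊤ : ℕ∞) s D) {c : ℝ} (hsc : ∀ z ∈ D, s z < c)
    (hcpt : ∀ c' < c, ∃ K, IsCompact K ∧ K ⊆ D ∧ {z ∈ D | s z ≤ c'} ⊆ K) {L : ℝ} (hL0 : 0 ≤ L)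
    (hL : ∀ z ∈ D, ∑ j, ‖dz j (fun w => (s w : ℂ)) z‖ ^ 2 ≤ L) {Φ : (Fin n → ℂ) → ℝ} {N : ℝ}
    (hN : 0 < N) (hlevi : ∀ z ∈ D, ∀ ξ : Fin n → ℂ,
      (1 + N * ((c - s z) ^ 4)⁻¹) * ∑ j, ‖ξ j‖ ^ 2 ≤ levi Φ z ξ) : HasGoodCutoffs D Φ := by
  classical
  obtain ⟨a, ha, haN⟩ : ∃ a : ℝ, 0 < a ∧ 64 * L * a ^ 2 ≤ N := by
    refine ⟨√(N / (64 * (L + 1))), Real.sqrt_pos.2 (by positivity), ?_⟩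
    rw [Real.sq_sqrt (by positivity)]
    have : 64 * L * (N / (64 * (L + 1))) = N * (L / (L + 1)) := by field_simp
    rw [this]
    exact mul_le_of_le_one_right hN.le (div_le_one_of_le₀ (by linarith) (by positivity))
  set M : ℕ → ℝ := fun m => (m : ℝ) + 1 with hMd
  have hM : ∀ m, 1 ≤ M m := fun m => by simp [hMd]
  have hM0 : ∀ m, 0 < M m := fun m => by linarith [hM m]
  have hMt : Tendsto M atTop atTop := tendsto_atTop_add_const_right _ _ tendsto_natCast_atTop_atTop
  set k : ℕ → ℝ → ℝ := fun m t => expNegInvGlue (((c - t) - (M m ^ 2)⁻¹) * (M m / a)) with hk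
  set η : ℕ → (Fin n → ℂ) → ℝ := fun m z => if z ∈ D then k m (s z) else 0 with hη
  have hηD : ∀ m, ∀ z ∈ D, η m z = k m (s z) := fun m z hz => if_pos hz
  have hks : ∀ m, ContDiff ℝ (⊤ : ℕ∞) (k m) := fun m =>
    expNegInvGlue.contDiff.comp (by fun_prop)
  have hk' : ∀ m t, HasDerivAt (k m) (-((M m / a) * (((((c - t) - (M m ^ 2)⁻¹) * (M m / a))⁻¹) ^ 2 *
      expNegInvGlue (((c - t) - (M m ^ 2)⁻¹) * (M m / a))))) t := by
    intro m t
    have h1 : HasDerivAt (fun t => ((c - t) - (M m ^ 2)⁻¹) * (M m / a)) (-1 * (M m / a)) t :=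
      (((hasDerivAt_id t).const_sub c).sub_const _).mul_const _
    have := (hasDerivAt_expNegInvGlue _).comp t h1
    exact this.congr_deriv (by ring)
  have hsup : ∀ m, ∃ K, IsCompact K ∧ K ⊆ D ∧ ∀ z, z ∉ K → η m z = 0 := by
    intro m
    have hp : 0 < (M m ^ 2)⁻¹ := by have := hM0 m; positivity
    obtain ⟨K, hK, hKD, hsub⟩ := hcpt (c - (M m ^ 2)⁻¹) (by linarith)
    refine ⟨K, hK, hKD, fun z hz => ?_⟩
    by_cases hzD : z ∈ D
    · rw [hηD m z hzD]
      refine expNegInvGlue.zero_of_nonpos (mul_nonpos_of_nonpos_of_nonneg ?_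
        (by have := hM0 m; positivity))
      by_contra hcon
      exact hz (hsub ⟨hzD, by linarith⟩)
    · exact if_neg hzD
  refine ⟨η, fun m => 4 * L * 40320 / (a ^ 6 * M m ^ 2), ?_, fun m => ?_, fun m z => ?_,
    fun m z hz ξ => ?_, fun z hz => ?_⟩
  · refine Tendsto.div_atTop tendsto_const_nhds ?_
    exact ((tendsto_pow_atTop (by norm_num)).comp hMt).const_mul_atTop (by positivity)
  · obtain ⟨K, hK, hKD, h0⟩ := hsup m
    have hts : tsupport (η m) ⊆ K := closure_minimal (fun z hz => by
      by_contra hzK; exact hz (h0 z hzK)) hK.isClosed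
    refine ⟨contDiff_iff_contDiffAt.2 fun z => ?_, hK.of_isClosed_subset (isClosed_tsupport _) hts,
      hts.trans hKD⟩
    by_cases hz : z ∈ D
    · have h1 : ContDiffAt ℝ (⊤ : ℕ∞) (fun w => k m (s w)) z :=
        (hks m).contDiffAt.comp z (hs.contDiffAt (hD.mem_nhds hz))
      refine h1.congr_of_eventuallyEq ?_
      filter_upwards [hD.mem_nhds hz] with w hw using hηD m w hw
    · refine (contDiffAt_const (c := (0:ℝ))).congr_of_eventuallyEq ?_
      filter_upwards [hK.isClosed.isOpen_compl.mem_nhds fun h => hz (hKD h)] with w hw using h0 w hw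
  · simp only [hη]
    split_ifs
    · exact ⟨expNegInvGlue.nonneg _, expNegInvGlue_le_one _⟩
    · simp
  · have hd : ∀ j, dz j (fun w => (η m w : ℂ)) z = ((-((M m / a) * (((((c - s z) - (M m ^ 2)⁻¹)
        * (M m / a))⁻¹) ^ 2 * expNegInvGlue (((c - s z) - (M m ^ 2)⁻¹) * (M m / a)))) : ℝ) : ℂ)
        * dz j (fun w => (s w : ℂ)) z := by
      intro j
      have he : (fun w => (η m w : ℂ)) =ᶠ[𝓝 z] fun w => ((k m (s w) : ℝ) : ℂ) := by
        filter_upwards [hD.mem_nhds hz] with w hw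
        rw [hηD m w hw]
      rw [dz, wd_congr he, wd_comp_real ((hs.contDiffAt (hD.mem_nhds hz)).differentiableAt
        (by simp)) (hk' m (s z))]
    have hS : (0:ℝ) ≤ ∑ j, ‖ξ j‖ ^ 2 := Finset.sum_nonneg fun _ _ => by positivity
    have hy : 0 < c - s z := by linarith [hsc z hz]
    have hb := cutoff_deriv_bound hL0 ha haN (hM m) hy
    have hη1 : η m z = expNegInvGlue (((c - s z) - (M m ^ 2)⁻¹) * (M m / a)) := hηD m z hz
    have hg : ∑ j, ‖dz j (fun w => (η m w : ℂ)) z‖ ^ 2 ≤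
        L * ((M m / a) * (((((c - s z) - (M m ^ 2)⁻¹) * (M m / a))⁻¹) ^ 2 * η m z)) ^ 2 := by
      simp only [hd, norm_mul, mul_pow, ← Finset.mul_sum, norm_real, Real.norm_eq_abs, sq_abs]
      rw [mul_comm, neg_sq, ← hη1]
      refine mul_le_mul (hL z hz) (le_of_eq (by ring)) (by positivity) hL0
    rw [← hη1] at hb
    have h1 := hlevi z hz ξ
    calc _ ≤ ((1 + N * ((c - s z) ^ 4)⁻¹) * η m z ^ 2) * ∑ j, ‖ξ j‖ ^ 2 :=
          mul_le_mul_of_nonneg_right (by nlinarith) hS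
      _ = ((1 + N * ((c - s z) ^ 4)⁻¹) * ∑ j, ‖ξ j‖ ^ 2) * η m z ^ 2 := by ring
      _ ≤ _ := mul_le_mul_of_nonneg_right h1 (sq_nonneg _)
  · have hy : 0 < c - s z := by linarith [hsc z hz]
    have ht : Tendsto (fun m => ((c - s z) - (M m ^ 2)⁻¹) * (M m / a)) atTop atTop := by
      have h1 : Tendsto (fun m => (c - s z) - (M m ^ 2)⁻¹) atTop (𝓝 (c - s z - 0)) :=
        tendsto_const_nhds.sub ((tendsto_pow_atTop (by norm_num)).comp hMt).inv_tendsto_atTop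
      exact h1.pos_mul_atTop (by simpa using hy) (hMt.atTop_div_const ha)
    have h2 : Tendsto (fun m => Real.exp (-(((c - s z) - (M m ^ 2)⁻¹) * (M m / a))⁻¹)) atTop
        (𝓝 1) := by
      have := (Real.continuous_exp.tendsto _).comp ht.inv_tendsto_atTop.neg
      simpa [Function.comp_def] using this
    refine h2.congr' ?_
    filter_upwards [ht.eventually_gt_atTop 0] with m hm
    rw [hηD m z hz]
    exact (expNegInvGlue_of_pos hm).symm

end GoodCutoffs

section Psh

/-- The sub-mean value inequality on circles passes to mollifications. -/
lemma moll_le_circle_average {δ : ℝ} (hδ : 0 < δ) {v : (Fin n → ℂ) → ℝ} (hv : Continuous v)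
    {z w : Fin n → ℂ} {r : ℝ}
    (h : ∀ x ∈ Metric.ball z δ, v x ≤ (1 / (2 * Real.pi)) *
      ∫ θ in (0:ℝ)..(2 * Real.pi), v (x + ((r : ℂ) * exp (θ * I)) • w)) :
    moll δ v z ≤ (1 / (2 * Real.pi)) *
      ∫ θ in (0:ℝ)..(2 * Real.pi), moll δ v (z + ((r : ℂ) * exp (θ * I)) • w) := by
  have hpi : (0:ℝ) ≤ 2 * Real.pi := by positivity
  have hcont : Continuous (Function.uncurry fun (θ : ℝ) (y : Fin n → ℂ) =>
      bump δ y • v (z + ((r : ℂ) * exp (θ * I)) • w - y)) := by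
    have h1 : Continuous fun p : ℝ × (Fin n → ℂ) => bump δ p.2 :=
      (contDiff_bump δ).continuous.comp continuous_snd
    have h2 : Continuous fun p : ℝ × (Fin n → ℂ) =>
      v (z + ((r : ℂ) * exp (p.1 * I)) • w - p.2) := hv.comp (by fun_prop)
    exact h1.smul h2
  have hint : Integrable (Function.uncurry fun (θ : ℝ) (y : Fin n → ℂ) =>
      bump δ y • v (z + ((r : ℂ) * exp (θ * I)) • w - y))
      ((volume.restrict (uIoc 0 (2 * Real.pi))).prod volume) := by
    rw [← Measure.restrict_univ (μ := (volume : Measure (Fin n → ℂ))), Measure.prod_restrict]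
    have hc : IntegrableOn (Function.uncurry fun (θ : ℝ) (y : Fin n → ℂ) =>
      bump δ y • v (z + ((r : ℂ) * exp (θ * I)) • w - y))
      (uIcc 0 (2 * Real.pi) ×ˢ Metric.closedBall 0 δ) (volume.prod volume) :=
      hcont.continuousOn.integrableOn_compact (isCompact_uIcc.prod (isCompact_closedBall _ _))
    refine hc.of_forall_sdiff_eq_zero (measurableSet_uIoc.prod MeasurableSet.univ) ?_
    rintro ⟨θ, y⟩ ⟨⟨h1, -⟩, h2⟩
    have hb0 : bump δ y = 0 := by
      by_contra h
      exact h2 ⟨uIoc_subset_uIcc h1, by simpa using (norm_lt_of_bump_ne hδ h).le⟩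
    simp [hb0]
  have hsw := integral_integral_swap hint
  rw [uIoc_of_le hpi] at hsw
  simp only [← intervalIntegral.integral_of_le hpi, ← moll_eq_swap,
    intervalIntegral.integral_smul] at hsw
  rw [hsw, ← integral_const_mul, moll_eq_swap]
  have hcs : HasCompactSupport fun y => bump δ y • v (z - y) :=
    (hasCompactSupport_bump hδ).smul_right
  refine integral_mono ?_ ?_ fun y => ?_
  · exact Continuous.integrable_of_hasCompactSupport
      ((contDiff_bump δ).continuous.smul (hv.comp (by fun_prop))) hcs
  · have := hint.integral_prod_right
    rw [uIoc_of_le hpi] at this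
    simp only [Function.uncurry, ← intervalIntegral.integral_of_le hpi,
      intervalIntegral.integral_smul] at this
    exact this.const_mul _
  · by_cases hb : bump δ y = 0
    · simp [hb]
    · have h1 := h (z - y) (by simpa using norm_lt_of_bump_ne hδ hb)
      have h2 := mul_le_mul_of_nonneg_left h1 (bump_nonneg hδ y)
      simp only [smul_eq_mul]
      refine h2.trans (le_of_eq ?_)
      have : ∀ θ : ℝ, z - y + ((r : ℂ) * exp (θ * I)) • w = z + ((r : ℂ) * exp (θ * I)) • w - y :=
        fun θ => by abel
      simp only [this]
      ring

/-- Second order Taylor expansion. -/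
lemma abs_taylor_two_le {s : (Fin n → ℂ) → ℝ} (hs : ContDiff ℝ (⊤ : ℕ∞) s) (z : Fin n → ℂ)
    {ε : ℝ} (hε : 0 < ε) : ∃ ρ > 0, ∀ v : Fin n → ℂ, ‖v‖ < ρ →
      |s (z + v) - s z - fderiv ℝ s z v - (1 / 2) * fderiv ℝ (fderiv ℝ s) z v v| ≤ ε * ‖v‖ ^ 2 := by
  set B := fderiv ℝ (fderiv ℝ s) z with hB
  have hsym : ∀ v w, B v w = B w v := hs.contDiffAt.isSymmSndFDerivAt (by
    simpa using WithTop.coe_le_coe.2 (le_top : (2 : ℕ∞) ≤ ⊤))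
  have hd : DifferentiableAt ℝ (fderiv ℝ s) z :=
    (hs.fderiv_right (m := (⊤ : ℕ∞)) (by simp)).differentiable (by simp) z
  have ho := hd.hasFDerivAt.isLittleO
  obtain ⟨ρ, hρ, hρ2⟩ := Metric.eventually_nhds_iff.1 (ho.def hε)
  refine ⟨ρ, hρ, fun v hv => ?_⟩
  let R : (Fin n → ℂ) → ℝ := fun x => s (z + x) - s z - fderiv ℝ s z x - (1 / 2) * B x x
  have hR : ∀ x, HasFDerivAt R (fderiv ℝ s (z + x) - fderiv ℝ s z - B x) x := by
    intro x
    have h1 : HasFDerivAt (fun x => s (z + x)) (fderiv ℝ s (z + x)) x := by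
      have := ((hs.differentiable (by simp)) (z + x)).hasFDerivAt.comp x
        ((hasFDerivAt_id x).const_add z)
      exact this.congr_fderiv (ContinuousLinearMap.comp_id _)
    have h2 : HasFDerivAt (fun x => B x x) (B x + B.flip x) x := by
      have := B.hasFDerivAt (x := x) |>.clm_apply (hasFDerivAt_id x)
      refine this.congr_fderiv ?_
      ext y; simp
    have h3 : HasFDerivAt R (fderiv ℝ s (z + x) - fderiv ℝ s z - (1 / 2 : ℝ) • (B x + B.flip x)) x :=
      ((h1.sub_const (s z)).sub (fderiv ℝ s z).hasFDerivAt).sub (h2.const_mul (1/2))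
    refine h3.congr_fderiv ?_
    ext y
    simp only [sub_apply, smul_apply, add_apply, ContinuousLinearMap.flip_apply, smul_eq_mul,
      hsym y x]
    ring
  have hm := (convex_closedBall (0 : Fin n → ℂ) ‖v‖).norm_image_sub_le_of_norm_hasFDerivWithin_le
    (fun x _ => (hR x).hasFDerivWithinAt) (C := ε * ‖v‖) (fun x hx => ?_)
    (x := 0) (y := v) (by simp) (by simp)
  · have hR0 : R 0 = 0 := by simp [R]
    rw [hR0, sub_zero, sub_zero, Real.norm_eq_abs] at hm
    refine hm.trans (le_of_eq (by ring))
  · have hx' : ‖x‖ ≤ ‖v‖ := by simpa using hx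
    have := hρ2 (y := z + x) (by simpa using hx'.trans_lt hv)
    simp only [add_sub_cancel_left] at this
    exact this.trans (mul_le_mul_of_nonneg_left hx' hε.le)

/-- A smooth function satisfying the sub-mean value inequality on small circles has nonnegative
Levi form. -/
lemma levi_nonneg_of_le_circle_average {s : (Fin n → ℂ) → ℝ} (hs : ContDiff ℝ (⊤ : ℕ∞) s)
    {z ξ : Fin n → ℂ} {r0 : ℝ} (hr0 : 0 < r0)
    (h : ∀ r, 0 < r → r < r0 → s z ≤ (1 / (2 * Real.pi)) *
      ∫ θ in (0:ℝ)..(2 * Real.pi), s (z + ((r : ℂ) * exp (θ * I)) • ξ)) :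
    0 ≤ levi s z ξ := by
  have hpi := Real.pi_pos
  set B := fderiv ℝ (fderiv ℝ s) z with hB
  have hsym : ∀ v w, B v w = B w v := hs.contDiffAt.isSymmSndFDerivAt (by
    simpa using WithTop.coe_le_coe.2 (le_top : (2 : ℕ∞) ≤ ⊤))
  refine le_of_forall_pos_lt_add fun ε' hε' => ?_
  obtain ⟨ε, hε, hεξ⟩ : ∃ ε > 0, ε * ‖ξ‖ ^ 2 < ε' :=
    ⟨ε' / (‖ξ‖ ^ 2 + 1), by positivity, by
      rw [div_mul_eq_mul_div, div_lt_iff₀ (by positivity)]; nlinarith⟩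
  obtain ⟨ρ, hρ, hT⟩ := abs_taylor_two_le hs z hε
  obtain ⟨r, hr, hrr0, hrρ⟩ : ∃ r : ℝ, 0 < r ∧ r < r0 ∧ r * ‖ξ‖ < ρ := by
    refine ⟨min (r0 / 2) (ρ / (‖ξ‖ + 1) ), by positivity, ?_, ?_⟩
    · exact (min_le_left _ _).trans_lt (by linarith)
    · calc _ ≤ ρ / (‖ξ‖ + 1) * ‖ξ‖ := mul_le_mul_of_nonneg_right (min_le_right _ _) (norm_nonneg _)
        _ < ρ := by
          rw [div_mul_eq_mul_div, div_lt_iff₀ (by positivity)]; nlinarith [norm_nonneg ξ]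
  have h1 := h r hr hrr0
  have hv : ∀ θ : ℝ, ((r : ℂ) * exp (θ * I)) • ξ = (r * Real.cos θ) • ξ + (r * Real.sin θ) • (I • ξ) := by
    intro θ
    ext j
    simp only [exp_mul_I, Pi.smul_apply, Pi.add_apply, smul_eq_mul, real_smul, ofReal_mul,
      ofReal_cos, ofReal_sin]
    ring
  have hnv : ∀ θ : ℝ, ‖((r : ℂ) * exp (θ * I)) • ξ‖ = r * ‖ξ‖ := by
    intro θ
    rw [norm_smul, norm_mul, norm_exp_ofReal_mul_I, mul_one, norm_real, Real.norm_of_nonneg hr.le]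
  set D := fderiv ℝ s z with hD
  let P : ℝ → ℝ := fun θ => s z + r * D ξ * Real.cos θ + r * D (I • ξ) * Real.sin θ +
    (1 / 2) * r ^ 2 * (B ξ ξ) * Real.cos θ ^ 2 + r ^ 2 * B ξ (I • ξ) * (Real.sin θ * Real.cos θ)
    + (1 / 2) * r ^ 2 * (B (I • ξ) (I • ξ)) * Real.sin θ ^ 2 + ε * (r * ‖ξ‖) ^ 2
  have hP : ∀ θ : ℝ, s (z + ((r : ℂ) * exp (θ * I)) • ξ) ≤ P θ := by
    intro θ
    have h2 := (abs_le.1 (hT (((r : ℂ) * exp (θ * I)) • ξ) (by rw [hnv]; exact hrρ))).2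
    rw [hnv] at h2
    have h3 : D (((r : ℂ) * exp (θ * I)) • ξ) = r * D ξ * Real.cos θ + r * D (I • ξ) * Real.sin θ := by
      rw [hv, map_add, map_smul, map_smul, smul_eq_mul, smul_eq_mul]; ring
    have h4 : B (((r : ℂ) * exp (θ * I)) • ξ) (((r : ℂ) * exp (θ * I)) • ξ) =
        r ^ 2 * (B ξ ξ) * Real.cos θ ^ 2 + 2 * r ^ 2 * B ξ (I • ξ) * (Real.sin θ * Real.cos θ)
        + r ^ 2 * (B (I • ξ) (I • ξ)) * Real.sin θ ^ 2 := by
      rw [hv]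
      simp only [map_add, map_smul, add_apply, smul_apply, smul_eq_mul, hsym (I • ξ) ξ]
      ring
    rw [h3, h4] at h2
    simp only [P]
    linarith
  have hPc : Continuous P := by fun_prop
  have hsc : Continuous fun θ : ℝ => s (z + ((r : ℂ) * exp (θ * I)) • ξ) :=
    hs.continuous.comp (by fun_prop)
  have h5 : (∫ θ in (0:ℝ)..(2 * Real.pi), s (z + ((r : ℂ) * exp (θ * I)) • ξ)) ≤
      ∫ θ in (0:ℝ)..(2 * Real.pi), P θ :=
    intervalIntegral.integral_mono_on (by positivity) (hsc.intervalIntegrable _ _)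
      (hPc.intervalIntegrable _ _) fun θ _ => hP θ
  have h6 : (∫ θ in (0:ℝ)..(2 * Real.pi), P θ) =
      2 * Real.pi * (s z + r ^ 2 * (levi s z ξ + ε * ‖ξ‖ ^ 2)) := by
    have hci : ∀ f : ℝ → ℝ, Continuous f → IntervalIntegrable f volume 0 (2 * Real.pi) :=
      fun f hf => hf.intervalIntegrable _ _
    simp only [P]
    rw [intervalIntegral.integral_add (hci _ (by fun_prop)) (hci _ (by fun_prop)),
      intervalIntegral.integral_add (hci _ (by fun_prop)) (hci _ (by fun_prop)),
      intervalIntegral.integral_add (hci _ (by fun_prop)) (hci _ (by fun_prop)),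
      intervalIntegral.integral_add (hci _ (by fun_prop)) (hci _ (by fun_prop)),
      intervalIntegral.integral_add (hci _ (by fun_prop)) (hci _ (by fun_prop)),
      intervalIntegral.integral_add (hci _ (by fun_prop)) (hci _ (by fun_prop))]
    simp only [intervalIntegral.integral_const_mul, intervalIntegral.integral_const, integral_cos,
      integral_sin, integral_cos_sq, integral_sin_sq, integral_sin_mul_cos₁]
    rw [levi_eq_second_deriv hs.contDiffAt]
    simp
    ring
  rw [h6] at h5
  have h7 : s z ≤ s z + r ^ 2 * (levi s z ξ + ε * ‖ξ‖ ^ 2) := by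
    refine h1.trans ?_
    calc _ ≤ (1 / (2 * Real.pi)) * (2 * Real.pi * (s z + r ^ 2 * (levi s z ξ + ε * ‖ξ‖ ^ 2))) :=
          mul_le_mul_of_nonneg_left h5 (by positivity)
      _ = _ := by field_simp
  have h8 : 0 ≤ levi s z ξ + ε * ‖ξ‖ ^ 2 := by
    by_contra hc
    have := mul_neg_of_pos_of_neg (pow_pos hr 2) (not_le.1 hc)
    linarith
  linarith

end Psh

section Exhaustion

/-- A bounded pseudoconvex domain is exhausted by sublevel domains of smooth strictly
plurisubharmonic functions. -/
theorem exists_smooth_psh_domain {Ω : Set (Fin n → ℂ)} (hΩ : IsOpen Ω)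
    (hb : Bornology.IsBounded Ω) (hpsc : PseudoconvexExh n Ω) {K : Set (Fin n → ℂ)}
    (hK : IsCompact K) (hKΩ : K ⊆ Ω) :
    ∃ (D : Set (Fin n → ℂ)) (s : (Fin n → ℂ) → ℝ) (c L : ℝ), IsOpen D ∧ D ⊆ Ω ∧ K ⊆ D ∧
      ContDiff ℝ (⊤ : ℕ∞) s ∧ (∀ z ∈ D, s z < c) ∧ (∀ z ∈ K, s z ≤ c - 1) ∧
      (∀ c' < c, ∃ K', IsCompact K' ∧ K' ⊆ D ∧ {z ∈ D | s z ≤ c'} ⊆ K') ∧ 0 ≤ L ∧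
      (∀ z ∈ D, ∑ j, ‖dz j (fun w => (s w : ℂ)) z‖ ^ 2 ≤ L) ∧
      ∀ z ∈ D, ∀ ξ : Fin n → ℂ, ∑ j, ‖ξ j‖ ^ 2 ≤ levi s z ξ := by
  obtain ⟨u, huc, ⟨-, hu⟩, hex⟩ := hpsc
  obtain ⟨M, hM⟩ : ∃ M, ∀ z ∈ Ω, dsq 0 z ≤ M := by
    obtain ⟨M, hM⟩ := hb.isCompact_closure.exists_bound_of_continuousOn
      (contDiff_dsq (0 : Fin n → ℂ)).continuous.continuousOn
    exact ⟨M, fun z hz => (le_abs_self _).trans (hM z (subset_closure hz))⟩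
  obtain ⟨c0, hc0⟩ := hK.exists_bound_of_continuousOn (huc.mono hKΩ)
  have hc0' : ∀ z ∈ K, u z ≤ c0 := fun z hz => (le_abs_self _).trans (hc0 z hz)
  obtain ⟨K1, hK1, hK1Ω, hK1s⟩ := hex (c0 + M + 4)
  obtain ⟨δ0, hδ0, hδΩ⟩ := hK1.exists_cthickening_subset_open hΩ hK1Ω
  obtain ⟨χ, hχ, hχc, hχΩ, hχ1, -⟩ := exists_cutoff (hK1.cthickening (r := δ0)) hΩ hδΩ
  set v : (Fin n → ℂ) → ℝ := fun z => χ z * u z with hv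
  have hvc : Continuous v := by
    refine continuous_iff_continuousAt.2 fun z => ?_
    by_cases hz : z ∈ tsupport χ
    · exact hχ.continuous.continuousAt.mul (huc.continuousAt (hΩ.mem_nhds (hχΩ hz)))
    · have h0 : ∀ᶠ w in 𝓝 z, v w = 0 := by
        filter_upwards [notMem_tsupport_iff_eventuallyEq.1 hz] with w hw
        simp [hv, hw]
      exact (continuousAt_const (y := (0:ℝ))).congr (h0.mono fun w hw => hw.symm)
  have hvs : HasCompactSupport v := hχc.mul_right
  have hvu : ∀ z ∈ Metric.cthickening δ0 K1, v z = u z := fun z hz => by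
    simp [hv, hχ1.self_of_nhdsSet z hz]
  obtain ⟨ε1, hε1, huni⟩ := Metric.uniformContinuous_iff.1
    (hvs.uniformContinuous_of_continuous hvc) 1 one_pos
  set ε := min ε1 (δ0 / 2) with hε
  have hε0 : 0 < ε := lt_min hε1 (by positivity)
  have hεδ : ε ≤ δ0 / 2 := min_le_right _ _
  set s1 := moll ε v with hs1
  have hs1s : ContDiff ℝ (⊤ : ℕ∞) s1 := contDiff_moll hε0 hvc.locallyIntegrable
  have hs1v : ∀ z, |s1 z - v z| ≤ 1 := fun z =>
    norm_moll_sub_le hε0 hvc.locallyIntegrable fun t ht =>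
      (huni ((Metric.mem_ball.1 ht).trans_le (min_le_left _ _))).le
  set s : (Fin n → ℂ) → ℝ := fun z => s1 z + dsq 0 z with hs
  have hss : ContDiff ℝ (⊤ : ℕ∞) s := hs1s.add (contDiff_dsq 0)
  set c := c0 + M + 2 with hc
  set D : Set (Fin n → ℂ) := {z | z ∈ Ω ∧ u z < c0 + M + 4 ∧ s z < c} with hD
  have hDK1 : ∀ z ∈ D, z ∈ K1 := fun z hz => hK1s ⟨hz.1, hz.2.1.le⟩
  have hK1v : ∀ z ∈ K1, v z = u z := fun z hz => hvu z (Metric.self_subset_cthickening _ hz)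
  have hDo : IsOpen D := by
    have h1 := huc.isOpen_inter_preimage hΩ (isOpen_Iio (a := c0 + M + 4))
    have h2 := (isOpen_Iio (a := c)).preimage hss.continuous
    have e : D = Ω ∩ u ⁻¹' Iio (c0 + M + 4) ∩ s ⁻¹' Iio c :=
      Set.ext fun z => ⟨fun h => ⟨⟨h.1, h.2.1⟩, h.2.2⟩, fun h => ⟨h.1.1, h.1.2, h.2⟩⟩
    exact e ▸ h1.inter h2
  obtain ⟨L, hL⟩ := hK1.exists_bound_of_continuousOn
    (f := fun z => ∑ j, ‖dz j (fun w => (s w : ℂ)) z‖ ^ 2)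
    (continuous_finsetSum _ fun j _ => ((contDiff_wd (contDiff_ofReal hss)).continuous.norm.pow 2)
      ).continuousOn
  refine ⟨D, s, c, max L 0, hDo, fun z hz => hz.1, fun z hz => ?_, hss, fun z hz => hz.2.2,
    fun z hz => ?_, fun c' hc' => ?_, le_max_right _ _, fun z hz => ?_, fun z hz ξ => ?_⟩
  · have h0 := hc0' z hz
    have hMz := hM z (hKΩ hz)
    have hM0 : 0 ≤ M := (dsq_nonneg 0 z).trans hMz
    have h1 : u z < c0 + M + 4 := by linarith
    have h2 := hK1v z (hK1s ⟨hKΩ hz, h1.le⟩)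
    have h3 := (abs_le.1 (hs1v z)).2
    exact ⟨hKΩ hz, h1, by simp only [hs, hc]; linarith⟩
  · have h0 := hc0' z hz
    have hMz := hM z (hKΩ hz)
    have hM0 : 0 ≤ M := (dsq_nonneg 0 z).trans hMz
    have h2 := hK1v z (hK1s ⟨hKΩ hz, by linarith⟩)
    have h3 := (abs_le.1 (hs1v z)).2
    simp only [hs, hc]; linarith
  · refine ⟨K1 ∩ ({z | s z ≤ c'} ∩ {z | v z ≤ c + 1}), hK1.inter_right
      ((isClosed_le hss.continuous continuous_const).inter
        (isClosed_le hvc continuous_const)), fun z hz => ?_, fun z hz => ?_⟩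
    · obtain ⟨h1, h2, h3⟩ := hz
      simp only [mem_ofPred_eq, hK1v z h1, hc] at h2 h3
      exact ⟨hK1Ω h1, by linarith, by linarith⟩
    · have h1 := hDK1 z hz.1
      refine ⟨h1, hz.2, ?_⟩
      have h3 := (abs_le.1 (hs1v z)).1
      have h4 := hz.1.2.2
      have h5 := dsq_nonneg 0 z
      simp only [hs, mem_ofPred_eq] at h4 ⊢
      linarith
  · exact (le_abs_self _).trans ((hL z (hDK1 z hz)).trans (le_max_left _ _))
  · rw [hs, levi_add isOpen_univ hs1s.contDiffOn (contDiff_dsq 0).contDiffOn (mem_univ z), levi_dsq]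
    have hz1 := hDK1 z hz
    have hpos : 0 ≤ levi s1 z ξ := by
      refine levi_nonneg_of_le_circle_average (r0 := δ0 / 2 / (‖ξ‖ + 1)) hs1s (by positivity)
        fun r hr hr0 => ?_
      refine moll_le_circle_average hε0 hvc fun x hx => ?_
      have hrξ : r * ‖ξ‖ ≤ δ0 / 2 := by
        rw [lt_div_iff₀ (by positivity)] at hr0
        nlinarith [norm_nonneg ξ]
      have hmem : ∀ t : ℂ, ‖t‖ ≤ r → x + t • ξ ∈ Metric.cthickening δ0 K1 := by
        intro t ht
        refine Metric.mem_cthickening_of_dist_le _ z _ _ hz1 ?_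
        have h1 : dist (x + t • ξ) x ≤ δ0 / 2 := by
          rw [dist_eq_norm, add_sub_cancel_left, norm_smul]
          exact (mul_le_mul_of_nonneg_right ht (norm_nonneg _)).trans hrξ
        have h2 := (Metric.mem_ball.1 hx).le.trans hεδ
        linarith [dist_triangle (x + t • ξ) x z]
      have hx0 := hmem 0 (by simpa using hr.le)
      rw [zero_smul, add_zero] at hx0
      have h1 := hu x (hδΩ hx0) ξ r hr fun t ht => hδΩ (hmem t ht)
      rw [hvu x hx0]
      refine h1.trans (le_of_eq ?_)
      congr 1
      refine intervalIntegral.integral_congr fun θ _ => ?_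
      refine (hvu _ (hmem _ ?_)).symm
      rw [norm_mul, norm_exp_ofReal_mul_I, mul_one, norm_real, Real.norm_of_nonneg hr.le]
    linarith

end Exhaustion

section WeightedEstimate

lemma isTestFun_sum_dzb {D : Set (Fin n → ℂ)} {q : Fin n → (Fin n → ℂ) → ℂ}
    (hq : ∀ j, IsTestFun n (q j) D) : IsTestFun n (fun z => ∑ j, dzb j (q j) z) D := by
  have h : ∀ j, IsTestFun n (dzb j (q j)) D := fun j => isTestFun_wd (hq j)
  have hss : Function.support (fun z => ∑ j, dzb j (q j) z) ⊆ ⋃ j, tsupport (dzb j (q j)) := by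
    intro z hz
    obtain ⟨j, -, hj⟩ := Finset.exists_ne_zero_of_sum_ne_zero hz
    exact mem_iUnion.2 ⟨j, subset_tsupport _ hj⟩
  have hts : tsupport (fun z => ∑ j, dzb j (q j) z) ⊆ ⋃ j, tsupport (dzb j (q j)) :=
    closure_minimal hss (isClosed_iUnion_of_finite fun j => isClosed_tsupport _)
  exact ⟨ContDiff.sum fun j _ => (h j).1,
    (isCompact_iUnion fun j => (h j).2.1).of_isClosed_subset (isClosed_tsupport _) hts,
    hts.trans (iUnion_subset fun j => (h j).2.2)⟩

lemma hasDerivAt_inv_pow {c t : ℝ} (k : ℕ) (h : c - t ≠ 0) :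
    HasDerivAt (fun t => ((c - t) ^ k)⁻¹) (k * ((c - t) ^ (k + 1))⁻¹) t := by
  have h1 : HasDerivAt (fun t => (c - t) ^ k) (k * (c - t) ^ (k - 1) * -1) t :=
    ((hasDerivAt_id t).const_sub c).pow k
  refine (h1.inv (pow_ne_zero _ h)).congr_deriv ?_
  rcases k with _ | k
  · simp
  · simp only [Nat.add_sub_cancel]
    field_simp
    ring

/-- The weighted estimate for a regularised weight with a singularity at `p`. -/
lemma test_estimate_of_pos {Ω : Set (Fin n → ℂ)} (hΩ : IsOpen Ω) (hb : Bornology.IsBounded Ω)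
    (hpsc : PseudoconvexExh n Ω) {β : (Fin n → ℂ) → ℂ} (hβ : ContDiffOn ℝ (⊤ : ℕ∞) β Ω)
    (hα : ∀ j, MemLp (dzb j β) 2 (volume.restrict Ω)) {p : Fin n → ℂ} {ρ : ℝ} (hρ : 0 < ρ)
    (hρα : ∀ z ∈ Ω, dsq p z < ρ → ∀ j, dzb j β z = 0) (m : ℕ)
    {q : Fin n → (Fin n → ℂ) → ℂ} (hq : ∀ j, IsTestFun n (q j) Ω) {ε : ℝ} (hε : 0 < ε) :
    ‖∑ j, ∫ z, dzb j β z * q j z‖ ^ 2 ≤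
      (2 * Real.exp 1 * (ρ ^ m)⁻¹ * ∫ z in Ω, ∑ j, ‖dzb j β z‖ ^ 2) *
      ∫ z, ‖∑ j, dzb j (q j) z‖ ^ 2 * (Real.exp (dsq 0 z) * (dsq p z + ε) ^ m) := by
  obtain ⟨D, s, c, L, hD, hDΩ, hKD, hs, hsc, hsK, hcpt, hL0, hL, hlevi⟩ :=
    exists_smooth_psh_domain hΩ hb hpsc (K := ⋃ j, tsupport (q j))
      (isCompact_iUnion fun j => (hq j).2.1) (iUnion_subset fun j => (hq j).2.2)
  have hqD : ∀ j, IsTestFun n (q j) D := fun j =>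
    ⟨(hq j).1, (hq j).2.1, (subset_iUnion (fun j => tsupport (q j)) j).trans hKD⟩
  have hpε : ∀ z, 0 < dsq p z + ε := fun z => by linarith [dsq_nonneg p z]
  have hcs : ∀ z ∈ D, 0 < c - s z := fun z hz => by linarith [hsc z hz]
  set Φ1 : (Fin n → ℂ) → ℝ := fun z => m * Real.log (dsq p z + ε) with hΦ1
  set Φ2 : (Fin n → ℂ) → ℝ := fun z => ((c - s z) ^ 3)⁻¹ with hΦ2
  set Φ : (Fin n → ℂ) → ℝ := fun z => (dsq 0 z + Φ1 z) + Φ2 z with hΦ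
  have c1 : ContDiffOn ℝ (⊤ : ℕ∞) Φ1 D :=
    (contDiff_const.mul (((contDiff_dsq p).add contDiff_const).log
      fun z => (hpε z).ne')).contDiffOn
  have c2 : ContDiffOn ℝ (⊤ : ℕ∞) Φ2 D :=
    ((contDiff_const.sub hs).pow 3).contDiffOn.inv fun z hz => (pow_pos (hcs z hz) 3).ne'
  have c0 : ContDiffOn ℝ (⊤ : ℕ∞) (dsq (0 : Fin n → ℂ)) D := (contDiff_dsq 0).contDiffOn
  have c01 : ContDiffOn ℝ (⊤ : ℕ∞) (fun z => dsq 0 z + Φ1 z) D := c0.add c1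
  have cΦ : ContDiffOn ℝ (⊤ : ℕ∞) Φ D := c01.add c2
  have hgood : HasGoodCutoffs D Φ := by
    refine hasGoodCutoffs hD hs.contDiffOn hsc hcpt hL0 hL (N := 3) (by norm_num) fun z hz ξ => ?_
    rw [hΦ, levi_add hD c01 c2 hz, levi_add hD c0 c1 hz, levi_dsq]
    have h1 : 0 ≤ levi Φ1 z ξ := levi_log_dsq_nonneg p z ξ hε (Nat.cast_nonneg m)
    have h2 := levi_comp hD hs.contDiffOn (k := fun t => ((c - t) ^ 3)⁻¹)
      (k1 := fun t => 3 * ((c - t) ^ 4)⁻¹) (k2 := 3 * (4 * ((c - s z) ^ 5)⁻¹)) hz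
      (fun w hw => by simpa using hasDerivAt_inv_pow 3 (hcs w hw).ne')
      (by simpa using (hasDerivAt_inv_pow 4 (hcs z hz).ne').const_mul 3) ξ
    have h3 : levi Φ2 z ξ = _ := h2
    have h4 := hcs z hz
    have h5 : 0 ≤ 3 * (4 * ((c - s z) ^ 5)⁻¹) * ‖∑ j, dz j (fun w => (s w : ℂ)) z * ξ j‖ ^ 2 := by
      positivity
    have h6 : 3 * ((c - s z) ^ 4)⁻¹ * ∑ j, ‖ξ j‖ ^ 2 ≤ 3 * ((c - s z) ^ 4)⁻¹ * levi s z ξ :=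
      mul_le_mul_of_nonneg_left (hlevi z hz ξ) (by positivity)
    rw [h3]
    linarith
  have hexpΦ1 : ∀ z, Real.exp (Φ1 z) = (dsq p z + ε) ^ m := fun z => by
    change Real.exp (m * Real.log (dsq p z + ε)) = _
    rw [mul_comm, Real.exp_mul, Real.exp_log (hpε z), Real.rpow_natCast]
  have hΦge : ∀ z ∈ D, Φ1 z ≤ Φ z := fun z hz => by
    have h1 := dsq_nonneg 0 z
    have h2 : 0 ≤ Φ2 z := (inv_pos.2 (pow_pos (hcs z hz) 3)).le
    simp only [hΦ]; linarith
  have hA : ∀ j, MemLp (fun z => ((Real.exp (-Φ z / 2) : ℝ) : ℂ) * dzb j β z) 2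
      (volume.restrict D) := by
    intro j
    have hm : AEStronglyMeasurable (fun z => ((Real.exp (-Φ z / 2) : ℝ) : ℂ))
        (volume.restrict D) :=
      (continuous_ofReal.comp_continuousOn (Real.continuous_exp.comp_continuousOn
        (cΦ.continuousOn.neg.div_const 2))).aestronglyMeasurable hD.measurableSet
    have hα' := (hα j).mono_measure (Measure.restrict_mono_set volume hDΩ)
    refine hα'.of_le_mul (c := Real.exp (-(m * Real.log ε) / 2)) (hm.mul hα'.1) ?_
    filter_upwards [ae_restrict_mem hD.measurableSet] with z hz
    rw [norm_mul, norm_real, Real.norm_of_nonneg (Real.exp_pos _).le]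
    refine mul_le_mul_of_nonneg_right (Real.exp_le_exp.2 ?_) (norm_nonneg _)
    have h1 := hΦge z hz
    have h2 : m * Real.log ε ≤ Φ1 z := mul_le_mul_of_nonneg_left
      (Real.log_le_log hε (by linarith [dsq_nonneg p z])) (Nat.cast_nonneg m)
    linarith
  have hαi : IntegrableOn (fun z => ∑ j, ‖dzb j β z‖ ^ 2) Ω :=
    integrable_finsetSum _ fun j _ => (hα j).integrable_norm_pow (by norm_num)
  refine (dual_estimate hD cΦ hgood (hβ.mono hDΩ) hA hqD).trans ?_
  have hR1 : (∫ z in D, ∑ j, ‖dzb j β z‖ ^ 2 * Real.exp (-Φ z)) ≤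
      (ρ ^ m)⁻¹ * ∫ z in Ω, ∑ j, ‖dzb j β z‖ ^ 2 := by
    rw [← integral_const_mul]
    refine le_trans (integral_mono_of_nonneg (.of_forall fun z => Finset.sum_nonneg fun j _ =>
      by positivity) ((hαi.mono_set hDΩ).const_mul _) ?_)
      (setIntegral_mono_set (hαi.const_mul _) (.of_forall fun z => ?_) hDΩ.eventuallyLE)
    · filter_upwards [ae_restrict_mem hD.measurableSet] with z hz
      rw [← Finset.sum_mul, mul_comm]
      rcases lt_or_ge (dsq p z) ρ with h | h
      · simp [hρα z (hDΩ hz) h]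
      · refine mul_le_mul_of_nonneg_right ?_ (Finset.sum_nonneg fun j _ => by positivity)
        rw [Real.exp_neg]
        refine inv_anti₀ (by positivity) ?_
        calc ρ ^ m ≤ (dsq p z + ε) ^ m := pow_le_pow_left₀ hρ.le (by linarith) m
          _ = Real.exp (Φ1 z) := (hexpΦ1 z).symm
          _ ≤ _ := Real.exp_le_exp.2 (hΦge z hz)
    · exact mul_nonneg (by positivity) (Finset.sum_nonneg fun j _ => by positivity)
  have hQ := isTestFun_sum_dzb hqD
  set Q : (Fin n → ℂ) → ℂ := fun z => ∑ j, dzb j (q j) z with hQd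
  have hQsupp : ∀ z, z ∉ (⋃ j, tsupport (q j)) → Q z = 0 := fun z hz =>
    Finset.sum_eq_zero fun j _ => image_eq_zero_of_notMem_tsupport fun h =>
      hz (mem_iUnion.2 ⟨j, tsupport_wd_subset h⟩)
  have hQi : Integrable fun z => ‖Q z‖ ^ 2 * (Real.exp (dsq 0 z) * (dsq p z + ε) ^ m) := by
    have hQc := hQ.1.continuous
    have h0 := (contDiff_dsq (0 : Fin n → ℂ)).continuous
    have h1 := (contDiff_dsq p).continuous
    refine Continuous.integrable_of_hasCompactSupport (by fun_prop) ?_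
    exact HasCompactSupport.mul_right (hQ.2.1.comp_left (g := fun x : ℂ => ‖x‖ ^ 2) (by simp))
  have hR2 : (∫ z in D, ‖Q z‖ ^ 2 * Real.exp (Φ z)) ≤ Real.exp 1 *
      ∫ z, ‖Q z‖ ^ 2 * (Real.exp (dsq 0 z) * (dsq p z + ε) ^ m) := by
    rw [← integral_const_mul]
    refine le_trans (integral_mono_of_nonneg (.of_forall fun z => by positivity)
      (hQi.restrict.const_mul _) ?_) (setIntegral_le_integral (hQi.const_mul _)
        (.of_forall fun z => ?_))
    · refine .of_forall fun z => ?_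
      by_cases hz : z ∈ ⋃ j, tsupport (q j)
      · have h1 : Φ2 z ≤ 1 := inv_le_one_of_one_le₀ (one_le_pow₀ (by linarith [hsK z hz]))
        have h2 : Real.exp (Φ z) ≤ Real.exp 1 * (Real.exp (dsq 0 z) * (dsq p z + ε) ^ m) := by
          rw [← hexpΦ1, ← Real.exp_add, ← Real.exp_add]
          exact Real.exp_le_exp.2 (by simp only [hΦ]; linarith)
        calc _ ≤ ‖Q z‖ ^ 2 * (Real.exp 1 * (Real.exp (dsq 0 z) * (dsq p z + ε) ^ m)) :=
              mul_le_mul_of_nonneg_left h2 (by positivity)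
          _ = _ := by ring
      · simp [hQsupp z hz]
    · have := hpε z
      positivity
  calc _ ≤ ((ρ ^ m)⁻¹ * ∫ z in Ω, ∑ j, ‖dzb j β z‖ ^ 2) * (2 * (Real.exp 1 *
        ∫ z, ‖Q z‖ ^ 2 * (Real.exp (dsq 0 z) * (dsq p z + ε) ^ m))) :=
        mul_le_mul hR1 (mul_le_mul_of_nonneg_left hR2 (by norm_num))
          (mul_nonneg (by norm_num) (integral_nonneg fun z => by positivity))
          (mul_nonneg (by positivity) (integral_nonneg fun z => Finset.sum_nonneg fun j _ =>
            by positivity))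
    _ = _ := by ring

/-- The weighted estimate for the singular weight. -/
lemma test_estimate {Ω : Set (Fin n → ℂ)} (hΩ : IsOpen Ω) (hb : Bornology.IsBounded Ω)
    (hpsc : PseudoconvexExh n Ω) {β : (Fin n → ℂ) → ℂ} (hβ : ContDiffOn ℝ (⊤ : ℕ∞) β Ω)
    (hα : ∀ j, MemLp (dzb j β) 2 (volume.restrict Ω)) {p : Fin n → ℂ} {ρ : ℝ} (hρ : 0 < ρ)
    (hρα : ∀ z ∈ Ω, dsq p z < ρ → ∀ j, dzb j β z = 0) (m : ℕ)
    {q : Fin n → (Fin n → ℂ) → ℂ} (hq : ∀ j, IsTestFun n (q j) Ω) :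
    ‖∑ j, ∫ z, dzb j β z * q j z‖ ^ 2 ≤
      (2 * Real.exp 1 * (ρ ^ m)⁻¹ * ∫ z in Ω, ∑ j, ‖dzb j β z‖ ^ 2) *
      ∫ z, ‖∑ j, dzb j (q j) z‖ ^ 2 * (Real.exp (dsq 0 z) * dsq p z ^ m) := by
  have hQ := isTestFun_sum_dzb hq
  set Q : (Fin n → ℂ) → ℂ := fun z => ∑ j, dzb j (q j) z with hQd
  have hQc := hQ.1.continuous
  have h0 := (contDiff_dsq (0 : Fin n → ℂ)).continuous
  have h1 := (contDiff_dsq p).continuous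
  have hint : ∀ ε : ℝ, Integrable
      fun z => ‖Q z‖ ^ 2 * (Real.exp (dsq 0 z) * (dsq p z + ε) ^ m) := fun ε =>
    Continuous.integrable_of_hasCompactSupport (by fun_prop)
      (HasCompactSupport.mul_right (hQ.2.1.comp_left (g := fun x : ℂ => ‖x‖ ^ 2) (by simp)))
  have hlim : Tendsto (fun ε : ℝ => ∫ z, ‖Q z‖ ^ 2 * (Real.exp (dsq 0 z) * (dsq p z + ε) ^ m))
      (𝓝[>] 0) (𝓝 (∫ z, ‖Q z‖ ^ 2 * (Real.exp (dsq 0 z) * dsq p z ^ m))) := by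
    refine tendsto_integral_filter_of_dominated_convergence
      (fun z => ‖Q z‖ ^ 2 * (Real.exp (dsq 0 z) * (dsq p z + 1) ^ m))
      (.of_forall fun ε => (hint ε).1) ?_ (hint 1) (.of_forall fun z => ?_)
    · filter_upwards [Ioo_mem_nhdsGT (zero_lt_one (α := ℝ))] with ε hε
      refine .of_forall fun z => ?_
      have h2 := dsq_nonneg p z
      have h3 : 0 ≤ dsq p z + ε := by linarith [hε.1]
      rw [Real.norm_of_nonneg (by positivity)]
      refine mul_le_mul_of_nonneg_left (mul_le_mul_of_nonneg_left (pow_le_pow_left₀ h3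
        (by linarith [hε.2]) m) (by positivity)) (by positivity)
    · have hc : Continuous fun ε : ℝ => ‖Q z‖ ^ 2 * (Real.exp (dsq 0 z) * (dsq p z + ε) ^ m) := by
        fun_prop
      have := hc.tendsto 0
      rw [add_zero] at this
      exact this.mono_left nhdsWithin_le_nhds
  refine ge_of_tendsto (hlim.const_mul _) ?_
  filter_upwards [self_mem_nhdsWithin] with ε hε
  exact test_estimate_of_pos hΩ hb hpsc hβ hα hρ hρα m hq hε

end WeightedEstimate

section Correction

open scoped InnerProductSpace in
/-- A linear functional controlled by a seminorm `‖T ·‖` is represented through `T`. -/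
lemma exists_riesz_of_le {V H : Type*} [AddCommGroup V] [Module ℂ V] [NormedAddCommGroup H]
    [InnerProductSpace ℂ H] [CompleteSpace H] (T : V →ₗ[ℂ] H) (l : V →ₗ[ℂ] ℂ) {C : ℝ}
    (hC : 0 ≤ C) (h : ∀ v, ‖l v‖ ≤ C * ‖T v‖) :
    ∃ g : H, ‖g‖ ≤ C ∧ ∀ v, l v = ⟪g, T v⟫_ℂ := by
  have hker : LinearMap.ker T ≤ LinearMap.ker l := fun v hv => by
    have := h v
    rw [LinearMap.mem_ker.1 hv, norm_zero, mul_zero] at this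
    exact LinearMap.mem_ker.2 (norm_le_zero_iff.1 this)
  let φ0 : LinearMap.range T →ₗ[ℂ] ℂ :=
    ((LinearMap.ker T).liftQ l hker).comp T.quotKerEquivRange.symm.toLinearMap
  have hφ0 : ∀ v, φ0 ⟨T v, LinearMap.mem_range_self T v⟩ = l v := by
    intro v
    have : T.quotKerEquivRange.symm ⟨T v, LinearMap.mem_range_self T v⟩
        = (LinearMap.ker T).mkQ v := by
      rw [LinearEquiv.symm_apply_eq]
      rfl
    simp only [φ0, LinearMap.comp_apply, LinearEquiv.coe_coe, this]
    simp
  have hb : ∀ x, ‖φ0 x‖ ≤ C * ‖x‖ := by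
    rintro ⟨_, v, rfl⟩
    rw [hφ0]
    exact h v
  obtain ⟨φ, hφ, hφn⟩ := exists_extension_norm_eq (LinearMap.range T) (φ0.mkContinuous C hb)
  refine ⟨(InnerProductSpace.toDual ℂ H).symm φ, ?_, fun v => ?_⟩
  · rw [LinearIsometryEquiv.norm_map, hφn]
    exact LinearMap.mkContinuous_norm_le _ hC _
  · rw [InnerProductSpace.toDual_symm_apply, ← hφ0 v]
    exact (hφ ⟨T v, LinearMap.mem_range_self T v⟩).symm

/-- Tuples of test functions. -/
def testTuples (Ω : Set (Fin n → ℂ)) : Submodule ℂ (Fin n → (Fin n → ℂ) → ℂ) where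
  carrier := {q | ∀ j, IsTestFun n (q j) Ω}
  zero_mem' := fun j => ⟨contDiff_const, HasCompactSupport.zero, by
    rw [Pi.zero_apply, tsupport_zero]; exact empty_subset _⟩
  add_mem' := fun {a b} ha hb j => ⟨(ha j).1.add (hb j).1, (ha j).2.1.add (hb j).2.1,
    (tsupport_add (a j) (b j)).trans (union_subset (ha j).2.2 (hb j).2.2)⟩
  smul_mem' := fun c a ha j => ⟨(ha j).1.const_smul c, (ha j).2.1.smul_left (f := fun _ => c),
    (tsupport_smul_subset_right (fun _ => c) (a j)).trans (ha j).2.2⟩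

lemma norm_sq_toLp {μ : Measure (Fin n → ℂ)} {f : (Fin n → ℂ) → ℂ} (hf : MemLp f 2 μ) :
    ‖hf.toLp f‖ ^ 2 = ∫ z, ‖f z‖ ^ 2 ∂μ := by
  have h : ((‖hf.toLp f‖ ^ 2 : ℝ) : ℂ) = ((∫ z, ‖f z‖ ^ 2 ∂μ : ℝ) : ℂ) := by
    have h0 := inner_self_eq_norm_sq_to_K (𝕜 := ℂ) (hf.toLp f)
    rw [ofReal_pow, ← RCLike.ofReal_eq_complex_ofReal, ← h0, L2.inner_def]
    refine Eq.trans ?_ integral_complex_ofReal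
    refine integral_congr_ae ?_
    filter_upwards [hf.coeFn_toLp] with z hz
    rw [hz, RCLike.inner_apply, mul_conj']
    push_cast
    rfl
  exact_mod_cast h

/-- Solution of the `∂̄`-equation with an estimate vanishing to high order at `p`, phrased as the
existence of a holomorphic correction of `β`. -/
theorem exists_correction {Ω : Set (Fin n → ℂ)} (hΩ : IsOpen Ω) (hb : Bornology.IsBounded Ω)
    (hpsc : PseudoconvexExh n Ω) {β : (Fin n → ℂ) → ℂ} (hβ : ContDiffOn ℝ (⊤ : ℕ∞) β Ω)
    (hβ2 : MemLp β 2 (volume.restrict Ω))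
    (hα : ∀ j, MemLp (dzb j β) 2 (volume.restrict Ω)) {p : Fin n → ℂ} {ρ : ℝ} (hρ : 0 < ρ)
    (hρα : ∀ z ∈ Ω, dsq p z < ρ → ∀ j, dzb j β z = 0) (κ : ℕ) :
    ∃ F g : (Fin n → ℂ) → ℂ, DifferentiableOn ℂ F Ω ∧ MemLp g 2 (volume.restrict Ω) ∧
      (∫ z in Ω, ‖g z‖ ^ 2) ≤
        2 * Real.exp 1 * (ρ ^ (2 * κ))⁻¹ * ∫ z in Ω, ∑ j, ‖dzb j β z‖ ^ 2 ∧
      ∀ᵐ z ∂(volume.restrict Ω),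
        F z = β z + g z * ((Real.exp (dsq 0 z / 2) * dsq p z ^ κ : ℝ) : ℂ) := by
  set μ := (volume : Measure (Fin n → ℂ)).restrict Ω with hμ
  set w : (Fin n → ℂ) → ℝ := fun z => Real.exp (dsq 0 z / 2) * dsq p z ^ κ with hw
  have hwc : Continuous w := by
    have h0 := (contDiff_dsq (0 : Fin n → ℂ)).continuous
    have h1 := (contDiff_dsq p).continuous
    fun_prop
  have hw0 : ∀ z, 0 ≤ w z := fun z => mul_nonneg (Real.exp_pos _).le (pow_nonneg (dsq_nonneg p z) _)
  have hwC : Continuous fun z => (w z : ℂ) := continuous_ofReal.comp hwc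
  set A := 2 * Real.exp 1 * (ρ ^ (2 * κ))⁻¹ * ∫ z in Ω, ∑ j, ‖dzb j β z‖ ^ 2 with hA
  have hA0 : 0 ≤ A := mul_nonneg (by positivity)
    (integral_nonneg fun z => Finset.sum_nonneg fun j _ => by positivity)
  have htest : ∀ (q : testTuples Ω) j, IsTestFun n (q.1 j) Ω := fun q => q.2
  have hmem : ∀ q : testTuples Ω, MemLp (fun z => (w z : ℂ) * ∑ j, dzb j (q.1 j) z) 2 μ :=
    fun q => memLp_test_mul hΩ hwC.continuousOn (isTestFun_sum_dzb (htest q))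
  have hdiff : ∀ (q : testTuples Ω) j z, DifferentiableAt ℝ (q.1 j) z := fun q j z =>
    (htest q j).1.differentiable (by simp) z
  let T : testTuples Ω →ₗ[ℂ] Lp ℂ 2 μ :=
    { toFun := fun q => (hmem q).toLp _
      map_add' := fun a b => by
        rw [← MemLp.toLp_add]
        refine MemLp.toLp_congr _ _ (.of_forall fun z => ?_)
        have : ∀ j, dzb j ((a + b).1 j) z = dzb j (a.1 j) z + dzb j (b.1 j) z := fun j =>
          wd_add (hdiff a j z) (hdiff b j z)
        simp only [Pi.add_apply, this, Finset.sum_add_distrib, mul_add]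
      map_smul' := fun c a => by
        rw [RingHom.id_apply, ← MemLp.toLp_const_smul]
        refine MemLp.toLp_congr _ _ (.of_forall fun z => ?_)
        have : ∀ j, dzb j ((c • a).1 j) z = c * dzb j (a.1 j) z := fun j =>
          wd_const_mul c (hdiff a j z)
        simp only [Pi.smul_apply, smul_eq_mul, this, ← Finset.mul_sum]
        ring }
  have hint : ∀ (q : testTuples Ω) j, Integrable fun z => dzb j β z * q.1 j z := fun q j =>
    integrable_mul_of_tsupport hΩ (contDiffOn_wd hΩ hβ).continuousOn (htest q j).1.continuous
      (htest q j).2.1 (htest q j).2.2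
  let l : testTuples Ω →ₗ[ℂ] ℂ :=
    { toFun := fun q => ∑ j, ∫ z, dzb j β z * q.1 j z
      map_add' := fun a b => by
        rw [← Finset.sum_add_distrib]
        refine Finset.sum_congr rfl fun j _ => ?_
        rw [← integral_add (hint a j) (hint b j)]
        refine integral_congr_ae (.of_forall fun z => ?_)
        exact mul_add _ _ _
      map_smul' := fun c a => by
        rw [RingHom.id_apply, smul_eq_mul, Finset.mul_sum]
        refine Finset.sum_congr rfl fun j _ => ?_
        rw [← integral_const_mul]
        refine integral_congr_ae (.of_forall fun z => ?_)
        exact mul_left_comm _ _ _ }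
  have hTn : ∀ q, ‖T q‖ ^ 2 = ∫ z, ‖∑ j, dzb j (q.1 j) z‖ ^ 2 *
      (Real.exp (dsq 0 z) * dsq p z ^ (2 * κ)) := by
    intro q
    refine (norm_sq_toLp (hmem q)).trans ?_
    have h0 : ∀ z, ‖(w z : ℂ) * ∑ j, dzb j (q.1 j) z‖ ^ 2 = ‖∑ j, dzb j (q.1 j) z‖ ^ 2 *
        (Real.exp (dsq 0 z) * dsq p z ^ (2 * κ)) := by
      intro z
      rw [norm_mul, norm_real, Real.norm_of_nonneg (hw0 z), mul_pow, hw, mul_pow, ← Real.exp_nat_mul,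
        ← pow_mul, mul_comm κ 2, mul_comm]
      congr 3
      push_cast
      ring_nf
    simp only [h0]
    refine setIntegral_eq_integral_of_forall_compl_eq_zero fun z hz => ?_
    rw [image_eq_zero_of_notMem_tsupport (f := fun z => ∑ j, dzb j (q.1 j) z)
      fun h => hz ((isTestFun_sum_dzb (htest q)).2.2 h)]
    simp
  obtain ⟨g0, hg0, hg⟩ := exists_riesz_of_le T l (Real.sqrt_nonneg A) (fun q => by
    have h := test_estimate hΩ hb hpsc hβ hα hρ hρα (2 * κ) (htest q)
    rw [← hTn q] at h
    have h2 : ‖l q‖ ^ 2 ≤ (√A * ‖T q‖) ^ 2 := by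
      rw [mul_pow, Real.sq_sqrt hA0]
      exact h
    exact le_of_sq_le_sq h2 (by positivity))
  set g : (Fin n → ℂ) → ℂ := fun z => starRingEnd ℂ (g0 z) with hgd
  have hgm : MemLp g 2 μ := (Lp.memLp g0).star
  have hgn : (∫ z in Ω, ‖g z‖ ^ 2) ≤ A := by
    have h := norm_sq_toLp (Lp.memLp g0)
    rw [Lp.toLp_coeFn] at h
    have h1 : (∫ z in Ω, ‖g z‖ ^ 2) = ‖g0‖ ^ 2 := by
      rw [h]
      simp only [hgd, RCLike.norm_conj]
      rfl
    rw [h1, ← Real.sq_sqrt hA0]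
    exact pow_le_pow_left₀ (norm_nonneg _) hg0 2
  have hw2 : MemLp (fun z => g z * w z) 2 μ := by
    obtain ⟨M, hM⟩ := hb.isCompact_closure.exists_bound_of_continuousOn hwC.continuousOn
    refine MemLp.of_le_mul (c := M) hgm
      (hgm.1.mul hwC.aestronglyMeasurable) ?_
    refine (ae_restrict_iff' hΩ.measurableSet).2 (.of_forall fun z hz => ?_)
    rw [norm_mul, mul_comm]
    exact mul_le_mul_of_nonneg_right (hM z (subset_closure hz)) (norm_nonneg _)
  have hweak : ∀ j ψ, IsTestFun n ψ Ω →
      ∫ z, Ω.indicator (fun z => β z + g z * w z) z * dzb j ψ z = 0 := by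
    intro j ψ hψ
    have hqt : ∀ i, IsTestFun n ((Pi.single j ψ : Fin n → (Fin n → ℂ) → ℂ) i) Ω := by
      intro i
      rcases eq_or_ne i j with rfl | h
      · rwa [Pi.single_eq_same]
      · rw [Pi.single_eq_of_ne h]
        exact (testTuples Ω).zero_mem i
    let q : testTuples Ω := ⟨Pi.single j ψ, hqt⟩
    have hz0 : ∀ i z, i ≠ j → dzb i (q.1 i) z = 0 := by
      intro i z h
      have : q.1 i = fun _ => 0 := Pi.single_eq_of_ne h _
      simp [wd, this]
    have hqj : q.1 j = ψ := Pi.single_eq_same _ _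
    have hl : l q = ∫ z, dzb j β z * ψ z := by
      change ∑ i, ∫ z, dzb i β z * q.1 i z = _
      rw [Finset.sum_eq_single j, hqj]
      · intro i _ h
        have : q.1 i = 0 := Pi.single_eq_of_ne h _
        simp [this]
      · simp
    have hT : l q = ∫ z in Ω, (g z * w z) * dzb j ψ z := by
      rw [hg, L2.inner_def]
      refine integral_congr_ae ?_
      filter_upwards [(hmem q).coeFn_toLp] with z hz
      have h1 : (T q) z = w z * dzb j ψ z := by
        refine hz.trans ?_
        rw [Finset.sum_eq_single j (fun i _ h => hz0 i z h) (by simp), hqj]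
      rw [h1, RCLike.inner_apply]
      simp only [hgd]
      ring
    have hψ' := isTestFun_wd (c := I) (j := j) hψ
    have h1 : ∫ z in Ω, β z * dzb j ψ z = -∫ z, dzb j β z * ψ z := by
      rw [setIntegral_eq_of_test hψ', integral_mul_wd hΩ hβ hψ]
    have hψ2 : MemLp (dzb j ψ) 2 μ :=
      (hψ'.1.continuous.memLp_of_hasCompactSupport hψ'.2.1).restrict Ω
    have i1 : IntegrableOn (fun z => β z * dzb j ψ z) Ω :=
      MemLp.integrable_mul (p := 2) (q := 2) hβ2 hψ2
    have i2 : IntegrableOn (fun z => (g z * w z) * dzb j ψ z) Ω :=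
      MemLp.integrable_mul (p := 2) (q := 2) hw2 hψ2
    have h2 : ∀ z, Ω.indicator (fun z => β z + g z * w z) z * dzb j ψ z =
        Ω.indicator (fun z => β z * dzb j ψ z + (g z * w z) * dzb j ψ z) z := by
      intro z
      by_cases hz : z ∈ Ω
      · rw [indicator_of_mem hz, indicator_of_mem hz, add_mul]
      · rw [indicator_of_notMem hz, indicator_of_notMem hz, zero_mul]
    simp only [h2]
    rw [integral_indicator hΩ.measurableSet, integral_add i1 i2, h1, ← hT, hl, neg_add_cancel]
  obtain ⟨F, hF, hFe⟩ := exists_holomorphic_of_weak hΩ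
    (h := Ω.indicator (fun z => β z + g z * w z))
    ((memLp_indicator_iff_restrict hΩ.measurableSet).2 (hβ2.add hw2))
    (HasCompactSupport.of_support_subset_isCompact hb.isCompact_closure
      ((support_indicator_subset).trans subset_closure)) hweak
  refine ⟨F, g, hF, hgm, hgn, ?_⟩
  rw [hμ, ae_restrict_iff' hΩ.measurableSet]
  filter_upwards [hFe] with z hz hzΩ
  rw [← hz hzΩ, indicator_of_mem hzΩ]

end Correction

section Vanishing

lemma exists_norm_le_pow_four {p : Fin n → ℂ} {r B : ℝ} {G g : (Fin n → ℂ) → ℂ}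
    {w : (Fin n → ℂ) → ℝ} (hG : DifferentiableOn ℂ G (Metric.ball p r))
    (hg : IntegrableOn g (Metric.ball p r))
    (hw : ∀ z ∈ Metric.ball p r, ‖w z‖ ≤ B * ‖z - p‖ ^ (2 * n + 4)) (hB : 0 ≤ B)
    (he : ∀ᵐ z ∂(volume.restrict (Metric.ball p r)), G z = g z * w z) :
    ∃ C, ∀ z ∈ Metric.ball p (r / 2), z ≠ p → ‖G z‖ ≤ C * ‖z - p‖ ^ 4 := by
  obtain ⟨K, hK0, hK⟩ := exists_bump_le (n := n)
  refine ⟨K * B * 2 ^ (2 * n + 4) * ∫ t in Metric.ball p r, ‖g t‖, fun z hz hzp => ?_⟩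
  set δ := ‖z - p‖ with hδd
  have hδ : 0 < δ := norm_pos_iff.2 (sub_ne_zero.2 hzp)
  have hzr : δ < r / 2 := by rwa [Metric.mem_ball, dist_eq_norm] at hz
  have hsub : Metric.closedBall z δ ⊆ Metric.ball p r :=
    (Metric.closedBall_subset_closedBall' (ε₂ := 2 * δ)
      (by rw [dist_eq_norm, ← hδd]; linarith)).trans (Metric.closedBall_subset_ball (by linarith))
  rw [← moll_eq_self_of_differentiableOn hδ hG hsub, moll]
  set c := K * (δ ^ (2 * n))⁻¹ * (B * (2 * δ) ^ (2 * n + 4)) with hc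
  have hi : Integrable ((Metric.ball p r).indicator fun t => c * ‖g t‖) :=
    (integrable_indicator_iff measurableSet_ball).2 (hg.norm.const_mul c)
  refine (norm_integral_le_of_norm_le hi ?_).trans ?_
  · rw [ae_restrict_iff' measurableSet_ball] at he
    filter_upwards [he] with t ht
    by_cases h : bump δ (z - t) = 0
    · rw [h, zero_smul, norm_zero]
      exact indicator_nonneg (fun _ _ => by positivity) _
    · have hlt := norm_lt_of_bump_ne hδ h
      have htb : t ∈ Metric.ball p r := hsub (by
        rw [Metric.mem_closedBall, dist_comm, dist_eq_norm]; exact hlt.le)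
      have htp : ‖t - p‖ ≤ 2 * δ := by
        have := norm_sub_le (z - p) (z - t)
        rw [sub_sub_sub_cancel_left] at this
        linarith
      rw [indicator_of_mem htb, ht htb, norm_smul, norm_mul, norm_real,
        Real.norm_of_nonneg (bump_nonneg hδ _)]
      have h1 : ‖w t‖ ≤ B * (2 * δ) ^ (2 * n + 4) := (hw t htb).trans (by gcongr)
      calc bump δ (z - t) * (‖g t‖ * ‖w t‖)
          ≤ (K * (δ ^ (2 * n))⁻¹) * (‖g t‖ * (B * (2 * δ) ^ (2 * n + 4))) := by
            have := hK δ hδ (z - t)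
            gcongr
        _ = c * ‖g t‖ := by rw [hc]; ring
  · rw [integral_indicator measurableSet_ball, integral_const_mul]
    refine le_of_eq ?_
    rw [hc, mul_pow, pow_add δ]
    field_simp

lemma hasFDerivAt_zero_of_norm_le_pow {E F : Type*} [NormedAddCommGroup E] [NormedSpace ℂ E]
    [NormedAddCommGroup F] [NormedSpace ℂ F] {h : E → F} {p : E} {r C : ℝ} {m : ℕ} (hr : 0 < r)
    (hm : 1 < m) (hh : ∀ z ∈ Metric.ball p r, ‖h z‖ ≤ C * ‖z - p‖ ^ m) :
    HasFDerivAt h (0 : E →L[ℂ] F) p := by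
  refine Asymptotics.IsBigO.hasFDerivAt (n := m) (Asymptotics.IsBigO.of_bound C ?_) hm
  filter_upwards [Metric.ball_mem_nhds p hr] with z hz
  rw [norm_pow, norm_norm]
  exact hh z hz

lemma norm_fderiv_apply_le {G : (Fin n → ℂ) → ℂ} {p : Fin n → ℂ} {r C : ℝ}
    (hG : DifferentiableOn ℂ G (Metric.ball p r))
    (hC : ∀ z ∈ Metric.ball p r, ‖G z‖ ≤ C * ‖z - p‖ ^ 4) (hC0 : 0 ≤ C)
    {v : Fin n → ℂ} (hv : ‖v‖ ≤ 1) {z : Fin n → ℂ} (hz : z ∈ Metric.ball p (r / 2)) (hzp : z ≠ p) :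
    ‖fderiv ℂ G z v‖ ≤ (16 * C) * ‖z - p‖ ^ 3 := by
  set δ := ‖z - p‖ with hδd
  have hδ : 0 < δ := norm_pos_iff.2 (sub_ne_zero.2 hzp)
  have hzr : δ < r / 2 := by rwa [Metric.mem_ball, dist_eq_norm] at hz
  have hbd : ∀ t ∈ Metric.closedBall (0 : ℂ) δ, ‖z + t • v - p‖ ≤ 2 * δ := by
    intro t ht
    have h1 : z + t • v - p = (z - p) + t • v := by abel
    rw [mem_closedBall_zero_iff] at ht
    rw [h1]
    refine (norm_add_le _ _).trans ?_
    rw [norm_smul]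
    nlinarith [norm_nonneg t, norm_nonneg v]
  have hmem : ∀ t ∈ Metric.closedBall (0 : ℂ) δ, z + t • v ∈ Metric.ball p r := by
    intro t ht
    rw [Metric.mem_ball, dist_eq_norm]
    linarith [hbd t ht]
  have hline : ∀ t : ℂ, HasDerivAt (fun t : ℂ => z + t • v) v t := fun t => by
    simpa using ((hasDerivAt_id t).smul_const v).const_add z
  have hd : ∀ t ∈ Metric.closedBall (0 : ℂ) δ,
      HasDerivAt (fun t : ℂ => G (z + t • v)) (fderiv ℂ G (z + t • v) v) t := fun t ht =>
    ((hG.differentiableAt (Metric.isOpen_ball.mem_nhds (hmem t ht))).hasFDerivAt).comp_hasDerivAt t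
      (hline t)
  have h0 := (hd 0 (Metric.mem_closedBall_self hδ.le)).deriv
  rw [zero_smul, add_zero] at h0
  rw [← h0]
  refine (norm_deriv_le_of_forall_mem_sphere_norm_le (C := C * (2 * δ) ^ 4) hδ ?_ ?_).trans ?_
  · refine DifferentiableOn.diffContOnCl_ball (U := Metric.closedBall 0 δ) ?_ subset_rfl
    exact fun t ht => (hd t ht).differentiableAt.differentiableWithinAt
  · intro t ht
    have ht' := Metric.sphere_subset_closedBall ht
    refine (hC _ (hmem t ht')).trans ?_
    have := hbd t ht'
    gcongr
  · refine le_of_eq ?_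
    field_simp
    ring

/-- A holomorphic function which is `O(‖z - p‖⁴)` has vanishing 2-jet at `p`. -/
lemma two_jet_eq_zero (hn : 0 < n) {G : (Fin n → ℂ) → ℂ} {p : Fin n → ℂ} {r C : ℝ} (hr : 0 < r)
    (hG : DifferentiableOn ℂ G (Metric.ball p r))
    (hC : ∀ z ∈ Metric.ball p r, z ≠ p → ‖G z‖ ≤ C * ‖z - p‖ ^ 4) :
    G p = 0 ∧ fderiv ℂ G p = 0 ∧ ∀ v : Fin n → ℂ, ‖v‖ ≤ 1 →
      HasFDerivAt (fun z => fderiv ℂ G z v) (0 : (Fin n → ℂ) →L[ℂ] ℂ) p := by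
  have hp := Metric.mem_ball_self (x := p) hr
  have hGp : G p = 0 := by
    have : Nonempty (Fin n) := ⟨⟨0, hn⟩⟩
    have : (𝓝[≠] p).NeBot := Module.punctured_nhds_neBot ℂ _ p
    have hcont : Tendsto G (𝓝[≠] p) (𝓝 (G p)) :=
      (hG.continuousOn.continuousAt (Metric.isOpen_ball.mem_nhds hp)).tendsto.mono_left
        nhdsWithin_le_nhds
    have hz : Tendsto (fun z => C * ‖z - p‖ ^ 4) (𝓝[≠] p) (𝓝 0) := by
      have : Continuous fun z : Fin n → ℂ => C * ‖z - p‖ ^ 4 := by fun_prop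
      simpa using (this.tendsto p).mono_left nhdsWithin_le_nhds
    refine tendsto_nhds_unique hcont (squeeze_zero_norm' ?_ hz)
    filter_upwards [self_mem_nhdsWithin, nhdsWithin_le_nhds (Metric.ball_mem_nhds p hr)]
      with z h1 h2 using hC z h2 h1
  have hC' : ∀ z ∈ Metric.ball p r, ‖G z‖ ≤ |C| * ‖z - p‖ ^ 4 := by
    intro z hz
    rcases eq_or_ne z p with rfl | h
    · simp [hGp]
    · exact (hC z hz h).trans (by gcongr; exact le_abs_self C)
  have hf : fderiv ℂ G p = 0 := (hasFDerivAt_zero_of_norm_le_pow hr (by norm_num) hC').fderiv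
  refine ⟨hGp, hf, fun v hv => ?_⟩
  refine hasFDerivAt_zero_of_norm_le_pow (half_pos hr) (m := 3) (C := 16 * |C|) (by norm_num) ?_
  intro z hz
  rcases eq_or_ne z p with rfl | h
  · simp [hf]
  · exact norm_fderiv_apply_le hG hC' (abs_nonneg C) hv hz h

end Vanishing

section Extension

lemma fderiv_add_of_hasFDerivAt_zero {E F : Type*} [NormedAddCommGroup E] [NormedSpace ℂ E]
    [NormedAddCommGroup F] [NormedSpace ℂ F] {a b : E → F} {p : E}
    (hb : HasFDerivAt b (0 : E →L[ℂ] F) p) : fderiv ℂ (fun z => a z + b z) p = fderiv ℂ a p := by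
  by_cases ha : DifferentiableAt ℂ a p
  · rw [fderiv_fun_add ha hb.differentiableAt, hb.fderiv, add_zero]
  · have h : ¬DifferentiableAt ℂ (fun z => a z + b z) p := fun h => ha (by
      have h' : DifferentiableAt ℂ (fun z => a z + b z - b z) p := h.sub hb.differentiableAt
      simpa using h')
    rw [fderiv_zero_of_not_differentiableAt ha, fderiv_zero_of_not_differentiableAt h]

/-- Holomorphic functions agreeing to fourth order at `p` have the same 2-jet at `p`. -/
lemma two_jet_congr (hn : 0 < n) {f F : (Fin n → ℂ) → ℂ} {p : Fin n → ℂ} {r C : ℝ} (hr : 0 < r)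
    (hf : DifferentiableOn ℂ f (Metric.ball p r)) (hF : DifferentiableOn ℂ F (Metric.ball p r))
    (hC : ∀ z ∈ Metric.ball p r, z ≠ p → ‖F z - f z‖ ≤ C * ‖z - p‖ ^ 4) :
    F p = f p ∧ fderiv ℂ F p = fderiv ℂ f p ∧ ∀ X Y, holDeriv2 n F p X Y = holDeriv2 n f p X Y := by
  have hd : ∀ z ∈ Metric.ball p r, fderiv ℂ (fun z => F z - f z) z = fderiv ℂ F z - fderiv ℂ f z :=
    fun z hz => fderiv_fun_sub (hF.differentiableAt (Metric.isOpen_ball.mem_nhds hz))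
      (hf.differentiableAt (Metric.isOpen_ball.mem_nhds hz))
  obtain ⟨h0, h1, h2⟩ := two_jet_eq_zero hn hr (hF.sub hf) hC
  refine ⟨sub_eq_zero.1 h0, sub_eq_zero.1 ((hd p (Metric.mem_ball_self hr)).symm.trans h1),
    fun X Y => ?_⟩
  simp only [holDeriv2]
  refine Finset.sum_congr rfl fun j _ => Finset.sum_congr rfl fun k _ => ?_
  have hk : ‖(Pi.single k 1 : Fin n → ℂ)‖ ≤ 1 := by
    rw [Pi.norm_single, norm_one]
  rw [← fderiv_add_of_hasFDerivAt_zero (a := fun z => fderiv ℂ f z (Pi.single k 1)) (h2 _ hk)]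
  congr 2
  refine Filter.EventuallyEq.fderiv_eq ?_
  filter_upwards [Metric.ball_mem_nhds p hr] with z hz
  have h3 : fderiv ℂ (F - f) z = fderiv ℂ F z - fderiv ℂ f z := hd z hz
  rw [h3, sub_apply]
  ring

lemma dsq_le (p z : Fin n → ℂ) : dsq p z ≤ n * ‖z - p‖ ^ 2 := by
  rw [dsq]
  refine (Finset.sum_le_card_nsmul _ _ (‖z - p‖ ^ 2) fun i _ => ?_).trans (by simp)
  exact pow_le_pow_left₀ (norm_nonneg _) (norm_le_pi_norm (z - p) i) 2

lemma norm_sq_le_dsq (p z : Fin n → ℂ) : ‖z - p‖ ^ 2 ≤ dsq p z := by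
  have h : ‖z - p‖ ≤ √(dsq p z) := by
    refine (pi_norm_le_iff_of_nonneg (Real.sqrt_nonneg _)).2 fun i => Real.le_sqrt_of_sq_le ?_
    exact Finset.single_le_sum (f := fun i => ‖z i - p i‖ ^ 2) (fun i _ => by positivity)
      (Finset.mem_univ i)
  calc ‖z - p‖ ^ 2 ≤ √(dsq p z) ^ 2 := by gcongr
    _ = dsq p z := Real.sq_sqrt (dsq_nonneg p z)

lemma memLp_bdd_mul {μ : Measure (Fin n → ℂ)} {a h : (Fin n → ℂ) → ℂ} (ha : Continuous a) {M : ℝ}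
    (hM : ∀ z, ‖a z‖ ≤ M) (hh : MemLp h 2 μ) : MemLp (fun z => a z * h z) 2 μ := by
  refine MemLp.of_le_mul (c := M) hh (ha.aestronglyMeasurable.mul hh.1) (.of_forall fun z => ?_)
  rw [norm_mul]
  exact mul_le_mul_of_nonneg_right (hM z) (norm_nonneg _)

lemma memLp_of_inBergman {D : Set (Fin n → ℂ)} (hD : IsOpen D) {f : (Fin n → ℂ) → ℂ}
    (hf : InBergman n D f) : MemLp f 2 (volume.restrict D) :=
  (memLp_two_iff_integrable_sq_norm
    (hf.1.continuousOn.aestronglyMeasurable hD.measurableSet)).2 hf.2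

lemma exists_weight_bound {Ω : Set (Fin n → ℂ)} (hb : Bornology.IsBounded Ω) (κ : ℕ) :
    ∃ M, 0 ≤ M ∧ ∀ p ∈ Ω, ∀ z ∈ Ω, Real.exp (dsq 0 z / 2) * dsq p z ^ κ ≤ M := by
  have hc : Continuous fun x : (Fin n → ℂ) × (Fin n → ℂ) =>
      Real.exp (dsq 0 x.2 / 2) * dsq x.1 x.2 ^ κ := by
    simp only [dsq]
    fun_prop
  obtain ⟨M, hM⟩ := (hb.isCompact_closure.prod hb.isCompact_closure).exists_bound_of_continuousOn
    hc.continuousOn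
  refine ⟨|M|, abs_nonneg M, fun p hp z hz => ?_⟩
  exact (le_abs_self _).trans ((hM (p, z) ⟨subset_closure hp, subset_closure hz⟩).trans
    (le_abs_self M))

/-- Holomorphic functions near `p` extend to `Ω`, modulo third order terms, with uniform bounds. -/
theorem exists_extension {Ω : Set (Fin n → ℂ)} (hn : 0 < n) (hΩ : IsOpen Ω)
    (hb : Bornology.IsBounded Ω) (hpsc : PseudoconvexExh n Ω) {W U : Set (Fin n → ℂ)}
    (hUo : IsOpen U) (hWU : closure W ⊆ U) (hWc : IsCompact (closure W)) :
    ∃ C > (0 : ℝ), ∀ p ∈ W ∩ Ω, ∀ f, InBergman n (U ∩ Ω) f →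
      ∃ F, InBergman n Ω F ∧ F p = f p ∧ fderiv ℂ F p = fderiv ℂ f p ∧
        (∀ X Y, holDeriv2 n F p X Y = holDeriv2 n f p X Y) ∧
        l2sq n Ω F ≤ C * l2sq n (U ∩ Ω) f := by
  obtain ⟨χ, hχ, hχc, hχU, hχ1, hχ01⟩ := exists_cutoff hWc hUo hWU
  obtain ⟨V, hVo, hWV, hV⟩ := mem_nhdsSet_iff_exists.1 hχ1
  obtain ⟨ε, hε, hεV⟩ := hWc.exists_thickening_subset_open hVo hWV
  have hχs : ∀ z, χ z ≠ 0 → z ∈ U := fun z hz => hχU (subset_tsupport _ hz)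
  have hVU : V ⊆ U := fun z hz => hχs z (by
    have : χ z = 1 := hV hz
    rw [this]; exact one_ne_zero)
  have hball : ∀ p ∈ W, ∀ z, ‖z - p‖ < ε → z ∈ V := fun p hp z hz =>
    hεV (Metric.mem_thickening_iff.2 ⟨p, subset_closure hp, by rwa [dist_eq_norm]⟩)
  set X : (Fin n → ℂ) → ℂ := fun z => (χ z : ℂ) with hXd
  have hX : ContDiff ℝ (⊤ : ℕ∞) X := contDiff_ofReal hχ
  have hXU : tsupport X ⊆ U := (tsupport_ofReal_subset χ).trans hχU
  have hXc : HasCompactSupport X := hχc.of_isClosed_subset (isClosed_tsupport X)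
    (tsupport_ofReal_subset χ)
  have hX1 : ∀ z, ‖X z‖ ≤ 1 := fun z => by
    rw [hXd, norm_real, Real.norm_of_nonneg (hχ01 z).1]
    exact (hχ01 z).2
  have hXd0 : ∀ j z, z ∉ U → dzb j X z = 0 := fun j z hz =>
    image_eq_zero_of_notMem_tsupport (f := dzb j X) fun h => hz (hXU (tsupport_wd_subset h))
  have hdc : ∀ j, Continuous (dzb j X) := fun j => (contDiff_wd hX).continuous
  obtain ⟨K, hK⟩ : ∃ K, ∀ j z, ‖dzb j X z‖ ≤ K := by
    choose K hK using fun j => (hdc j).bounded_above_of_compact_support (hasCompactSupport_wd hXc)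
    exact ⟨∑ j, |K j|, fun j z => (hK j z).trans ((le_abs_self _).trans
      (Finset.single_le_sum (f := fun j => |K j|) (fun j _ => abs_nonneg _) (Finset.mem_univ j)))⟩
  set κ := n + 2 with hκ
  obtain ⟨M, hM0, hM⟩ := exists_weight_bound hb κ
  set ρ := ε ^ 2 with hρd
  have hρ : 0 < ρ := by positivity
  set A := 2 * Real.exp 1 * (ρ ^ (2 * κ))⁻¹ with hA
  have hA0 : 0 < A := by positivity
  refine ⟨2 + 2 * M ^ 2 * (A * (n * K ^ 2)), by positivity, ?_⟩
  rintro p ⟨hpW, hpΩ⟩ f hf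
  have hUΩ : IsOpen (U ∩ Ω) := hUo.inter hΩ
  set μ := (volume : Measure (Fin n → ℂ)).restrict Ω with hμ
  set h := U.indicator f with hh
  have hhm : MemLp h 2 μ := by
    rw [hh, memLp_indicator_iff_restrict hUo.measurableSet, hμ,
      Measure.restrict_restrict hUo.measurableSet]
    exact memLp_of_inBergman hUΩ hf
  have hhn : ∫ z in Ω, ‖h z‖ ^ 2 = l2sq n (U ∩ Ω) f := by
    have : ∀ z, ‖h z‖ ^ 2 = U.indicator (fun z => ‖f z‖ ^ 2) z := fun z => by
      by_cases hz : z ∈ U <;> simp [hh, hz]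
    simp only [this]
    rw [setIntegral_indicator hUo.measurableSet, inter_comm, l2sq]
  have hhi : Integrable (fun z => ‖h z‖ ^ 2) μ := hhm.integrable_norm_pow (by norm_num)
  have hfd : ∀ z ∈ U ∩ Ω, DifferentiableAt ℂ f z := fun z hz =>
    hf.1.differentiableAt (hUΩ.mem_nhds hz)
  set β : (Fin n → ℂ) → ℂ := fun z => X z * h z with hβd
  have hβU : ∀ z ∈ U, β =ᶠ[𝓝 z] fun z => X z * f z := fun z hz => by
    filter_upwards [hUo.mem_nhds hz] with y hy
    simp only [hβd, hh, indicator_of_mem hy]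
  have hβ0 : ∀ z, z ∉ U → β =ᶠ[𝓝 z] fun _ => 0 := fun z hz => by
    have : z ∉ tsupport X := fun hz' => hz (hXU hz')
    filter_upwards [notMem_tsupport_iff_eventuallyEq.1 this] with y hy
    simp only [hβd, hy, Pi.zero_apply, zero_mul]
  have hβ : ContDiffOn ℝ (⊤ : ℕ∞) β Ω := by
    intro z hz
    refine ContDiffAt.contDiffWithinAt ?_
    by_cases hzU : z ∈ U
    · refine ContDiffAt.congr_of_eventuallyEq ?_ (hβU z hzU)
      exact hX.contDiffAt.mul ((contDiffOn_of_differentiableOn hUΩ hf.1).contDiffAt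
        (hUΩ.mem_nhds ⟨hzU, hz⟩))
    · exact contDiffAt_const.congr_of_eventuallyEq (hβ0 z hzU)
  have hdβ : ∀ j, ∀ z ∈ Ω, dzb j β z = dzb j X z * h z := by
    intro j z hz
    by_cases hzU : z ∈ U
    · have h1 := hfd z ⟨hzU, hz⟩
      have h2 : DifferentiableAt ℝ f z := h1.restrictScalars ℝ
      have e : dzb j β z = dzb j X z * f z + X z * dzb j f z :=
        (wd_congr (hβU z hzU)).trans (wd_mul (hX.differentiable (by simp) z) h2)
      rw [e, dzb_eq_zero h1, mul_zero, add_zero, hh, indicator_of_mem hzU]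
    · have e : dzb j β z = dzb j (fun _ => 0) z := wd_congr (hβ0 z hzU)
      rw [e, hXd0 j z hzU]
      simp [wd]
  have hβ2 : MemLp β 2 μ := memLp_bdd_mul hX.continuous hX1 hhm
  have hα : ∀ j, MemLp (dzb j β) 2 μ := fun j =>
    (memLp_bdd_mul (hdc j) (hK j) hhm).ae_eq <|
      (ae_restrict_iff' hΩ.measurableSet).2 (.of_forall fun z hz => (hdβ j z hz).symm)
  have hρα : ∀ z ∈ Ω, dsq p z < ρ → ∀ j, dzb j β z = 0 := by
    intro z hz hzρ j
    have hzV : z ∈ V := hball p hpW z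
      (lt_of_pow_lt_pow_left₀ 2 hε.le ((norm_sq_le_dsq p z).trans_lt hzρ))
    have : X =ᶠ[𝓝 z] fun _ => 1 := by
      filter_upwards [hVo.mem_nhds hzV] with y hy
      have : χ y = 1 := hV hy
      simp [hXd, this]
    have e : dzb j X z = dzb j (fun _ => 1) z := wd_congr this
    rw [hdβ j z hz, e]
    simp [wd]
  obtain ⟨F, g, hF, hg2, hgn, hFe⟩ := exists_correction hΩ hb hpsc hβ hβ2 hα hρ hρα κ
  set w : (Fin n → ℂ) → ℝ := fun z => Real.exp (dsq 0 z / 2) * dsq p z ^ κ with hw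
  have hw0 : ∀ z, 0 ≤ w z := fun z => mul_nonneg (Real.exp_pos _).le (pow_nonneg (dsq_nonneg p z) _)
  have hgi : Integrable (fun z => ‖g z‖ ^ 2) μ := hg2.integrable_norm_pow (by norm_num)
  have hgb : ∫ z in Ω, ‖g z‖ ^ 2 ≤ A * ((n * K ^ 2) * l2sq n (U ∩ Ω) f) := by
    refine hgn.trans (mul_le_mul_of_nonneg_left ?_ hA0.le)
    rw [← hhn, ← integral_const_mul]
    refine setIntegral_mono_on ?_ (hhi.const_mul _) hΩ.measurableSet fun z hz => ?_
    · exact integrable_finsetSum _ fun j _ => (hα j).integrable_norm_pow (by norm_num)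
    · refine (Finset.sum_le_card_nsmul _ _ (K ^ 2 * ‖h z‖ ^ 2) fun j _ => ?_).trans
        (by simp [mul_assoc])
      rw [hdβ j z hz, norm_mul, mul_pow]
      have := hK j z
      gcongr
  have hsq : ∀ᵐ z ∂μ, ‖F z‖ ^ 2 ≤ 2 * ‖h z‖ ^ 2 + 2 * M ^ 2 * ‖g z‖ ^ 2 := by
    filter_upwards [hFe, ae_restrict_mem hΩ.measurableSet] with z hz hzΩ
    have h1 : ‖F z‖ ≤ ‖h z‖ + M * ‖g z‖ := by
      rw [hz]
      refine (norm_add_le _ _).trans (add_le_add ?_ ?_)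
      · rw [hβd, norm_mul]
        exact mul_le_of_le_one_left (norm_nonneg _) (hX1 z)
      · rw [norm_mul, norm_real, Real.norm_of_nonneg (hw0 z), mul_comm]
        exact mul_le_mul_of_nonneg_right (hM p hpΩ z hzΩ) (norm_nonneg _)
    nlinarith [sq_nonneg (‖h z‖ - M * ‖g z‖), norm_nonneg (F z)]
  have hdom : Integrable (fun z => 2 * ‖h z‖ ^ 2 + 2 * M ^ 2 * ‖g z‖ ^ 2) μ :=
    (hhi.const_mul _).add (hgi.const_mul _)
  have hFi : Integrable (fun z => ‖F z‖ ^ 2) μ := by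
    refine hdom.mono' ?_ ?_
    · exact ((hF.continuousOn.aestronglyMeasurable hΩ.measurableSet).norm.pow 2)
    · filter_upwards [hsq] with z hz
      rwa [Real.norm_of_nonneg (by positivity)]
  have hjet : F p = f p ∧ fderiv ℂ F p = fderiv ℂ f p ∧
      ∀ X Y, holDeriv2 n F p X Y = holDeriv2 n f p X Y := by
    obtain ⟨r, hr, hrs⟩ := Metric.isOpen_iff.1 (hVo.inter hΩ) p
      ⟨hball p hpW p (by simpa using hε), hpΩ⟩
    have hrΩ : Metric.ball p r ⊆ Ω := hrs.trans inter_subset_right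
    have hrU : Metric.ball p r ⊆ U ∩ Ω := hrs.trans (inter_subset_inter_left _ hVU)
    obtain ⟨E, hE⟩ := hb.isCompact_closure.exists_bound_of_continuousOn
      (f := fun z : Fin n → ℂ => Real.exp (dsq 0 z / 2))
      (Real.continuous_exp.comp ((contDiff_dsq 0).continuous.div_const 2)).continuousOn
    have hE0 : 0 ≤ E := (norm_nonneg _).trans (hE p (subset_closure hpΩ))
    have hwb : ∀ z ∈ Metric.ball p r, ‖w z‖ ≤ (E * n ^ κ) * ‖z - p‖ ^ (2 * n + 4) := by
      intro z hz
      rw [hw, norm_mul, norm_pow, Real.norm_of_nonneg (dsq_nonneg p z), mul_assoc]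
      have h1 := hE z (subset_closure (hrΩ hz))
      have h2 : dsq p z ^ κ ≤ n ^ κ * ‖z - p‖ ^ (2 * n + 4) := by
        refine (pow_le_pow_left₀ (dsq_nonneg p z) (dsq_le p z) κ).trans_eq ?_
        rw [mul_pow, ← pow_mul]
        congr 2
      have h3 := pow_nonneg (dsq_nonneg p z) κ
      gcongr
    have hgi1 : IntegrableOn g (Metric.ball p r) := by
      have : IsFiniteMeasure ((volume : Measure (Fin n → ℂ)).restrict (Metric.ball p r)) :=
        ⟨by rw [Measure.restrict_apply_univ]; exact measure_ball_lt_top⟩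
      exact (hg2.mono_measure (Measure.restrict_mono_set _ hrΩ)).integrable (by norm_num)
    have hFd := hF.mono hrΩ
    have hfd' := hf.1.mono hrU
    have hGe : ∀ᵐ z ∂(volume.restrict (Metric.ball p r)), F z - f z = g z * w z := by
      filter_upwards [ae_restrict_of_ae_restrict_of_subset hrΩ hFe,
        ae_restrict_mem measurableSet_ball] with z hz hzb
      have hχz : χ z = 1 := hV (hrs hzb).1
      rw [hz, hβd, hXd, hh]
      simp only [indicator_of_mem (hrU hzb).1, hχz, ofReal_one, one_mul, add_sub_cancel_left]
      rfl
    obtain ⟨C, hC⟩ := exists_norm_le_pow_four (hFd.sub hfd') hgi1 hwb (by positivity) hGe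
    have hrr : Metric.ball p (r / 2) ⊆ Metric.ball p r := Metric.ball_subset_ball (by linarith)
    exact two_jet_congr hn (half_pos hr) (hfd'.mono hrr) (hFd.mono hrr) hC
  refine ⟨F, ⟨hF, hFi⟩, hjet.1, hjet.2.1, hjet.2.2, ?_⟩
  have hint := integral_mono_ae hFi hdom hsq
  rw [integral_add (hhi.const_mul _) (hgi.const_mul _), integral_const_mul, integral_const_mul,
    hhn] at hint
  have h2 := mul_le_mul_of_nonneg_left hgb (by positivity : 0 ≤ 2 * M ^ 2)
  rw [l2sq]
  linarith

end Extension

end DBar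

/-- Localization of the minimum integral `I²`: for a bounded pseudoconvex domain
`Ω ⊂ ℂⁿ`, `z₀ ∈ ∂Ω`, and open neighborhoods `W ⊂⊂ U` of `z₀`, there is `C₂ > 0` with
`I²_{U∩Ω}(p;X,Y) ≤ I²_Ω(p;X,Y) ≤ C₂ · I²_{U∩Ω}(p;X,Y)` for all `p ∈ W ∩ Ω` and
`X, Y ∈ ℂⁿ`. -/
theorem I2_localization
    {n : ℕ} (Ω : Set (Fin n → ℂ)) (hΩ : IsOpen Ω) (hb : Bornology.IsBounded Ω)
    (hconn : IsPreconnected Ω) (hpsc : PseudoconvexExh n Ω)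
    (z₀ : Fin n → ℂ) (hz₀ : z₀ ∈ frontier Ω)
    (W U : Set (Fin n → ℂ)) (hWo : IsOpen W) (hUo : IsOpen U)
    (hz₀W : z₀ ∈ W) (hWU : closure W ⊆ U) (hWc : IsCompact (closure W)) :
    ∃ C₂ > (0:ℝ), ∀ p ∈ W ∩ Ω, ∀ X Y : Fin n → ℂ,
      I2 n (U ∩ Ω) p X Y ≤ I2 n Ω p X Y ∧ I2 n Ω p X Y ≤ C₂ * I2 n (U ∩ Ω) p X Y := by
  have hn : 0 < n := by
    rcases Nat.eq_zero_or_pos n with rfl | hn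
    · have : frontier Ω = ∅ := by
        rcases Subsingleton.eq_empty_or_singleton (s := Ω) subsingleton_of_subsingleton with h | ⟨x, h⟩
        · rw [h, frontier_empty]
        · have : Ω = univ := by rw [h]; exact eq_univ_of_forall fun y => Subsingleton.elim _ _
          rw [this, frontier_univ]
      rw [this] at hz₀
      exact hz₀.elim
    · exact hn
  obtain ⟨C, hC, hext⟩ := DBar.exists_extension hn hΩ hb hpsc hUo hWU hWc
  refine ⟨C, hC, fun p hp X Y => ?_⟩
  set S : Set (Fin n → ℂ) → Set ℝ := fun D => {r | ∃ f, InBergman n D f ∧ f p = 0 ∧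
    fderiv ℂ f p = 0 ∧ holDeriv2 n f p X Y = 1 ∧ r = l2sq n D f} with hS
  have hbdd : ∀ D, BddBelow (S D) := fun D => ⟨0, by
    rintro r ⟨f, -, -, -, -, rfl⟩
    exact integral_nonneg fun z => by positivity⟩
  have hrestrict : ∀ r ∈ S Ω, ∃ s ∈ S (U ∩ Ω), s ≤ r := by
    rintro r ⟨f, hf, h0, h1, h2, rfl⟩
    refine ⟨_, ⟨f, ⟨hf.1.mono inter_subset_right, hf.2.mono_set inter_subset_right⟩, h0, h1, h2,
      rfl⟩, ?_⟩
    exact setIntegral_mono_set hf.2 (.of_forall fun z => by positivity)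
      (LE.le.eventuallyLE inter_subset_right)
  have hextend : ∀ r ∈ S (U ∩ Ω), ∃ s ∈ S Ω, s ≤ C * r := by
    rintro r ⟨f, hf, h0, h1, h2, rfl⟩
    obtain ⟨F, hF, hF0, hF1, hF2, hFn⟩ := hext p hp f hf
    exact ⟨_, ⟨F, hF, hF0.trans h0, hF1.trans h1, (hF2 X Y).trans h2, rfl⟩, hFn⟩
  change sInf (S (U ∩ Ω)) ≤ sInf (S Ω) ∧ sInf (S Ω) ≤ C * sInf (S (U ∩ Ω))
  rcases (S (U ∩ Ω)).eq_empty_or_nonempty with he | hne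
  · have he' : S Ω = ∅ := eq_empty_of_forall_notMem fun r hr => by
      obtain ⟨s, hs, -⟩ := hrestrict r hr
      rwa [he] at hs
    simp [he, he']
  · have hne' : (S Ω).Nonempty := by
      obtain ⟨r, hr⟩ := hne
      obtain ⟨s, hs, -⟩ := hextend r hr
      exact ⟨s, hs⟩
    refine ⟨le_csInf hne' fun r hr => ?_, ?_⟩
    · obtain ⟨s, hs, hsr⟩ := hrestrict r hr
      exact (csInf_le (hbdd _) hs).trans hsr
    · rw [← div_le_iff₀' hC]
      refine le_csInf hne fun r hr => ?_
      obtain ⟨s, hs, hsr⟩ := hextend r hr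
      rw [div_le_iff₀' hC]
      exact (csInf_le (hbdd _) hs).trans hsr
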